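/- arXiv:2511.05164 — 4 statements merged into one kernel-verified Lean document; each statement's English description precedes it below -/
import Mathlib

section
/- Let q be a prime power which is not a prime. Then every irreducible complex character of PGL_2(q) of degree q−1 is unisingular. -/
open Module FDRep Matrix CategoryTheory

/-- A finite-dimensional complex representation of a group is *unisingular* if every group
element acts with `1` as an eigenvalue. -/
def FDRep.IsUnisingular {G : Type} [Monoid G] (V : FDRep ℂ G) : Prop :=
  ∀ g : G, Module.End.HasEigenvalue (V.ρ g) 1

/-- The projective general linear group: the quotient of `GL n R` by its center. -/
abbrev Matrix.ProjectiveGeneralLinearGroup (n : Type*) [DecidableEq n] [Fintype n]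
    (R : Type*) [CommRing R] : Type _ :=
  GL n R ⧸ Subgroup.center (GL n R)

/-- `PGL₂(F)`, the projective general linear group of degree 2 over `F`. -/
abbrev PGL2 (F : Type) [Field F] : Type _ :=
  Matrix.ProjectiveGeneralLinearGroup (Fin 2) F

/-- Schur's lemma, phrased for linear endomorphisms commuting with the action. -/
lemma FDRep.exists_eq_smul_one_of_commute {G : Type} [Group G] {V : FDRep ℂ G} (hV : Simple V)
    (f : Module.End ℂ V) (hf : ∀ g, f * V.ρ g = V.ρ g * f) : ∃ c : ℂ, f = c • 1 := by
  let φ : V ⟶ V :=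
    { hom := InducedCategory.homMk (ModuleCat.ofHom f)
      comm := fun g ↦ by
        ext v
        exact LinearMap.congr_fun (hf g) v }
  have h1 : Module.finrank ℂ (V ⟶ V) = 1 := by
    rw [finrank_hom_simple_simple, if_pos ⟨Iso.refl _⟩]
  obtain ⟨c, hc⟩ := (finrank_eq_one_iff_of_nonzero' (𝟙 V) (id_nonzero V)).1 h1 φ
  refine ⟨c, ?_⟩
  have := congrArg (fun ψ : V ⟶ V ↦ ψ.hom.hom.hom) hc
  exact this.symm

/-- A simple representation whose operators pairwise commute is one-dimensional. -/
lemma FDRep.finrank_eq_one_of_commute {G : Type} [Group G] [Fintype G] {V : FDRep ℂ G}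
    (hV : Simple V) (h : ∀ g g', V.ρ g * V.ρ g' = V.ρ g' * V.ρ g) :
    Module.finrank ℂ V = 1 := by
  choose c hc using fun g ↦ exists_eq_smul_one_of_commute hV (V.ρ g) (h g)
  have hc1 (g : G) : (Module.finrank ℂ V : ℂ) * (c g * c g⁻¹) = Module.finrank ℂ V := by
    have h1 : V.ρ g * V.ρ g⁻¹ = 1 := by rw [← map_mul, mul_inv_cancel, map_one]
    rw [hc g, hc g⁻¹] at h1
    have := congrArg (LinearMap.trace ℂ V) h1
    simp only [smul_mul_smul_comm, mul_one, map_smul, LinearMap.trace_one, smul_eq_mul] at this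
    rw [mul_comm, this]
  have hχ (g : G) : V.character g * V.character g⁻¹ = (Module.finrank ℂ V : ℂ) ^ 2 := by
    rw [FDRep.character, FDRep.character, hc g, hc g⁻¹, map_smul, map_smul, LinearMap.trace_one,
      smul_eq_mul, smul_eq_mul, sq]
    nth_rewrite 3 [← hc1 g]
    ring
  have := (FDRep.simple_iff_char_is_norm_one V).1 hV
  simp only [hχ, Finset.sum_const, nsmul_eq_mul, Finset.card_univ,
    ← Nat.card_eq_fintype_card] at this
  have hG : (Nat.card G : ℂ) ≠ 0 := by simp
  have h2 := mul_left_cancel₀ hG (this.trans (mul_one _).symm)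
  have h3 : Module.finrank ℂ V ^ 2 = 1 := by exact_mod_cast h2
  simpa using h3

/-- The group elements of a simple representation of dimension greater than one sum to zero. -/
lemma FDRep.sum_ρ_eq_zero {G : Type} [Group G] [Fintype G] {V : FDRep ℂ G}
    (hV : Simple V) (h1 : Module.finrank ℂ V ≠ 1) : ∑ g, V.ρ g = 0 := by
  have hl (g : G) : V.ρ g * ∑ x, V.ρ x = ∑ x, V.ρ x := by
    rw [Finset.mul_sum]
    exact Fintype.sum_equiv (Equiv.mulLeft g) _ _ fun x ↦ (map_mul V.ρ g x).symm
  have hr (g : G) : (∑ x, V.ρ x) * V.ρ g = ∑ x, V.ρ x := by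
    rw [Finset.sum_mul]
    exact Fintype.sum_equiv (Equiv.mulRight g) _ _ fun x ↦ (map_mul V.ρ x g).symm
  obtain ⟨c, hc⟩ := exists_eq_smul_one_of_commute hV _ fun g ↦ (hr g).trans (hl g).symm
  by_contra h0
  have hc0 : c ≠ 0 := by rintro rfl; exact h0 (by rw [hc, zero_smul])
  refine h1 (finrank_eq_one_of_commute hV fun g g' ↦ ?_)
  have h (g : G) : V.ρ g = 1 := by
    have := hl g
    rw [hc, mul_smul_comm, mul_one] at this
    exact smul_right_injective _ hc0 this
  rw [h g, h g']

namespace Matrix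

/-- A nonscalar `2 × 2` matrix is similar to the companion matrix of its characteristic
polynomial. -/
lemma exists_mul_eq_mul_companion {F : Type*} [Field F] {A : Matrix (Fin 2) (Fin 2) F}
    (hA : ∀ c : F, A ≠ c • 1) :
    ∃ P : Matrix (Fin 2) (Fin 2) F, P.det ≠ 0 ∧ A * P = P * !![0, -A.det; 1, A.trace] := by
  have key (x y : F) (h : x * (A 1 0 * x + A 1 1 * y) - y * (A 0 0 * x + A 0 1 * y) ≠ 0) :
      ∃ P : Matrix (Fin 2) (Fin 2) F, P.det ≠ 0 ∧ A * P = P * !![0, -A.det; 1, A.trace] := by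
    refine ⟨!![x, A 0 0 * x + A 0 1 * y; y, A 1 0 * x + A 1 1 * y], ?_, ?_⟩
    · rw [det_fin_two_of]
      convert h using 1
      ring
    · ext i j
      fin_cases i <;> fin_cases j <;>
        simp [mul_apply, Fin.sum_univ_two, det_fin_two, trace_fin_two] <;> ring
  by_cases h10 : A 1 0 = 0
  · by_cases h01 : A 0 1 = 0
    · refine key 1 1 fun h ↦ hA (A 0 0) ?_
      have h11 : A 1 1 = A 0 0 := by
        rw [h10, h01] at h
        linear_combination h
      ext i j
      fin_cases i <;> fin_cases j <;> simp [h10, h01, h11]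
    · exact key 0 1 (by simpa using h01)
  · exact key 1 0 (by simpa using h10)

/-- Nonscalar `2 × 2` matrices with the same trace and determinant are similar. -/
lemma exists_mul_eq_mul_of_trace_eq_of_det_eq {F : Type*} [Field F]
    {A B : Matrix (Fin 2) (Fin 2) F} (hA : ∀ c : F, A ≠ c • 1) (hB : ∀ c : F, B ≠ c • 1)
    (ht : A.trace = B.trace) (hd : A.det = B.det) :
    ∃ P : Matrix (Fin 2) (Fin 2) F, P.det ≠ 0 ∧ A * P = P * B := by
  obtain ⟨P, hP, hAP⟩ := exists_mul_eq_mul_companion hA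
  obtain ⟨Q, hQ, hBQ⟩ := exists_mul_eq_mul_companion hB
  have hQu : IsUnit Q.det := hQ.isUnit
  refine ⟨P * Q⁻¹, ?_, ?_⟩
  · rw [det_mul, det_nonsing_inv, Ring.inverse_eq_inv']
    exact mul_ne_zero hP (inv_ne_zero hQ)
  · rw [← Matrix.mul_assoc, hAP, ht, hd, Matrix.mul_assoc, Matrix.mul_assoc]
    congr 1
    calc _ = Q⁻¹ * (Q * !![0, -B.det; 1, B.trace]) * Q⁻¹ := by
            rw [← Matrix.mul_assoc Q⁻¹, nonsing_inv_mul _ hQu, Matrix.one_mul]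
      _ = Q⁻¹ * B := by
            rw [← hBQ, ← Matrix.mul_assoc, Matrix.mul_assoc, mul_nonsing_inv _ hQu, Matrix.mul_one]

lemma det_sub_smul_one_fin_two {F : Type*} [CommRing F] (A : Matrix (Fin 2) (Fin 2) F) (a : F) :
    (A - a • 1).det = a ^ 2 - A.trace * a + A.det := by
  simp [det_fin_two, trace_fin_two]
  ring

lemma det_smul_add_smul_one_fin_two {F : Type*} [CommRing F] (A : Matrix (Fin 2) (Fin 2) F)
    (s t : F) : (s • A + t • 1).det = s ^ 2 * A.det + s * t * A.trace + t ^ 2 := by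
  simp [det_fin_two, trace_fin_two]
  ring

lemma trace_smul_add_smul_one_fin_two {F : Type*} [CommRing F] (A : Matrix (Fin 2) (Fin 2) F)
    (s t : F) : (s • A + t • 1).trace = s * A.trace + 2 * t := by
  simp [trace_fin_two]
  ring

lemma smul_add_smul_one_ne {F : Type*} [Field F] {A : Matrix (Fin 2) (Fin 2) F}
    (hA : ∀ c : F, A ≠ c • 1) {s : F} (hs : s ≠ 0) (t c : F) : s • A + t • 1 ≠ c • 1 := by
  intro h
  refine hA (s⁻¹ * (c - t)) ?_
  rw [mul_smul, sub_smul, ← h, add_sub_cancel_right, smul_smul, inv_mul_cancel₀ hs, one_smul]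

/-- A nonscalar `2 × 2` matrix with an eigenvalue is, up to similarity and affine change, one of the
matrix units `E₁₁` and `E₁₂`. -/
lemma exists_affine_mul_eq_mul_of_det_sub_eq_zero {F : Type*} [Field F]
    {A : Matrix (Fin 2) (Fin 2) F} (hA : ∀ c : F, A ≠ c • 1) {a : F} (ha : (A - a • 1).det = 0) :
    (∃ (s t : F) (P : Matrix (Fin 2) (Fin 2) F), s ≠ 0 ∧ P.det ≠ 0 ∧
      (s • A + t • 1) * P = P * !![1, 0; 0, 0]) ∨
    ∃ (P : Matrix (Fin 2) (Fin 2) F), P.det ≠ 0 ∧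
      (A - a • 1) * P = P * !![0, 1; 0, 0] := by
  rw [det_sub_smul_one_fin_two] at ha
  by_cases h : A.trace = 2 * a
  · right
    refine exists_mul_eq_mul_of_trace_eq_of_det_eq ?_ ?_ ?_ ?_
    · intro c hc
      exact hA (c + a) (by rw [add_smul, ← hc, sub_add_cancel])
    · intro c hc
      simpa using congrFun (congrFun hc 0) 1
    · simp [trace_fin_two] at h ⊢
      linear_combination h
    · rw [det_sub_smul_one_fin_two, ha]
      simp [det_fin_two]
  · left
    have hs : A.trace - 2 * a ≠ 0 := sub_ne_zero.2 h
    refine ⟨(A.trace - 2 * a)⁻¹, -(a * (A.trace - 2 * a)⁻¹), ?_⟩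
    refine (exists_mul_eq_mul_of_trace_eq_of_det_eq (smul_add_smul_one_ne hA (inv_ne_zero hs) _)
      ?_ ?_ ?_).imp fun P hP ↦ ⟨inv_ne_zero hs, hP⟩
    · intro c hc
      have h0 := congrFun (congrFun hc 0) 0
      have h1 := congrFun (congrFun hc 1) 1
      simp at h0 h1
      exact one_ne_zero (h0.trans h1.symm)
    · rw [trace_smul_add_smul_one_fin_two]
      simp [trace_fin_two] at hs ⊢
      field_simp
      ring
    · rw [det_smul_add_smul_one_fin_two, det_fin_two_of]
      linear_combination (A.trace - 2 * a)⁻¹ ^ 2 * ha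

open Polynomial in
/-- Over a finite field, any two `2 × 2` matrices without eigenvalues agree up to similarity and
affine change. -/
lemma exists_affine_mul_eq_mul_of_det_sub_ne_zero {F : Type*} [Field F] [Finite F]
    {A B : Matrix (Fin 2) (Fin 2) F} (hA : ∀ a : F, (A - a • 1).det ≠ 0)
    (hB : ∀ a : F, (B - a • 1).det ≠ 0) :
    ∃ (s t : F) (P : Matrix (Fin 2) (Fin 2) F), s ≠ 0 ∧ P.det ≠ 0 ∧
      (s • A + t • 1) * P = P * B := by
  have nonscalar {A : Matrix (Fin 2) (Fin 2) F} (hA : ∀ a : F, (A - a • 1).det ≠ 0) (c : F) :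
      A ≠ c • 1 := by
    rintro rfl
    exact hA c (by simp)
  have irr {A : Matrix (Fin 2) (Fin 2) F} (hA : ∀ a : F, (A - a • 1).det ≠ 0) :
      Irreducible A.charpoly := by
    have hd : A.charpoly.natDegree = 2 := by simp [charpoly_natDegree_eq_dim]
    refine (Polynomial.irreducible_iff_roots_eq_zero_of_degree_le_three hd.ge (by omega)).2 ?_
    refine Multiset.eq_zero_of_forall_notMem fun a ha ↦ hA a ?_
    have := (mem_roots'.1 ha).2
    rw [charpoly_fin_two] at this
    simp at this
    rw [det_sub_smul_one_fin_two, this]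
  have eqn {A : Matrix (Fin 2) (Fin 2) F} [Fact (Irreducible A.charpoly)] :
      (AdjoinRoot.root A.charpoly) ^ 2 = algebraMap F _ A.trace * AdjoinRoot.root A.charpoly
        - algebraMap F (AdjoinRoot A.charpoly) A.det := by
    have h : aeval (AdjoinRoot.root A.charpoly) (X ^ 2 - C A.trace * X + C A.det) = 0 := by
      rw [← charpoly_fin_two, AdjoinRoot.aeval_eq, AdjoinRoot.mk_self]
    simp at h
    rw [AdjoinRoot.algebraMap_eq]
    linear_combination h
  have iA := Fact.mk (irr hA)
  have iB := Fact.mk (irr hB)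
  have finrk {A : Matrix (Fin 2) (Fin 2) F} [Fact (Irreducible A.charpoly)] :
      Module.finrank F (AdjoinRoot A.charpoly) = 2 := by
    rw [(AdjoinRoot.powerBasis' (charpoly_monic A)).finrank, AdjoinRoot.powerBasis'_dim,
      charpoly_natDegree_eq_dim, Fintype.card_fin]
  have : Module.Finite F (AdjoinRoot A.charpoly) :=
    Module.finite_of_finrank_pos (by rw [finrk]; norm_num)
  have : Module.Finite F (AdjoinRoot B.charpoly) :=
    Module.finite_of_finrank_pos (by rw [finrk]; norm_num)
  have : Finite (AdjoinRoot A.charpoly) := Module.finite_of_finite F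
  obtain ⟨φ⟩ := FiniteField.nonempty_algHom_of_finrank_dvd (F := F)
    (K := AdjoinRoot B.charpoly) (L := AdjoinRoot A.charpoly) (by rw [finrk, finrk])
  set α := AdjoinRoot.root A.charpoly with hα
  obtain ⟨s, t, hst⟩ : ∃ s t : F, φ (AdjoinRoot.root B.charpoly) =
      algebraMap F _ s * α + algebraMap F _ t := by
    obtain ⟨f, hf⟩ := AdjoinRoot.mk_surjective (φ (AdjoinRoot.root B.charpoly))
    have hdeg : (f %ₘ A.charpoly).natDegree ≤ 1 := by
      have := natDegree_modByMonic_lt f (charpoly_monic A) (irr hA).ne_one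
      rw [charpoly_natDegree_eq_dim, Fintype.card_fin] at this
      omega
    obtain ⟨s, t, h⟩ := exists_eq_X_add_C_of_natDegree_le_one hdeg
    refine ⟨s, t, ?_⟩
    rw [← hf, ← modByMonic_add_div f A.charpoly, h]
    simp [hα]
  have hB2 := congrArg φ (eqn (A := B))
  rw [map_pow, map_sub, map_mul, AlgHom.commutes, AlgHom.commutes, hst] at hB2
  have indep (x y : F) (h : algebraMap F (AdjoinRoot A.charpoly) x * α + algebraMap F _ y = 0) :
      x = 0 ∧ y = 0 := by
    have h' : AdjoinRoot.mk A.charpoly (C x * X + C y) = 0 := by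
      simpa [hα] using h
    rw [AdjoinRoot.mk_eq_zero] at h'
    have h0 : (C x * X + C y : F[X]) = 0 := by
      refine eq_zero_of_dvd_of_natDegree_lt h' ?_
      rw [charpoly_natDegree_eq_dim, Fintype.card_fin]
      exact (natDegree_linear_le).trans_lt (by norm_num)
    have e1 := congrArg (coeff · 1) h0
    have e0 := congrArg (coeff · 0) h0
    simp [coeff_C] at e1 e0
    exact ⟨e1, e0⟩
  obtain ⟨h1, h2⟩ := indep (s ^ 2 * A.trace + 2 * s * t - B.trace * s)
    (t ^ 2 - s ^ 2 * A.det - B.trace * t + B.det) (by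
      simp only [map_add, map_sub, map_mul, map_pow, map_ofNat]
      linear_combination hB2 - algebraMap F _ s ^ 2 * eqn (A := A))
  have hs : s ≠ 0 := by
    rintro rfl
    refine hB t ?_
    rw [det_sub_smul_one_fin_two]
    linear_combination h2
  have ht : s * A.trace + 2 * t = B.trace := mul_left_cancel₀ hs (by linear_combination h1)
  obtain ⟨P, hP⟩ := exists_mul_eq_mul_of_trace_eq_of_det_eq
    (smul_add_smul_one_ne (nonscalar hA) hs t) (nonscalar hB)
    ((trace_smul_add_smul_one_fin_two _ _ _).trans ht) (by
      rw [det_smul_add_smul_one_fin_two]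
      linear_combination t * ht - h2)
  exact ⟨s, t, P, hs, hP⟩

end Matrix

section Unipotent

variable {F : Type*} [Field F] [Fintype F] {V : Type*} [AddCommGroup V] [Module ℂ V]
  (R : Matrix (Fin 2) (Fin 2) F →* Module.End ℂ V)

/-- The Fourier coefficient at the character `x ↦ ψ (a * x)` of the action of the upper
unitriangular matrices. -/
noncomputable def unipotentFourier (ψ : AddChar F ℂ) (a : F) : Module.End ℂ V :=
  ∑ x, ψ (x * a) • R !![1, x; 0, 1]

lemma unipotent_mul_unipotentFourier (ψ : AddChar F ℂ) (a y : F) :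
    R !![1, y; 0, 1] * unipotentFourier R ψ a = ψ (-(y * a)) • unipotentFourier R ψ a := by
  rw [unipotentFourier, Finset.mul_sum, Finset.smul_sum]
  refine Fintype.sum_equiv (Equiv.addLeft y) _ _ fun x ↦ ?_
  rw [mul_smul_comm, ← map_mul, smul_smul, Equiv.coe_addLeft, ← AddChar.map_add_eq_mul]
  congr 2
  · ring
  · ext i j
    fin_cases i <;> fin_cases j <;> simp [mul_apply, Fin.sum_univ_two, add_comm]

lemma torus_mul_unipotentFourier (ψ : AddChar F ℂ) {c : F} (hc : c ≠ 0) (a : F) :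
    R !![c, 0; 0, 1] * unipotentFourier R ψ (c * a) =
      unipotentFourier R ψ a * R !![c, 0; 0, 1] := by
  rw [unipotentFourier, unipotentFourier, Finset.mul_sum, Finset.sum_mul]
  refine Fintype.sum_equiv (Equiv.mulLeft₀ c hc) _ _ fun x ↦ ?_
  rw [mul_smul_comm, smul_mul_assoc, ← map_mul R, ← map_mul R, Equiv.mulLeft₀_apply]
  congr 2
  · ring
  · ext i j
    fin_cases i <;> fin_cases j <;> simp [mul_apply, Fin.sum_univ_two]

lemma unipotentFourier_mul [DecidableEq F] {ψ : AddChar F ℂ} (hψ : ψ.IsPrimitive) (a b : F) :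
    unipotentFourier R ψ b * unipotentFourier R ψ a =
      if a = b then (Fintype.card F : ℂ) • unipotentFourier R ψ a else 0 := by
  have h : unipotentFourier R ψ b * unipotentFourier R ψ a =
      (∑ y, ψ (y * (b - a))) • unipotentFourier R ψ a := by
    nth_rewrite 1 [unipotentFourier]
    rw [Finset.sum_mul, Finset.sum_smul]
    refine Finset.sum_congr rfl fun y _ ↦ ?_
    rw [smul_mul_assoc, unipotent_mul_unipotentFourier, smul_smul, ← AddChar.map_add_eq_mul]
    congr 2
    ring
  rw [h, AddChar.sum_mulShift _ hψ]
  by_cases hab : a = b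
  · simp [hab]
  · simp [hab, sub_eq_zero, Ne.symm hab]

lemma sum_unipotentFourier {ψ : AddChar F ℂ} (hψ : ψ.IsPrimitive) :
    ∑ a, unipotentFourier R ψ a = (Fintype.card F : ℂ) • 1 := by
  classical
  simp only [unipotentFourier]
  rw [Finset.sum_comm]
  have h (x : F) : ∑ a, ψ (x * a) • R !![1, x; 0, 1] =
      (if x = 0 then (Fintype.card F : ℂ) else 0) • R !![1, x; 0, 1] := by
    rw [← Finset.sum_smul]
    simp only [mul_comm x, AddChar.sum_mulShift _ hψ, Nat.cast_ite, Nat.cast_zero]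
  rw [Finset.sum_congr rfl fun x _ ↦ h x]
  rw [Finset.sum_eq_single 0]
  · rw [if_pos rfl, ← Matrix.one_fin_two, map_one]
  · intro x _ hx
    simp [hx]
  · simp

omit [Fintype F] in
lemma torus_mul_torus_inv {c : F} (hc : c ≠ 0) : R !![c, 0; 0, 1] * R !![c⁻¹, 0; 0, 1] = 1 := by
  rw [← map_mul, ← map_one R]
  congr 1
  ext i j
  fin_cases i <;> fin_cases j <;> simp [mul_apply, Fin.sum_univ_two, hc]

lemma trace_unipotentFourier_eq (ψ : AddChar F ℂ) {a : F} (ha : a ≠ 0) :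
    LinearMap.trace ℂ V (unipotentFourier R ψ a) =
      LinearMap.trace ℂ V (unipotentFourier R ψ 1) := by
  have h := torus_mul_unipotentFourier R ψ ha 1
  rw [mul_one] at h
  calc _ = LinearMap.trace ℂ V
        (R !![a⁻¹, 0; 0, 1] * (R !![a, 0; 0, 1] * unipotentFourier R ψ a)) := by
        have := torus_mul_torus_inv R (inv_ne_zero ha)
        rw [inv_inv] at this
        rw [← mul_assoc, this, one_mul]
    _ = _ := by
        rw [h, LinearMap.trace_mul_comm, mul_assoc, torus_mul_torus_inv R ha, mul_one]

variable [FiniteDimensional ℂ V]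

lemma exists_trace_unipotentFourier {ψ : AddChar F ℂ} (hψ : ψ.IsPrimitive) (a : F) :
    ∃ n : ℕ, LinearMap.trace ℂ V (unipotentFourier R ψ a) = Fintype.card F * n ∧
      (n = 0 → unipotentFourier R ψ a = 0) := by
  classical
  have hq : (Fintype.card F : ℂ) ≠ 0 := by simp
  set E := (Fintype.card F : ℂ)⁻¹ • unipotentFourier R ψ a with hE
  have hP : unipotentFourier R ψ a = (Fintype.card F : ℂ) • E := by
    rw [hE, smul_smul, mul_inv_cancel₀ hq, one_smul]
  have hid : IsIdempotentElem E := by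
    rw [IsIdempotentElem, hE, smul_mul_smul_comm, unipotentFourier_mul R hψ, if_pos rfl, smul_smul]
    congr 1
    field_simp
  have htr := (LinearMap.IsIdempotentElem.isProj_range E hid).trace
  refine ⟨_, by rw [hP, map_smul, htr, smul_eq_mul], fun h0 ↦ ?_⟩
  rw [h0, Nat.cast_zero] at htr
  rw [hP, LinearMap.IsIdempotentElem.eq_zero_of_trace_eq_zero hid htr, smul_zero]

/-- If the unitriangular matrices act nontrivially on a space of dimension `q - 1`, each nontrivial
character occurs exactly once. -/
lemma unipotentFourier_zero_eq_zero (hdim : Module.finrank ℂ V = Fintype.card F - 1)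
    (hU : ∃ x, R !![1, x; 0, 1] ≠ 1) {ψ : AddChar F ℂ} (hψ : ψ.IsPrimitive) :
    unipotentFourier R ψ 0 = 0 := by
  classical
  have hq : (Fintype.card F : ℂ) ≠ 0 := by simp
  have hq1 : 1 < Fintype.card F := Fintype.one_lt_card
  obtain ⟨m, hm, hm0⟩ := exists_trace_unipotentFourier R hψ 0
  obtain ⟨k, hk, hk0⟩ := exists_trace_unipotentFourier R hψ 1
  refine hm0 ?_
  have hsum := sum_unipotentFourier R hψ
  rw [← Finset.add_sum_erase _ _ (Finset.mem_univ 0)] at hsum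
  have hcount : m + (Fintype.card F - 1) * k = Fintype.card F - 1 := by
    have h := congrArg (LinearMap.trace ℂ V) hsum
    rw [map_add, map_sum, Finset.sum_congr rfl (g := fun _ ↦ (Fintype.card F : ℂ) * k)
      (fun a ha ↦ (trace_unipotentFourier_eq R ψ (Finset.ne_of_mem_erase ha)).trans hk), hm,
      map_smul, LinearMap.trace_one, hdim, Finset.sum_const, Finset.card_erase_of_mem
      (Finset.mem_univ _), Finset.card_univ, nsmul_eq_mul, smul_eq_mul, mul_left_comm,
      ← mul_add] at h
    exact_mod_cast mul_left_cancel₀ hq h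
  rcases Nat.eq_zero_or_pos k with rfl | hkpos
  · exfalso
    obtain ⟨x, hx⟩ := hU
    have h1 : unipotentFourier R ψ 1 = 0 := hk0 rfl
    have hall (a : F) (ha : a ≠ 0) : unipotentFourier R ψ a = 0 := by
      have h := torus_mul_unipotentFourier R ψ (inv_ne_zero ha) a
      rw [inv_mul_cancel₀ ha, h1, mul_zero] at h
      rw [← mul_one (unipotentFourier R ψ a), ← torus_mul_torus_inv R (inv_ne_zero ha), ← mul_assoc,
        ← h, zero_mul]
    rw [Finset.sum_eq_zero fun a ha ↦ hall a (Finset.ne_of_mem_erase ha), add_zero] at hsum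
    have h := unipotent_mul_unipotentFourier R ψ 0 x
    rw [hsum, mul_zero, neg_zero, AddChar.map_zero_eq_one, one_smul, mul_smul_comm, mul_one] at h
    exact hx (smul_right_injective _ hq h)
  · have : Fintype.card F - 1 ≤ (Fintype.card F - 1) * k := Nat.le_mul_of_pos_right _ hkpos
    omega

lemma exists_isPrimitive_addChar_complex (F : Type*) [Field F] [Finite F] :
    ∃ ψ : AddChar F ℂ, ψ.IsPrimitive := by
  have := Fintype.ofFinite F
  have : Nontrivial (AddChar F ℂ) := by
    rw [← Fintype.one_lt_card_iff_nontrivial, AddChar.card_eq]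
    exact Fintype.one_lt_card
  obtain ⟨ψ, hψ⟩ := exists_ne (1 : AddChar F ℂ)
  exact ⟨ψ, AddChar.IsPrimitive.of_ne_one hψ⟩

lemma sum_unipotent_eq_zero (hdim : Module.finrank ℂ V = Fintype.card F - 1)
    (hU : ∃ x, R !![1, x; 0, 1] ≠ 1) : ∑ x, R !![1, x; 0, 1] = 0 := by
  obtain ⟨ψ, hψ⟩ := exists_isPrimitive_addChar_complex F
  simpa [unipotentFourier] using unipotentFourier_zero_eq_zero R hdim hU hψ

lemma trace_torus_eq_zero (hdim : Module.finrank ℂ V = Fintype.card F - 1)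
    (hU : ∃ x, R !![1, x; 0, 1] ≠ 1) {c : F} (hc0 : c ≠ 0) (hc1 : c ≠ 1) :
    LinearMap.trace ℂ V (R !![c, 0; 0, 1]) = 0 := by
  classical
  obtain ⟨ψ, hψ⟩ := exists_isPrimitive_addChar_complex F
  have hq : (Fintype.card F : ℂ) ≠ 0 := by simp
  refine (mul_eq_zero.1 (?_ : (Fintype.card F : ℂ) * _ = 0)).resolve_left hq
  rw [← smul_eq_mul, ← map_smul, ← mul_one (R _), ← mul_smul_comm, ← sum_unipotentFourier R hψ,
    Finset.mul_sum, map_sum]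
  refine Finset.sum_eq_zero fun a _ ↦ ?_
  rcases eq_or_ne a 0 with rfl | ha
  · rw [unipotentFourier_zero_eq_zero R hdim hU hψ, mul_zero, map_zero]
  refine (mul_eq_zero.1 (?_ : (Fintype.card F : ℂ) * _ = 0)).resolve_left hq
  have h := torus_mul_unipotentFourier R ψ hc0 (c⁻¹ * a)
  rw [mul_inv_cancel_left₀ hc0] at h
  have hne : c⁻¹ * a ≠ a := by
    intro h'
    exact hc1 (inv_eq_one.1 (mul_right_cancel₀ ha (h'.trans (one_mul a).symm)))
  have h2 := unipotentFourier_mul R hψ a a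
  rw [if_pos rfl] at h2
  rw [← smul_eq_mul, ← map_smul, ← mul_smul_comm, ← h2, ← mul_assoc, LinearMap.trace_mul_comm, h,
    ← mul_assoc, unipotentFourier_mul R hψ, if_neg hne, zero_mul, map_zero]

/-- The character value at a nontrivial unipotent element is `-1`. -/
lemma trace_unipotent (hdim : Module.finrank ℂ V = Fintype.card F - 1)
    (hU : ∃ x, R !![1, x; 0, 1] ≠ 1) {x : F} (hx : x ≠ 0) :
    LinearMap.trace ℂ V (R !![1, x; 0, 1]) = -1 := by
  classical
  have hconj (y : F) (hy : y ≠ 0) :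
      LinearMap.trace ℂ V (R !![1, y; 0, 1]) = LinearMap.trace ℂ V (R !![1, 1; 0, 1]) := by
    have h : R !![1, y; 0, 1] = R !![y, 0; 0, 1] * R !![1, 1; 0, 1] * R !![y⁻¹, 0; 0, 1] := by
      rw [← map_mul, ← map_mul]
      congr 1
      ext i j
      fin_cases i <;> fin_cases j <;> simp [mul_apply, Fin.sum_univ_two, hy]
    have hi := torus_mul_torus_inv R (inv_ne_zero hy)
    rw [inv_inv] at hi
    rw [h, LinearMap.trace_mul_comm, ← mul_assoc, hi, one_mul]
  have h := congrArg (LinearMap.trace ℂ V) (sum_unipotent_eq_zero R hdim hU)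
  have hq1 : 1 < Fintype.card F := Fintype.one_lt_card
  rw [← Finset.add_sum_erase _ _ (Finset.mem_univ 0), ← Matrix.one_fin_two, map_one, map_add,
    map_sum, Finset.sum_congr rfl (fun y hy ↦ hconj y (Finset.ne_of_mem_erase hy)),
    Finset.sum_const, Finset.card_erase_of_mem (Finset.mem_univ _), Finset.card_univ,
    LinearMap.trace_one, hdim, nsmul_eq_mul, map_zero] at h
  have hq : ((Fintype.card F - 1 : ℕ) : ℂ) ≠ 0 := by
    rw [Nat.cast_ne_zero]
    omega
  rw [hconj x hx]
  exact mul_left_cancel₀ hq (by linear_combination h)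

end Unipotent

lemma card_matrix_fin_two (F : Type*) [Fintype F] :
    Fintype.card (Matrix (Fin 2) (Fin 2) F) = Fintype.card F ^ 4 := by
  change Fintype.card (Fin 2 → Fin 2 → F) = _
  simp only [Fintype.card_fun, Fintype.card_fin]
  ring

section Pencil

variable {F : Type*} [Field F] [Fintype F] {V : Type*} [AddCommGroup V] [Module ℂ V]
  (R : Matrix (Fin 2) (Fin 2) F →* Module.End ℂ V)

/-- The sum of a multiplicative map over the pencil of matrices spanned by `A` and `1`. -/
noncomputable def pencilSum (A : Matrix (Fin 2) (Fin 2) F) : Module.End ℂ V :=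
  ∑ s : F, ∑ t : F, R (s • A + t • 1)

lemma pencilSum_smul_add_smul_one (A : Matrix (Fin 2) (Fin 2) F) {s : F} (hs : s ≠ 0) (t : F) :
    pencilSum R (s • A + t • 1) = pencilSum R A := by
  refine Fintype.sum_equiv (Equiv.mulRight₀ s hs) _ _ fun s' ↦ ?_
  refine Fintype.sum_equiv (Equiv.addLeft (s' * t)) _ _ fun t' ↦ ?_
  congr 1
  simp only [Equiv.mulRight₀_apply, Equiv.coe_addLeft, smul_add, add_smul, smul_smul, add_assoc]

lemma pencilSum_mul_eq {A B P : Matrix (Fin 2) (Fin 2) F} (h : A * P = P * B) :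
    pencilSum R A * R P = R P * pencilSum R B := by
  simp only [pencilSum, Finset.sum_mul, Finset.mul_sum, ← map_mul]
  refine Finset.sum_congr rfl fun s _ ↦ Finset.sum_congr rfl fun t _ ↦ ?_
  rw [add_mul, mul_add, Matrix.smul_mul, h, Matrix.mul_smul, Matrix.smul_mul, Matrix.mul_smul,
    Matrix.one_mul, Matrix.mul_one]

omit [Fintype F] in
lemma map_mul_map_nonsing_inv {P : Matrix (Fin 2) (Fin 2) F} (hP : P.det ≠ 0) :
    R P * R P⁻¹ = 1 := by
  rw [← map_mul, mul_nonsing_inv _ hP.isUnit, map_one]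

lemma trace_pencilSum_eq {A B P : Matrix (Fin 2) (Fin 2) F} {s t : F} (hs : s ≠ 0)
    (hP : P.det ≠ 0) (h : (s • A + t • 1) * P = P * B) :
    LinearMap.trace ℂ V (pencilSum R A) = LinearMap.trace ℂ V (pencilSum R B) := by
  have h1 := pencilSum_mul_eq R h
  rw [pencilSum_smul_add_smul_one R A hs] at h1
  rw [← mul_one (pencilSum R A), ← map_mul_map_nonsing_inv R hP, ← mul_assoc, h1,
    LinearMap.trace_mul_comm, ← mul_assoc, ← map_mul, nonsing_inv_mul _ hP.isUnit, map_one, one_mul]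

/-- The units of the algebra generated by `A` fix the pencil sum. -/
lemma map_mul_pencilSum {A : Matrix (Fin 2) (Fin 2) F} (hA : A.det ≠ 0) :
    R A * pencilSum R A = pencilSum R A := by
  have h (s t : F) : A * (s • A + t • 1) = (s * A.trace + t) • A + (-(s * A.det)) • 1 := by
    ext i j
    fin_cases i <;> fin_cases j <;>
      simp [mul_apply, Fin.sum_univ_two, det_fin_two, trace_fin_two] <;> ring
  simp only [pencilSum, ← Fintype.sum_prod_type', Finset.mul_sum, ← map_mul, h]
  refine Function.Bijective.sum_comp (e := fun x : F × F ↦ (x.1 * A.trace + x.2, -(x.1 * A.det)))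
    ?_ fun x : F × F ↦ R (x.1 • A + x.2 • 1)
  refine Finite.injective_iff_bijective.1 fun x y hxy ↦ ?_
  simp only [Prod.mk.injEq, neg_inj] at hxy
  have h1 := mul_right_cancel₀ hA hxy.2
  exact Prod.ext h1 (by simpa [h1] using hxy.1)

variable (hs : ∀ c : F, c ≠ 0 → R (c • 1) = 1)
include hs

omit [Fintype F] in
lemma map_smul_matrix {c : F} (hc : c ≠ 0) (M : Matrix (Fin 2) (Fin 2) F) : R (c • M) = R M := by
  rw [← one_mul M, ← smul_mul, map_mul, hs c hc, one_mul, Matrix.one_mul]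

variable (h0 : ∀ M, M.det = 0 → R M = 0)
include h0

lemma sum_map_smul_one : ∑ t : F, R (t • 1) = ((Fintype.card F - 1 : ℕ) : ℂ) • 1 := by
  classical
  rw [← Finset.add_sum_erase _ _ (Finset.mem_univ 0), h0 _ (by simp),
    Finset.sum_congr rfl fun t ht ↦ hs t (Finset.ne_of_mem_erase ht), Finset.sum_const,
    Finset.card_erase_of_mem (Finset.mem_univ _), Finset.card_univ, zero_add,
    Nat.cast_smul_eq_nsmul]

lemma pencilSum_smul_one (c : F) :
    pencilSum R (c • 1) = (Fintype.card F * (Fintype.card F - 1 : ℕ) : ℂ) • 1 := by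
  have h (s : F) : ∑ t : F, R (s • c • 1 + t • 1) = ((Fintype.card F - 1 : ℕ) : ℂ) • 1 := by
    rw [← sum_map_smul_one R hs h0]
    refine Fintype.sum_equiv (Equiv.addLeft (s * c)) _ _ fun t ↦ ?_
    rw [Equiv.coe_addLeft, add_smul, smul_smul]
  rw [pencilSum, Finset.sum_congr rfl fun s _ ↦ h s, Finset.sum_const, Finset.card_univ, mul_smul,
    Nat.cast_smul_eq_nsmul ℂ (Fintype.card F)]

lemma pencilSum_unipotent (hu : ∑ x, R !![1, x; 0, 1] = 0) : pencilSum R !![0, 1; 0, 0] = 0 := by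
  rw [pencilSum, Finset.sum_comm]
  refine Finset.sum_eq_zero fun t _ ↦ ?_
  rcases eq_or_ne t 0 with rfl | ht
  · exact Finset.sum_eq_zero fun s _ ↦ h0 _ (by simp)
  · rw [← hu]
    refine Fintype.sum_equiv (Equiv.mulLeft₀ t⁻¹ (inv_ne_zero ht)) _ _ fun s ↦ ?_
    rw [← map_smul_matrix R hs (inv_ne_zero ht)]
    congr 1
    ext i j
    fin_cases i <;> fin_cases j <;> simp [ht]

lemma trace_pencilSum_torus [FiniteDimensional ℂ V]
    (ht : ∀ c : F, c ≠ 0 → c ≠ 1 → LinearMap.trace ℂ V (R !![c, 0; 0, 1]) = 0) :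
    LinearMap.trace ℂ V (pencilSum R !![1, 0; 0, 0]) =
      (Fintype.card F - 1 : ℕ) * Module.finrank ℂ V := by
  classical
  have hsum : ∑ c : F, LinearMap.trace ℂ V (R !![c, 0; 0, 1]) = Module.finrank ℂ V := by
    rw [Finset.sum_eq_single 1, ← Matrix.one_fin_two, map_one, LinearMap.trace_one]
    · intro c _ hc1
      rcases eq_or_ne c 0 with rfl | hc0
      · rw [h0 _ (by simp [det_fin_two]), map_zero]
      · exact ht c hc0 hc1
    · simp
  rw [pencilSum, Finset.sum_comm, map_sum, ← Finset.add_sum_erase _ _ (Finset.mem_univ 0),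
    Finset.sum_congr rfl (g := fun _ ↦ (Module.finrank ℂ V : ℂ)), Finset.sum_const,
    Finset.card_erase_of_mem (Finset.mem_univ _), Finset.card_univ, nsmul_eq_mul,
    Finset.sum_eq_zero, map_zero, zero_add]
  · exact fun s _ ↦ h0 _ (by simp [det_fin_two])
  · intro t ht
    have ht0 := Finset.ne_of_mem_erase ht
    rw [map_sum, ← hsum]
    refine Fintype.sum_equiv ((Equiv.addRight t).trans (Equiv.mulLeft₀ t⁻¹ (inv_ne_zero ht0))) _ _
      fun s ↦ ?_
    rw [← map_smul_matrix R hs (inv_ne_zero ht0)]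
    congr 2
    ext i j
    fin_cases i <;> fin_cases j <;> simp [ht0]

lemma sum_pencilSum (hR : ∑ M, R M = 0) :
    ∑ A, pencilSum R A =
      ((Fintype.card F : ℂ) ^ 4 * (Fintype.card F - 1 : ℕ)) • (1 : Module.End ℂ V) := by
  classical
  simp only [pencilSum]
  rw [Finset.sum_comm, Finset.sum_eq_single 0]
  · simp only [zero_smul, zero_add, sum_map_smul_one R hs h0, Finset.sum_const, Finset.card_univ]
    rw [← Nat.cast_smul_eq_nsmul ℂ, smul_smul, card_matrix_fin_two, Nat.cast_pow]
  · intro s _ hs0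
    rw [Finset.sum_comm]
    refine Finset.sum_eq_zero fun t _ ↦ ?_
    rw [← hR]
    exact Fintype.sum_equiv ((MulAction.toPerm (Units.mk0 s hs0)).trans (Equiv.addRight (t • 1)))
      _ _ fun A ↦ rfl
  · simp

end Pencil

section Eigenvalue

lemma Module.End.hasEigenvalue_one_of_mul_eq {K V : Type*} [Field K] [AddCommGroup V] [Module K V]
    {f Q : Module.End K V} (hQ : Q ≠ 0) (h : f * Q = Q) : f.HasEigenvalue 1 := by
  obtain ⟨v, hv⟩ := DFunLike.ne_iff.1 hQ
  refine Module.End.hasEigenvalue_of_hasEigenvector (x := Q v) ⟨?_, hv⟩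
  rw [Module.End.mem_eigenspace_iff, one_smul, ← Module.End.mul_apply, h]

variable {F : Type*} [Field F] [Fintype F] {V : Type*} [AddCommGroup V] [Module ℂ V]
  (R : Matrix (Fin 2) (Fin 2) F →* Module.End ℂ V) [FiniteDimensional ℂ V]
  (hdim : Module.finrank ℂ V = Fintype.card F - 1) (hU : ∃ x, R !![1, x; 0, 1] ≠ 1)
include hdim hU

lemma exists_unipotent_mul_eq (hq : ¬ (Fintype.card F).Prime) {x : F} (hx : x ≠ 0) :
    ∃ Q : Module.End ℂ V, Q ≠ 0 ∧ R !![1, x; 0, 1] * Q = Q := by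
  have hq1 : 1 < Fintype.card F := Fintype.one_lt_card
  have hpow (i : ℕ) : R !![1, x; 0, 1] ^ i = R !![1, i * x; 0, 1] := by
    induction i with
    | zero => simp [← Matrix.one_fin_two]
    | succ i ih =>
      rw [pow_succ, ih, ← map_mul]
      congr 1
      ext i j
      fin_cases i <;> fin_cases j <;> simp [mul_apply, Fin.sum_univ_two]
      ring
  have hp := CharP.char_is_prime F (ringChar F)
  refine ⟨∑ i ∈ Finset.range (ringChar F), R !![1, x; 0, 1] ^ i, fun h ↦ ?_, ?_⟩
  · obtain ⟨n, hn⟩ := Nat.exists_eq_succ_of_ne_zero hp.ne_zero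
    have hlt : ∀ i ∈ Finset.range n, ((i + 1 : ℕ) : F) ≠ 0 := by
      intro i hi h0
      have := Nat.le_of_dvd i.succ_pos (ringChar.dvd h0)
      have := Finset.mem_range.1 hi
      omega
    have h := congrArg (LinearMap.trace ℂ V) h
    rw [hn, Nat.succ_eq_add_one, Finset.sum_range_succ', pow_zero, map_add, map_sum,
      Finset.sum_congr rfl (g := fun _ ↦ (-1 : ℂ)), LinearMap.trace_one, hdim, Finset.sum_const,
      Finset.card_range, map_zero, nsmul_eq_mul, mul_neg_one, neg_add_eq_zero, Nat.cast_inj] at h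
    · exact hq (by rwa [show Fintype.card F = ringChar F by omega])
    · intro i hi
      rw [hpow, trace_unipotent R hdim hU (mul_ne_zero (hlt i hi) hx)]
  · rw [← sub_eq_zero, ← sub_one_mul, mul_geom_sum, hpow, ringChar.Nat.cast_ringChar, zero_mul,
      ← Matrix.one_fin_two, map_one, sub_self]

variable (hs : ∀ c : F, c ≠ 0 → R (c • 1) = 1) (h0 : ∀ M, M.det = 0 → R M = 0)
include hs h0

lemma trace_pencilSum_of_mul_eq_torus {A P : Matrix (Fin 2) (Fin 2) F} {s t : F} (hs0 : s ≠ 0)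
    (hP : P.det ≠ 0) (h : (s • A + t • 1) * P = P * !![1, 0; 0, 0]) :
    LinearMap.trace ℂ V (pencilSum R A) = ((Fintype.card F - 1 : ℕ) : ℂ) ^ 2 := by
  rw [trace_pencilSum_eq R hs0 hP h, trace_pencilSum_torus R hs h0
    fun c h0 h1 ↦ trace_torus_eq_zero R hdim hU h0 h1, hdim, sq]

lemma trace_pencilSum_of_mul_eq_unipotent {A P : Matrix (Fin 2) (Fin 2) F} {s t : F}
    (hs0 : s ≠ 0) (hP : P.det ≠ 0) (h : (s • A + t • 1) * P = P * !![0, 1; 0, 0]) :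
    LinearMap.trace ℂ V (pencilSum R A) = 0 := by
  rw [trace_pencilSum_eq R hs0 hP h,
    pencilSum_unipotent R hs h0 (sum_unipotent_eq_zero R hdim hU), map_zero]

lemma trace_pencilSum_of_eq (c x : F) [Decidable (x = 0)] :
    LinearMap.trace ℂ V (pencilSum R !![c, x; 0, c]) =
      if x = 0 then Fintype.card F * ((Fintype.card F - 1 : ℕ) : ℂ) ^ 2 else 0 := by
  split_ifs with hx
  · have h : !![c, x; 0, c] = c • (1 : Matrix (Fin 2) (Fin 2) F) := by
      ext i j
      fin_cases i <;> fin_cases j <;> simp [hx]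
    rw [h, pencilSum_smul_one R hs h0, map_smul, LinearMap.trace_one, hdim, smul_eq_mul]
    ring
  · refine trace_pencilSum_of_mul_eq_unipotent R hdim hU hs h0 (P := 1) (t := -(x⁻¹ * c))
      (inv_ne_zero hx) (by simp) ?_
    ext i j
    fin_cases i <;> fin_cases j <;> simp [hx]

/-- The pencil sum of a matrix without eigenvalues does not vanish: otherwise every nonscalar
pencil sum would have trace at most `(q - 1) ^ 2`, with strict inequality somewhere, and the sum of
all pencil sums would be too small. -/
lemma pencilSum_ne_zero_of_det_sub_ne_zero (hR : ∑ M, R M = 0) {B : Matrix (Fin 2) (Fin 2) F}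
    (hB : ∀ a : F, (B - a • 1).det ≠ 0) : pencilSum R B ≠ 0 := by
  classical
  intro hB0
  set q : ℕ := Fintype.card F with hq
  let f (A : Matrix (Fin 2) (Fin 2) F) : ℝ := (LinearMap.trace ℂ V (pencilSum R A)).re
  let e : F × F ↪ Matrix (Fin 2) (Fin 2) F :=
    ⟨fun p ↦ !![p.1, p.2; 0, p.1], fun p p' h ↦ Prod.ext
      (by simpa using congrFun (congrFun h 0) 0) (by simpa using congrFun (congrFun h 0) 1)⟩
  have he (p : F × F) : e p = !![p.1, p.2; 0, p.1] := rfl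
  let T : Finset (Matrix (Fin 2) (Fin 2) F) := Finset.univ.map e
  have hf : ∑ A, f A = (q : ℝ) ^ 4 * ((q - 1 : ℕ) : ℝ) ^ 2 := by
    have h := congrArg (fun Q ↦ (LinearMap.trace ℂ V Q).re) (sum_pencilSum R hs h0 hR)
    simp only [map_sum, Complex.re_sum, map_smul, LinearMap.trace_one, hdim, ← hq] at h
    rw [h, smul_eq_mul, mul_assoc, ← sq]
    exact_mod_cast Complex.natCast_re (q ^ 4 * (q - 1) ^ 2)
  have hfT : ∑ A ∈ T, f A = (q : ℝ) ^ 2 * ((q - 1 : ℕ) : ℝ) ^ 2 := by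
    have h (p : F × F) : f (e p) = if p.2 = 0 then (q : ℝ) * ((q - 1 : ℕ) : ℝ) ^ 2 else 0 := by
      simp only [f, he]
      rw [trace_pencilSum_of_eq R hdim hU hs h0, ← hq]
      split_ifs
      · exact_mod_cast Complex.natCast_re (q * (q - 1) ^ 2)
      · rfl
    simp only [T, Finset.sum_map, h, Fintype.sum_prod_type, Finset.sum_ite_eq', Finset.mem_univ,
      if_true, Finset.sum_const, Finset.card_univ, nsmul_eq_mul, ← hq]
    ring
  have hcard : (Tᶜ.card : ℝ) = q ^ 4 - q ^ 2 := by
    have h := Finset.card_add_card_compl T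
    rw [Finset.card_map, Finset.card_univ, Fintype.card_prod, card_matrix_fin_two, ← hq] at h
    rw [eq_sub_iff_add_eq']
    exact_mod_cast (sq q ▸ h)
  have hsum : ∑ A ∈ Tᶜ, (((q - 1 : ℕ) : ℝ) ^ 2 - f A) = 0 := by
    rw [Finset.sum_sub_distrib, Finset.sum_const, nsmul_eq_mul, hcard]
    linear_combination -hf + hfT - Finset.sum_add_sum_compl T f
  have hscalar {A : Matrix (Fin 2) (Fin 2) F} (hA : A ∈ Tᶜ) (c : F) : A ≠ c • 1 := by
    rintro rfl
    refine Finset.mem_compl.1 hA (Finset.mem_map.2 ⟨(c, 0), Finset.mem_univ _, ?_⟩)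
    ext i j
    fin_cases i <;> fin_cases j <;> simp [he]
  have hnonneg : ∀ A ∈ Tᶜ, 0 ≤ ((q - 1 : ℕ) : ℝ) ^ 2 - f A := by
    intro A hA
    have h0' : (0 : ℝ) ≤ ((q - 1 : ℕ) : ℝ) ^ 2 - (0 : ℂ).re := by
      rw [Complex.zero_re, sub_zero]
      positivity
    simp only [f]
    by_cases ha : ∃ a : F, (A - a • 1).det = 0
    · obtain ⟨a, ha⟩ := ha
      obtain ⟨s, t, P, hs0, hP, h⟩ | ⟨P, hP, h⟩ :=
        exists_affine_mul_eq_mul_of_det_sub_eq_zero (hscalar hA) ha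
      · rw [trace_pencilSum_of_mul_eq_torus R hdim hU hs h0 hs0 hP h, ← hq,
          ← Complex.ofReal_natCast, ← Complex.ofReal_pow, Complex.ofReal_re, sub_self]
      · rwa [trace_pencilSum_of_mul_eq_unipotent R hdim hU hs h0 (s := 1) (t := -a) one_ne_zero hP
          (by rwa [one_smul, neg_smul, ← sub_eq_add_neg])]
    · obtain ⟨s, t, P, hs0, hP, h⟩ :=
        exists_affine_mul_eq_mul_of_det_sub_ne_zero (not_exists.1 ha) hB
      rwa [trace_pencilSum_eq R hs0 hP h, hB0, map_zero]
  have hBT : B ∈ Tᶜ := by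
    refine Finset.mem_compl.2 fun h ↦ ?_
    obtain ⟨p, -, rfl⟩ := Finset.mem_map.1 h
    exact hB p.1 (by rw [he]; simp [det_fin_two])
  have h := (Finset.sum_eq_zero_iff_of_nonneg hnonneg).1 hsum B hBT
  simp only [f, hB0, map_zero, Complex.zero_re, sub_zero] at h
  have hq1 : 1 < q := Fintype.one_lt_card
  have : q - 1 = 0 := by exact_mod_cast pow_eq_zero_iff two_ne_zero |>.1 h
  omega

/-- In a cuspidal representation whose dimension is not one less than a prime, every invertible
matrix has `1` as an eigenvalue. -/
lemma hasEigenvalue_one_of_det_ne_zero (hq : ¬ (Fintype.card F).Prime) (hR : ∑ M, R M = 0)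
    {A : Matrix (Fin 2) (Fin 2) F} (hA : A.det ≠ 0) : (R A).HasEigenvalue 1 := by
  have hq1 : 1 < Fintype.card F := Fintype.one_lt_card
  have hq0 : Fintype.card F - 1 ≠ 0 := by omega
  have : Nontrivial V := Module.nontrivial_of_finrank_pos (R := ℂ) (by omega)
  by_cases hscalar : ∃ c : F, A = c • 1
  · obtain ⟨c, rfl⟩ := hscalar
    have hc : c ≠ 0 := by rintro rfl; simp at hA
    exact Module.End.hasEigenvalue_one_of_mul_eq one_ne_zero (by rw [hs c hc, one_mul])
  rw [not_exists] at hscalar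
  have of_pencilSum (h : pencilSum R A ≠ 0) : (R A).HasEigenvalue 1 :=
    Module.End.hasEigenvalue_one_of_mul_eq h (map_mul_pencilSum R hA)
  by_cases ha : ∃ a : F, (A - a • 1).det = 0
  · obtain ⟨a, ha⟩ := ha
    obtain ⟨s, t, P, hs0, hP, h⟩ | ⟨P, hP, h⟩ :=
      exists_affine_mul_eq_mul_of_det_sub_eq_zero hscalar ha
    · refine of_pencilSum fun h' ↦ ?_
      have := trace_pencilSum_of_mul_eq_torus R hdim hU hs h0 hs0 hP h
      rw [h', map_zero] at this
      exact hq0 (by exact_mod_cast pow_eq_zero_iff two_ne_zero |>.1 this.symm)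
    · have h' : A * P = P * (a • 1 + !![0, 1; 0, 0]) := by
        rw [mul_add, ← h, Matrix.sub_mul, Matrix.mul_smul, Matrix.smul_mul, Matrix.one_mul,
          Matrix.mul_one, add_sub_cancel]
      have ha0 : a ≠ 0 := by
        rintro rfl
        have := congrArg det h'
        simp [det_mul, hA, hP] at this
      have hu : a • 1 + !![0, 1; 0, 0] = a • !![1, a⁻¹; 0, 1] := by
        ext i j
        fin_cases i <;> fin_cases j <;> simp [ha0]
      obtain ⟨Q, hQ, hQ'⟩ := exists_unipotent_mul_eq R hdim hU hq (inv_ne_zero ha0)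
      refine Module.End.hasEigenvalue_one_of_mul_eq (Q := R P * Q) (fun hPQ ↦ hQ ?_) ?_
      · rw [← one_mul Q, ← map_one R, ← nonsing_inv_mul P hP.isUnit, map_mul, mul_assoc, hPQ,
          mul_zero]
      · rw [← mul_assoc, ← map_mul, h', hu, map_mul, map_smul_matrix R hs ha0, mul_assoc, hQ']
  · exact of_pencilSum
      (pencilSum_ne_zero_of_det_sub_ne_zero R hdim hU hs h0 hR (not_exists.1 ha))

end Eigenvalue

section PGL2

variable {F : Type} [Field F]

/-- The operator by which an invertible matrix acts on a representation of `PGL₂(F)`, extended by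
zero to all matrices. -/
noncomputable def PGL2.matrixRep (V : FDRep ℂ (PGL2 F)) :
    Matrix (Fin 2) (Fin 2) F →* Module.End ℂ V where
  toFun M := by
    classical exact if h : IsUnit M then V.ρ (QuotientGroup.mk h.unit) else 0
  map_one' := by
    rw [dif_pos isUnit_one, ← map_one V.ρ, ← QuotientGroup.mk_one]
    congr 2
    exact Units.ext rfl
  map_mul' M N := by
    by_cases hM : IsUnit M
    · by_cases hN : IsUnit N
      · rw [dif_pos hM, dif_pos hN, dif_pos (hM.mul hN), ← map_mul, ← QuotientGroup.mk_mul]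
        congr 2
        exact Units.ext rfl
      · rw [dif_neg hN, dif_neg fun h ↦ hN (isUnit_of_mul_isUnit_right h), mul_zero]
    · rw [dif_neg hM, dif_neg fun h ↦ hM (isUnit_of_mul_isUnit_left h), zero_mul]

namespace PGL2

lemma matrixRep_coe (V : FDRep ℂ (PGL2 F)) (g : GL (Fin 2) F) :
    matrixRep V g = V.ρ (QuotientGroup.mk g) := by
  refine (dif_pos g.isUnit).trans ?_
  congr 2
  exact Units.ext rfl

lemma matrixRep_of_det_eq_zero (V : FDRep ℂ (PGL2 F)) {M : Matrix (Fin 2) (Fin 2) F}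
    (hM : M.det = 0) : matrixRep V M = 0 :=
  dif_neg fun h ↦ ((isUnit_iff_isUnit_det M).1 h).ne_zero hM

lemma matrixRep_smul_one (V : FDRep ℂ (PGL2 F)) {c : F} (hc : c ≠ 0) :
    matrixRep V (c • 1) = 1 := by
  let g : GL (Fin 2) F := GeneralLinearGroup.mkOfDetNeZero (c • 1) (by simp [hc])
  have hg : g ∈ Subgroup.center (GL (Fin 2) F) := by
    rw [GeneralLinearGroup.mem_center_iff_val_mem_range_scalar]
    exact ⟨c, (smul_one_eq_diagonal c).symm⟩
  change matrixRep V g = 1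
  rw [matrixRep_coe, (QuotientGroup.eq_one_iff g).2 hg, map_one]

variable [Fintype F]

lemma sum_matrixRep {V : FDRep ℂ (PGL2 F)} (hV : Simple V) (h1 : Module.finrank ℂ V ≠ 1) :
    ∑ M, matrixRep V M = 0 := by
  classical
  have : Fintype (PGL2 F) := Fintype.ofFinite _
  have h (g : PGL2 F) : V.ρ g * ∑ M, matrixRep V M = ∑ M, matrixRep V M := by
    obtain ⟨g, rfl⟩ := QuotientGroup.mk_surjective g
    rw [← matrixRep_coe, Finset.mul_sum]
    exact Fintype.sum_equiv (Units.mulLeft g) _ _ fun M ↦ (map_mul _ _ _).symm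
  have h2 : (∑ g, V.ρ g) * ∑ M, matrixRep V M =
      (Fintype.card (PGL2 F) : ℂ) • ∑ M, matrixRep V M := by
    rw [Finset.sum_mul, Finset.sum_congr rfl fun g _ ↦ h g, Finset.sum_const, Finset.card_univ,
      Nat.cast_smul_eq_nsmul]
  rw [FDRep.sum_ρ_eq_zero hV h1, zero_mul] at h2
  exact (smul_eq_zero.1 h2.symm).resolve_left (Nat.cast_ne_zero.2 Fintype.card_ne_zero)

/-- A simple representation of dimension greater than one is nontrivial on the upper unitriangular
matrices. -/
lemma exists_matrixRep_unipotent_ne_one {V : FDRep ℂ (PGL2 F)} (hV : Simple V)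
    (h1 : Module.finrank ℂ V ≠ 1) : ∃ x, matrixRep V !![1, x; 0, 1] ≠ 1 := by
  classical
  by_contra! hu
  have : Fintype (PGL2 F) := Fintype.ofFinite _
  have hl (x : F) : matrixRep V !![1, 0; x, 1] = 1 := by
    have h : !![1, 0; x, 1] = !![0, 1; 1, 0] * !![1, x; 0, 1] * !![0, 1; 1, 0] := by
      ext i j
      fin_cases i <;> fin_cases j <;> simp [mul_apply, Fin.sum_univ_two]
    have hw : !![0, 1; 1, 0] * !![0, 1; 1, 0] = (1 : Matrix (Fin 2) (Fin 2) F) := by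
      ext i j
      fin_cases i <;> fin_cases j <;> simp [mul_apply, Fin.sum_univ_two]
    rw [h, map_mul, map_mul, hu, mul_one, ← map_mul, hw, map_one]
  have hdiag (M : Matrix (Fin 2) (Fin 2) F) (hM : M.det ≠ 0) :
      ∃ D : Fin 2 → F, matrixRep V M = matrixRep V (diagonal D) := by
    refine diagonal_transvection_induction_of_det_ne_zero
      (fun M ↦ ∃ D : Fin 2 → F, matrixRep V M = matrixRep V (diagonal D)) M hM
      (fun D _ ↦ ⟨D, rfl⟩) (fun t ↦ ⟨1, ?_⟩) ?_
    · have h : t.toMatrix = !![1, t.c; 0, 1] ∨ t.toMatrix = !![1, 0; t.c, 1] := by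
        obtain ⟨i, j, hij, c⟩ := t
        fin_cases i <;> fin_cases j
        · exact absurd rfl hij
        · left
          ext i j
          fin_cases i <;> fin_cases j <;> simp [TransvectionStruct.toMatrix, transvection]
        · right
          ext i j
          fin_cases i <;> fin_cases j <;> simp [TransvectionStruct.toMatrix, transvection]
        · exact absurd rfl hij
      rw [show diagonal (1 : Fin 2 → F) = 1 from diagonal_one, map_one]
      obtain h | h := h
      · rw [h, hu]
      · rw [h, hl]
    · rintro A B - - ⟨D, hD⟩ ⟨E, hE⟩
      exact ⟨fun i ↦ D i * E i, by rw [map_mul, hD, hE, ← map_mul, diagonal_mul_diagonal]⟩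
  refine h1 (FDRep.finrank_eq_one_of_commute hV fun g g' ↦ ?_)
  obtain ⟨g, rfl⟩ := QuotientGroup.mk_surjective g
  obtain ⟨g', rfl⟩ := QuotientGroup.mk_surjective g'
  obtain ⟨D, hD⟩ := hdiag g g.det_ne_zero
  obtain ⟨E, hE⟩ := hdiag g' g'.det_ne_zero
  rw [← matrixRep_coe, ← matrixRep_coe, hD, hE, ← map_mul, ← map_mul, (commute_diagonal D E).eq]

end PGL2

end PGL2

/-- Let `F` be a finite field with `q` elements, where `q` is not a prime.
Every irreducible complex character of `PGL₂(q)` of degree `q - 1` is unisingular. -/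
theorem PGL2_unisingular_of_deg_q_sub_one_of_not_prime (q : ℕ) (hq : ¬ q.Prime)
    (F : Type) [Field F] [Fintype F] (hF : Fintype.card F = q)
    (V : FDRep ℂ (PGL2 F)) (hV : Simple V)
    (hdeg : Module.finrank ℂ V = q - 1) :
    V.IsUnisingular := by
  subst hF
  have h1 : Module.finrank ℂ V ≠ 1 := by
    intro h
    have : Fintype.card F = 2 := by omega
    exact hq (this ▸ Nat.prime_two)
  intro g
  obtain ⟨g, rfl⟩ := QuotientGroup.mk_surjective g
  rw [← PGL2.matrixRep_coe]
  exact hasEigenvalue_one_of_det_ne_zero (PGL2.matrixRep V) hdeg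
    (PGL2.exists_matrixRep_unipotent_ne_one hV h1) (fun _ ↦ PGL2.matrixRep_smul_one V)
    (fun _ ↦ PGL2.matrixRep_of_det_eq_zero V) hq (PGL2.sum_matrixRep hV h1) g.det_ne_zero
end

section
/- Let q be an odd prime power. Then every irreducible complex character of PSL_2(q) of degree q is unisingular. -/
open Module FDRep Matrix CategoryTheory

/-- `PSL₂(F)`, the projective special linear group of degree 2 over `F`:
the quotient of `SL₂(F)` by its center. -/
abbrev PSL2 (F : Type) [Field F] : Type _ :=
  Matrix.ProjectiveSpecialLinearGroup (Fin 2) F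

theorem FDRep.eq_bot_or_eq_top_of_simple {G : Type} [Monoid G] (V : FDRep ℂ G) [Simple V]
    (W : Submodule ℂ V) (hW : ∀ g, ∀ v ∈ W, V.ρ g v ∈ W) : W = ⊥ ∨ W = ⊤ := by
  let S : Representation ℂ G W :=
    { toFun := fun g => (V.ρ g).restrict (hW g)
      map_one' := by ext; simp
      map_mul' := fun a b => by ext; simp }
  let i : FDRep.of S ⟶ V := ⟨FGModuleCat.ofHom W.subtype, fun g => by ext; rfl⟩
  have hi : ∀ x : W, i.hom.hom x = (x : V) := fun x => rfl
  have : Mono i := by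
    apply (forget (FDRep ℂ G)).mono_of_mono_map
    rw [CategoryTheory.mono_iff_injective]
    exact Subtype.val_injective
  by_cases h : i = 0
  · left
    rw [Submodule.eq_bot_iff]
    intro x hx
    have := hi ⟨x, hx⟩
    rw [h] at this
    exact this.symm
  · right
    have := isIso_of_mono_of_nonzero h
    rw [Submodule.eq_top_iff']
    intro x
    have hs : Function.Surjective ((forget (FDRep ℂ G)).map i) :=
      ((isIso_iff_bijective _).1 inferInstance).2
    obtain ⟨y, hy⟩ := hs x
    rw [← hy]
    exact y.2

theorem LinearMap.isIntegral_trace_of_pow_eq_one {V : Type*} [AddCommGroup V] [Module ℂ V]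
    [FiniteDimensional ℂ V] {f : Module.End ℂ V} {n : ℕ} (hn : 0 < n) (hf : f ^ n = 1) :
    IsIntegral ℤ (LinearMap.trace ℂ V f) := by
  rw [Module.End.trace_eq_sum_roots_charpoly_of_splits (IsAlgClosed.splits _)]
  apply IsIntegral.multiset_sum
  intro μ hμ
  have hev : Module.End.HasEigenvalue f μ := by
    rw [Module.End.hasEigenvalue_iff_isRoot_charpoly]
    exact Polynomial.isRoot_of_mem_roots hμ
  obtain ⟨v, hv⟩ := hev.exists_hasEigenvector
  have h1 : μ ^ n = 1 := by
    have := hv.pow_apply n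
    rw [hf, Module.End.one_apply] at this
    by_contra hne
    have h2 : (μ ^ n - 1) • v = 0 := by rw [sub_smul, one_smul, ← this, sub_self]
    exact (smul_eq_zero.1 h2).elim (fun h => hne (sub_eq_zero.1 h)) hv.2
  exact IsIntegral.of_pow hn (h1 ▸ isIntegral_one)

namespace Matrix

variable {F : Type*} [Field F]

/-- If `x` and `M x` are linearly independent, a matrix commuting with `M` and killing `x` is
zero. -/
theorem eq_zero_of_commute_of_mulVec_eq_zero {M C : Matrix (Fin 2) (Fin 2) F} {x : Fin 2 → F}
    (hx : x 0 * (M *ᵥ x) 1 - (M *ᵥ x) 0 * x 1 ≠ 0) (hC : Commute C M) (hCx : C *ᵥ x = 0) :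
    C = 0 := by
  have hCMx : C *ᵥ (M *ᵥ x) = 0 := by
    rw [mulVec_mulVec, hC.eq, ← mulVec_mulVec, hCx, mulVec_zero]
  have hP : IsUnit !![x 0, (M *ᵥ x) 0; x 1, (M *ᵥ x) 1] := by
    rw [isUnit_iff_isUnit_det, det_fin_two_of]
    exact isUnit_iff_ne_zero.2 hx
  refine hP.mul_left_eq_zero.1 ?_
  have h0 := congrFun hCx 0
  have h1 := congrFun hCx 1
  have h2 := congrFun hCMx 0
  have h3 := congrFun hCMx 1
  generalize M *ᵥ x = y at *
  simp only [mulVec, dotProduct, Fin.sum_univ_two, Pi.zero_apply] at h0 h1 h2 h3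
  ext i j
  fin_cases i <;> fin_cases j <;> simp [mul_apply, Fin.sum_univ_two, h0, h1, h2, h3]

theorem exists_cyclic_vector {M : Matrix (Fin 2) (Fin 2) F} (hdet : M.det = 1)
    (htr : M.trace ^ 2 ≠ 4) :
    ∃ x : Fin 2 → F, x 0 * (M *ᵥ x) 1 - (M *ᵥ x) 0 * x 1 ≠ 0 := by
  by_contra! h
  have h1 := h ![1, 0]
  have h2 := h ![0, 1]
  have h3 := h ![1, 1]
  simp only [mulVec, dotProduct, Fin.sum_univ_two, cons_val_zero, cons_val_one] at h1 h2 h3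
  rw [det_fin_two] at hdet
  rw [trace_fin_two] at htr
  grind

/-- A pencil `a + b M` spanned by a non-unipotent matrix of determinant one contains a matrix of
any given nonzero determinant. -/
theorem exists_det_pencil_eq [Fintype F] (hF : ringChar F ≠ 2) {M : Matrix (Fin 2) (Fin 2) F}
    (hdet : M.det = 1) (htr : M.trace ^ 2 ≠ 4) (e : F) :
    ∃ a b : F, (a • (1 : Matrix (Fin 2) (Fin 2) F) + b • M).det = e := by
  have h2 : (2 : F) ≠ 0 := Ring.two_ne_zero hF
  let d : F := 1 - M.trace ^ 2 / 4
  have h4 : (4 : F) ≠ 0 := by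
    have : (4 : F) = 2 * 2 := by norm_num
    rw [this]; exact mul_ne_zero h2 h2
  have hd : d ≠ 0 := by
    intro h
    apply htr
    simp only [d] at h
    field_simp at h
    linear_combination -h
  have hdegf : (Polynomial.X ^ 2 : Polynomial F).degree = 2 := by simp
  have hdegg : (Polynomial.C d * Polynomial.X ^ 2 + Polynomial.C 0 * Polynomial.X
      + Polynomial.C (-e) : Polynomial F).degree = 2 := Polynomial.degree_quadratic hd
  obtain ⟨A, B, hAB⟩ := FiniteField.exists_root_sum_quadratic hdegf hdegg
    (FiniteField.odd_card_of_char_ne_two hF)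
  simp only [Polynomial.eval_add, Polynomial.eval_mul, Polynomial.eval_pow, Polynomial.eval_X,
    Polynomial.eval_C] at hAB
  refine ⟨A - M.trace * B / 2, B, ?_⟩
  have : d * B ^ 2 = B ^ 2 - (M.trace * B / 2) ^ 2 := by
    simp only [d]; field_simp; ring
  rw [det_fin_two] at hdet
  have key : (((A - M.trace * B / 2) • (1 : Matrix (Fin 2) (Fin 2) F) + B • M).det)
      = (A - M.trace * B / 2) ^ 2 + (A - M.trace * B / 2) * B * M.trace + B ^ 2 := by
    generalize A - M.trace * B / 2 = a
    rw [det_fin_two, trace_fin_two]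
    simp
    linear_combination B ^ 2 * hdet
  rw [key]
  have h5 : M.trace * B = 2 * (M.trace * B / 2) := by field_simp
  linear_combination hAB - this + (A - M.trace * B / 2) * h5

/-- A non-unipotent element of `SL₂` over a finite field of odd characteristic has two lines
without eigenvectors lying in different orbits of the cyclic group that it generates. -/
theorem exists_two_orbits [Fintype F] (hF : ringChar F ≠ 2) {M : Matrix (Fin 2) (Fin 2) F}
    (hdet : M.det = 1) (htr : M.trace ^ 2 ≠ 4) :
    ∃ x y : Fin 2 → F, x ≠ 0 ∧ y ≠ 0 ∧
      (∀ (k : ℕ) (c : F), M ^ k *ᵥ x = c • x → M ^ k = c • 1) ∧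
      (∀ (k : ℕ) (c : F), M ^ k *ᵥ y = c • y → M ^ k = c • 1) ∧
      (∀ (k : ℕ) (c : F), M ^ k *ᵥ x ≠ c • y) ∧ (∀ (k : ℕ) (c : F), M ^ k *ᵥ y ≠ c • x) := by
  obtain ⟨x, hx⟩ := exists_cyclic_vector hdet htr
  obtain ⟨e, he⟩ := FiniteField.exists_nonsquare hF
  obtain ⟨a, b, hQ⟩ := exists_det_pencil_eq hF hdet htr e
  set Q : Matrix (Fin 2) (Fin 2) F := a • 1 + b • M with hQdef
  have he0 : e ≠ 0 := by rintro rfl; exact he (IsSquare.zero)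
  have hQM : Commute Q M :=
    ((Commute.one_left M).smul_left a).add_left ((Commute.refl M).smul_left b)
  have hQu : IsUnit Q := by
    rw [isUnit_iff_isUnit_det, hQ]; exact isUnit_iff_ne_zero.2 he0
  have hpow : ∀ k : ℕ, Commute (M ^ k) M := fun k => (Commute.refl M).pow_left k
  have hscal : ∀ c : F, Commute (c • (1 : Matrix (Fin 2) (Fin 2) F)) M :=
    fun c => (Commute.one_left M).smul_left c
  have hx0 : x ≠ 0 := by rintro rfl; simp at hx
  have hkey : ∀ C : Matrix (Fin 2) (Fin 2) F, Commute C M → C *ᵥ x = 0 → C = 0 :=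
    fun C h h' => eq_zero_of_commute_of_mulVec_eq_zero hx h h'
  refine ⟨x, Q *ᵥ x, hx0, ?_, ?_, ?_, ?_, ?_⟩
  · intro h
    have := hkey Q hQM h
    rw [this, isUnit_zero_iff] at hQu
    exact zero_ne_one hQu
  · intro k c h
    refine sub_eq_zero.1 (hkey _ ((hpow k).sub_left (hscal c)) ?_)
    rw [sub_mulVec, h, smul_mulVec, one_mulVec, sub_self]
  · intro k c h
    have h0 : Q * (M ^ k - c • 1) = 0 := by
      refine hkey _ (hQM.mul_left ((hpow k).sub_left (hscal c))) ?_
      rw [mul_sub, sub_mulVec, (hQM.pow_right k).eq, ← mulVec_mulVec, h, mul_smul_comm, mul_one,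
        smul_mulVec, sub_self]
    exact sub_eq_zero.1 (hQu.mul_right_eq_zero.1 h0)
  · intro k c h
    have h0 : M ^ k = c • Q := by
      refine sub_eq_zero.1 (hkey _ ((hpow k).sub_left (hQM.smul_left c)) ?_)
      rw [sub_mulVec, h, smul_mulVec, sub_self]
    have h1 := congrArg det h0
    rw [det_pow, hdet, one_pow, det_smul, hQ, Fintype.card_fin] at h1
    have hc : c ≠ 0 := by rintro rfl; simp at h1
    exact he ⟨c⁻¹, by field_simp; linear_combination -h1⟩
  · intro k c h
    have h0 : M ^ k * Q = c • 1 := by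
      refine sub_eq_zero.1 (hkey _ (((hpow k).mul_left hQM).sub_left (hscal c)) ?_)
      rw [sub_mulVec, ← mulVec_mulVec, h, smul_mulVec, one_mulVec, sub_self]
    have h1 := congrArg det h0
    rw [det_mul, det_pow, hdet, one_pow, det_smul, hQ, Fintype.card_fin] at h1
    exact he ⟨c, by simpa [sq] using h1⟩

end Matrix

namespace Matrix.SpecialLinearGroup

variable {F : Type*} [Field F]

/-- The upper unitriangular element of `SL₂` with parameter `x`. -/
def upperUnipotent (x : F) : SpecialLinearGroup (Fin 2) F :=
  ⟨!![1, x; 0, 1], by simp⟩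

/-- The diagonal torus of `SL₂`. -/
def diagonalTorus : Fˣ →* SpecialLinearGroup (Fin 2) F where
  toFun a := ⟨!![(a : F), 0; 0, ((a⁻¹ : Fˣ) : F)], by simp⟩
  map_one' := by ext i j; fin_cases i <;> fin_cases j <;> simp
  map_mul' a b := by
    apply Subtype.ext
    change _ = !![(a : F), 0; 0, ((a⁻¹ : Fˣ) : F)] * !![(b : F), 0; 0, ((b⁻¹ : Fˣ) : F)]
    simp [mul_comm]

theorem coe_upperUnipotent (x : F) : (upperUnipotent x).1 = !![1, x; 0, 1] := rfl

theorem coe_diagonalTorus (a : Fˣ) :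
    (diagonalTorus a).1 = !![(a : F), 0; 0, ((a⁻¹ : Fˣ) : F)] := rfl

theorem upperUnipotent_zero : upperUnipotent (0 : F) = 1 := by
  ext i j; fin_cases i <;> fin_cases j <;> simp [upperUnipotent]

theorem upperUnipotent_mul (x y : F) :
    upperUnipotent x * upperUnipotent y = upperUnipotent (x + y) := by
  apply Subtype.ext
  rw [coe_mul]
  simp [coe_upperUnipotent, add_comm]

theorem diagonalTorus_mul_upperUnipotent (a : Fˣ) (x : F) :
    diagonalTorus a * upperUnipotent x =
      upperUnipotent ((a : F) ^ 2 * x) * diagonalTorus a := by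
  apply Subtype.ext
  rw [coe_mul, coe_mul]
  simp [coe_upperUnipotent, coe_diagonalTorus]
  field_simp

theorem upperUnipotent_mul_diagonalTorus (a : Fˣ) (x : F) :
    upperUnipotent x * diagonalTorus a =
      diagonalTorus a * upperUnipotent (((a⁻¹ : Fˣ) : F) ^ 2 * x) := by
  rw [diagonalTorus_mul_upperUnipotent]
  congr 2
  simp

/-- An element of `SL₂` fixing the first basis vector is unipotent. -/
theorem eq_upperUnipotent_of_mulVec {g : SpecialLinearGroup (Fin 2) F}
    (hg : g.1 *ᵥ ![1, 0] = ![1, 0]) : ∃ x, g = upperUnipotent x := by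
  have h0 : g.1 0 0 = 1 := by simpa [mulVec, dotProduct, Fin.sum_univ_two] using congrFun hg 0
  have h1 : g.1 1 0 = 0 := by simpa [mulVec, dotProduct, Fin.sum_univ_two] using congrFun hg 1
  have h2 : g.1 1 1 = 1 := by
    have := g.2
    rw [det_fin_two, h0, h1] at this
    simpa using this
  refine ⟨g.1 0 1, ?_⟩
  ext i j; fin_cases i <;> fin_cases j <;> simp [upperUnipotent, h0, h1, h2]

theorem exists_mulVec_eq {x : Fin 2 → F} (hx : x ≠ 0) :
    ∃ g : SpecialLinearGroup (Fin 2) F, g.1 *ᵥ ![1, 0] = x := by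
  by_cases h0 : x 0 = 0
  · have h1 : x 1 ≠ 0 := fun h1 => hx (by ext i; fin_cases i <;> simp [h0, h1])
    refine ⟨⟨!![0, -(x 1)⁻¹; x 1, 0], by simp [h1]⟩, ?_⟩
    ext i; fin_cases i <;> simp [mulVec, dotProduct, h0]
  · refine ⟨⟨!![x 0, 0; x 1, (x 0)⁻¹], by simp [h0]⟩, ?_⟩
    ext i; fin_cases i <;> simp [mulVec, dotProduct]

theorem mulVec_ne_zero (g : SpecialLinearGroup (Fin 2) F) {x : Fin 2 → F} (hx : x ≠ 0) :
    g.1 *ᵥ x ≠ 0 := by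
  intro h
  apply hx
  have : (g⁻¹ * g).1 *ᵥ x = 0 := by
    rw [coe_mul, ← mulVec_mulVec, h, mulVec_zero]
  simpa using this

theorem eq_one_or_eq_neg_one_of_coe_eq_smul {g : SpecialLinearGroup (Fin 2) F} {c : F}
    (h : g.1 = c • (1 : Matrix (Fin 2) (Fin 2) F)) : g = 1 ∨ g = -1 := by
  have h1 := g.2
  rw [h, det_smul, det_one, mul_one, Fintype.card_fin, sq_eq_one_iff] at h1
  rcases h1 with rfl | rfl
  · left; ext i j; simp [h]
  · right; ext i j; simp [h]

section Representation

variable {V : Type*} [AddCommGroup V] [Module ℂ V]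

/-- A vector fixed by the unipotent subgroup and scaled by the torus extends to an equivariant
family of vectors indexed by the nonzero vectors of the plane. -/
theorem exists_equivariant_family (σ : SpecialLinearGroup (Fin 2) F →* Module.End ℂ V) {v : V}
    (hv : v ≠ 0) (hU : ∀ x, σ (upperUnipotent x) v = v)
    (hT : ∀ a, ∃ μ : ℂ, σ (diagonalTorus a) v = μ • v) :
    ∃ w : (Fin 2 → F) → V, (∀ g x, x ≠ 0 → σ g (w x) = w (g.1 *ᵥ x)) ∧ (∀ x, x ≠ 0 → w x ≠ 0) ∧
      ∀ x, x ≠ 0 → ∀ c : F, c ≠ 0 → ∃ μ : ℂ, w (c • x) = μ • w x := by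
  choose! h hh using fun (x : Fin 2 → F) (hx : x ≠ 0) => exists_mulVec_eq hx
  have key : ∀ g x, x ≠ 0 → g.1 *ᵥ ![1, 0] = x → σ g v = σ (h x) v := by
    intro g x hx hg
    obtain ⟨y, hy⟩ := eq_upperUnipotent_of_mulVec (g := (h x)⁻¹ * g) (by
      rw [coe_mul, ← mulVec_mulVec, hg]
      nth_rw 2 [← hh x hx]
      rw [mulVec_mulVec, ← coe_mul, inv_mul_cancel]
      simp)
    have : g = h x * upperUnipotent y := by rw [← hy]; group
    rw [this, map_mul, Module.End.mul_apply, hU]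
  refine ⟨fun x => σ (h x) v, ?_, ?_, ?_⟩
  · intro g x hx
    rw [← Module.End.mul_apply, ← map_mul]
    exact key _ _ (mulVec_ne_zero g hx) (by rw [coe_mul, ← mulVec_mulVec, hh x hx])
  · intro x hx (h0 : σ (h x) v = 0)
    apply hv
    have : σ ((h x)⁻¹ * h x) v = 0 := by rw [map_mul, Module.End.mul_apply, h0, map_zero]
    simpa using this
  · intro x hx c hc
    obtain ⟨μ, hμ⟩ := hT (Units.mk0 c hc)
    refine ⟨μ, ?_⟩
    change σ (h (c • x)) v = μ • σ (h x) v
    rw [← map_smul, ← hμ, ← Module.End.mul_apply, ← map_mul]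
    refine (key _ _ (smul_ne_zero hc hx) ?_).symm
    rw [coe_mul, ← mulVec_mulVec]
    have : (diagonalTorus (Units.mk0 c hc)).1 *ᵥ ![1, 0] = c • ![1, 0] := by
      ext i; fin_cases i <;> simp [coe_diagonalTorus, mulVec, dotProduct]
    rw [this, mulVec_smul, hh x hx]

/-- If the unipotent subgroup has a nonzero fixed vector, it has one that is an eigenvector of the
torus. -/
theorem exists_highest_weight_vector [Finite F] [FiniteDimensional ℂ V]
    (σ : SpecialLinearGroup (Fin 2) F →* Module.End ℂ V) {v : V}
    (hv : v ≠ 0) (hU : ∀ x, σ (upperUnipotent x) v = v) :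
    ∃ w : V, w ≠ 0 ∧ (∀ x, σ (upperUnipotent x) w = w) ∧
      ∀ a, ∃ μ : ℂ, σ (diagonalTorus a) w = μ • w := by
  let W : Submodule ℂ V := ⨅ x, LinearMap.eqLocus (σ (upperUnipotent x)) LinearMap.id
  have hW : ∀ z, z ∈ W ↔ ∀ x, σ (upperUnipotent x) z = z := by
    intro z; simp [W]
  have : Nontrivial W := ⟨⟨⟨v, (hW v).2 hU⟩, 0, fun h => hv (congrArg Subtype.val h)⟩⟩
  obtain ⟨t, ht⟩ := IsCyclic.exists_generator (α := Fˣ)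
  have hinv : ∀ z ∈ W, σ (diagonalTorus t) z ∈ W := by
    intro z hz
    rw [hW] at hz ⊢
    intro x
    rw [← Module.End.mul_apply, ← map_mul, upperUnipotent_mul_diagonalTorus, map_mul,
      Module.End.mul_apply, hz]
  obtain ⟨μ, hμ⟩ := Module.End.exists_eigenvalue ((σ (diagonalTorus t)).restrict hinv)
  obtain ⟨w, hw⟩ := hμ.exists_hasEigenvector
  have hwt : σ (diagonalTorus t) w = μ • (w : V) := congrArg Subtype.val hw.apply_eq_smul
  refine ⟨w, fun h => hw.2 (Subtype.ext h), (hW _).1 w.2, fun a => ?_⟩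
  obtain ⟨k, rfl⟩ := (Submonoid.mem_powers_iff _ _).1 (mem_powers_iff_mem_zpowers.2 (ht a))
  refine ⟨μ ^ k, ?_⟩
  rw [map_pow, map_pow]
  induction k with
  | zero => simp
  | succ k ih =>
    rw [pow_succ, Module.End.mul_apply, hwt, map_smul, ih, smul_smul, pow_succ, mul_comm]

/-- In an irreducible representation of degree `|F|`, an equivariant family with two points of
the projective line in distinct orbits of `g` produces a vector fixed by `g`. -/
theorem exists_fixed_vector_of_trace_sq_ne_four [Fintype F] (hF : ringChar F ≠ 2)
    [FiniteDimensional ℂ V] (hdim : finrank ℂ V = Fintype.card F)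
    (σ : SpecialLinearGroup (Fin 2) F →* Module.End ℂ V) (hneg : σ (-1) = 1)
    (hirr : ∀ W : Submodule ℂ V, (∀ g, ∀ v ∈ W, σ g v ∈ W) → W = ⊥ ∨ W = ⊤)
    {w : (Fin 2 → F) → V} (hw : ∀ g x, x ≠ 0 → σ g (w x) = w (g.1 *ᵥ x))
    (hw0 : ∀ x, x ≠ 0 → w x ≠ 0)
    (hwc : ∀ x, x ≠ 0 → ∀ c : F, c ≠ 0 → ∃ μ : ℂ, w (c • x) = μ • w x)
    {g : SpecialLinearGroup (Fin 2) F} (hg : g.1.trace ^ 2 ≠ 4) :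
    ∃ v : V, v ≠ 0 ∧ σ g v = v := by
  classical
  by_contra! hfix
  obtain ⟨x, y, hx, hy, hxx, hyy, hxy, hyx⟩ := exists_two_orbits hF g.2 hg
  have hex : ∃ n, 0 < n ∧ ∃ c : F, g.1 ^ n = c • 1 :=
    ⟨orderOf g, orderOf_pos g, 1, by rw [← coe_pow, pow_orderOf_eq_one]; simp⟩
  let n := Nat.find hex
  obtain ⟨hn, c, hc⟩ := Nat.find_spec hex
  have hmin : ∀ k, 0 < k → k < n → ∀ c : F, g.1 ^ k ≠ c • 1 :=
    fun k hk hkn c h => Nat.find_min hex hkn ⟨hk, c, h⟩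
  have hσn : σ g ^ n = 1 := by
    rw [← map_pow]
    rcases eq_one_or_eq_neg_one_of_coe_eq_smul (g := g ^ n) (c := c) (by rw [coe_pow]; exact hc)
      with h | h <;> rw [h]
    · exact map_one σ
    · exact hneg
  have hN : ∀ v, ∑ k ∈ Finset.range n, (σ g ^ k) v = 0 := by
    intro v
    by_contra hne
    refine hfix _ hne ?_
    have h1 : σ g * ∑ k ∈ Finset.range n, σ g ^ k = ∑ k ∈ Finset.range n, σ g ^ k := by
      have := mul_geom_sum (σ g) n
      rw [hσn, sub_self, sub_mul, one_mul, sub_eq_zero] at this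
      exact this
    have h2 := LinearMap.congr_fun h1 v
    simpa [LinearMap.sum_apply] using h2
  let A : Submodule ℂ V :=
    Submodule.span ℂ (w '' {z | z ≠ 0 ∧ (∀ c : F, z ≠ c • x) ∧ ∀ c : F, z ≠ c • y})
  have hA : ∀ z, z ≠ 0 → (∀ c : F, z ≠ c • x) → (∀ c : F, z ≠ c • y) → w z ∈ A :=
    fun z h1 h2 h3 => Submodule.subset_span ⟨z, ⟨h1, h2, h3⟩, rfl⟩
  have horbit : ∀ z, z ≠ 0 → (∀ k, 0 < k → k < n → w (g.1 ^ k *ᵥ z) ∈ A) → w z ∈ A := by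
    intro z hz h
    have h1 := hN (w z)
    obtain ⟨m, hm⟩ : ∃ m, n = m + 1 := ⟨n - 1, by omega⟩
    rw [hm, Finset.sum_range_succ', pow_zero, Module.End.one_apply] at h1
    rw [← neg_eq_of_add_eq_zero_right h1]
    refine A.neg_mem (A.sum_mem fun k hk => ?_)
    rw [← map_pow, hw _ _ hz, coe_pow]
    exact h _ (Nat.succ_pos k) (by rw [Finset.mem_range] at hk; omega)
  have hpow0 : ∀ (k : ℕ) z, z ≠ 0 → g.1 ^ k *ᵥ z ≠ 0 := by
    intro k z hz
    rw [← coe_pow]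
    exact mulVec_ne_zero _ hz
  have hAx : w x ∈ A := horbit x hx fun k hk hkn =>
    hA _ (hpow0 k x hx) (fun c h => hmin k hk hkn c (hxx k c h)) (hxy k)
  have hAy : w y ∈ A := horbit y hy fun k hk hkn =>
    hA _ (hpow0 k y hy) (hyx k) (fun c h => hmin k hk hkn c (hyy k c h))
  have hAc : ∀ z, z ≠ 0 → w z ∈ A → ∀ c : F, c • z ≠ 0 → w (c • z) ∈ A := by
    intro z hz h c hcz
    obtain ⟨μ, hμ⟩ := hwc z hz c (fun h => hcz (by rw [h, zero_smul]))
    rw [hμ]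
    exact A.smul_mem _ h
  have hall : ∀ z, z ≠ 0 → w z ∈ A := by
    intro z hz
    by_cases h1 : ∃ c : F, z = c • x
    · obtain ⟨c, rfl⟩ := h1
      exact hAc x hx hAx c hz
    by_cases h2 : ∃ c : F, z = c • y
    · obtain ⟨c, rfl⟩ := h2
      exact hAc y hy hAy c hz
    push Not at h1 h2
    exact hA z hz h1 h2
  have htop : A = ⊤ := by
    have hspan : A = Submodule.span ℂ (w '' {z | z ≠ 0}) := by
      apply le_antisymm
      · exact Submodule.span_mono (Set.image_mono fun z hz => hz.1)
      · rw [Submodule.span_le]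
        rintro _ ⟨z, hz, rfl⟩
        exact hall z hz
    refine (hirr A fun h v hv => ?_).resolve_left fun h => ?_
    · rw [hspan] at hv
      induction hv using Submodule.span_induction with
      | mem v hv =>
        obtain ⟨z, hz, rfl⟩ := hv
        rw [hw _ _ hz]
        exact hall _ (mulVec_ne_zero h hz)
      | zero => rw [map_zero]; exact A.zero_mem
      | add a b _ _ ha hb => rw [map_add]; exact A.add_mem ha hb
      | smul c a _ ha => rw [map_smul]; exact A.smul_mem _ ha
    · have := hall x hx
      rw [h, Submodule.mem_bot] at this
      exact hw0 x hx this
  let P := Projectivization F (Fin 2 → F)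
  have : Fintype P := Fintype.ofFinite P
  let px : P := Projectivization.mk F x hx
  let py : P := Projectivization.mk F y hy
  have hne : px ≠ py := by
    intro h
    obtain ⟨c, hc⟩ := (Projectivization.mk_eq_mk_iff' F x y hx hy).1 h
    exact hxy 0 c (by simp [hc])
  let S : Finset V := (Finset.univ \ {px, py}).image fun p : P => w p.rep
  have hAS : A ≤ Submodule.span ℂ (S : Set V) := by
    rw [Submodule.span_le]
    rintro _ ⟨z, ⟨hz, hzx, hzy⟩, rfl⟩
    obtain ⟨a, ha⟩ := Projectivization.exists_smul_eq_mk_rep F z hz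
    have hrep : ∀ u (hu : u ≠ 0), (∀ c : F, z ≠ c • u) →
        Projectivization.mk F z hz ≠ Projectivization.mk F u hu := by
      intro u hu h h'
      obtain ⟨c, hc⟩ := (Projectivization.mk_eq_mk_iff' F z u hz hu).1 h'
      exact h c hc.symm
    obtain ⟨μ, hμ⟩ := hwc (Projectivization.mk F z hz).rep (Projectivization.rep_nonzero _)
      ((a⁻¹ : Fˣ) : F) (Units.ne_zero _)
    have hz' : ((a⁻¹ : Fˣ) : F) • (Projectivization.mk F z hz).rep = z := by
      rw [← ha]
      exact inv_smul_smul a z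
    rw [hz'] at hμ
    rw [hμ]
    refine Submodule.smul_mem _ _ (Submodule.subset_span ?_)
    simp only [S, Finset.coe_image]
    refine ⟨_, ?_, rfl⟩
    simp [px, py, hrep x hx hzx, hrep y hy hzy]
  have hcardP : Fintype.card P = Fintype.card F + 1 := by
    have := Projectivization.card_of_finrank_two (k := F) (V := Fin 2 → F) (by simp)
    rwa [Nat.card_eq_fintype_card, Nat.card_eq_fintype_card] at this
  have hS : S.card ≤ Fintype.card F - 1 := by
    refine Finset.card_image_le.trans ?_
    rw [Finset.card_sdiff_of_subset (Finset.subset_univ _), Finset.card_univ, hcardP,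
      Finset.card_pair hne]
    omega
  have hle : finrank ℂ V ≤ S.card := by
    have h1 : Submodule.span ℂ (S : Set V) = ⊤ := top_le_iff.1 (htop ▸ hAS)
    rw [← finrank_top, ← h1]
    exact finrank_span_finset_le_card S
  have := Fintype.card_pos (α := F)
  omega

/-- Elements of trace `±2` fix a vector of any equivariant family. -/
theorem exists_fixed_vector_of_trace_sq_eq_four
    (σ : SpecialLinearGroup (Fin 2) F →* Module.End ℂ V) (hneg : σ (-1) = 1)
    {w : (Fin 2 → F) → V} (hw : ∀ g x, x ≠ 0 → σ g (w x) = w (g.1 *ᵥ x))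
    (hw0 : ∀ x, x ≠ 0 → w x ≠ 0)
    {g : SpecialLinearGroup (Fin 2) F} (hg : g.1.trace ^ 2 = 4) :
    ∃ v : V, v ≠ 0 ∧ σ g v = v := by
  have hdet := g.2
  have main : ∀ c : F, c ^ 2 = 1 → g.1.trace = 2 * c → ∃ x, x ≠ 0 ∧ g.1 *ᵥ x = c • x := by
    intro c hc htr
    have h0 : (g.1 - c • (1 : Matrix (Fin 2) (Fin 2) F)).det = 0 := by
      rw [trace_fin_two] at htr
      rw [det_fin_two] at hdet ⊢
      simp
      linear_combination hdet - c * htr - hc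
    obtain ⟨x, hx, h⟩ := exists_mulVec_eq_zero_iff.2 h0
    refine ⟨x, hx, ?_⟩
    rw [sub_mulVec, smul_mulVec, one_mulVec] at h
    exact sub_eq_zero.1 h
  have hfac : (g.1.trace - 2) * (g.1.trace + 2) = 0 := by linear_combination hg
  rcases mul_eq_zero.1 hfac with h | h
  · obtain ⟨x, hx, hgx⟩ := main 1 (by ring) (by linear_combination h)
    exact ⟨w x, hw0 x hx, by rw [hw _ _ hx, hgx, one_smul]⟩
  · obtain ⟨x, hx, hgx⟩ := main (-1) (by ring) (by linear_combination h)
    refine ⟨w x, hw0 x hx, ?_⟩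
    have h1 := hw (-1) x hx
    rw [hneg, Module.End.one_apply] at h1
    rw [hw _ _ hx, hgx]
    conv_rhs => rw [h1]
    congr 1
    simp [neg_mulVec]

end Representation

end Matrix.SpecialLinearGroup

namespace Matrix.SpecialLinearGroup

variable {F : Type*} [Field F] [Fintype F] {V : Type*} [AddCommGroup V] [Module ℂ V]

/-- Twice the trace of a unipotent element depends on its parameter through the quadratic
character only. -/
theorem two_mul_trace_upperUnipotent [DecidableEq F]
    (σ : SpecialLinearGroup (Fin 2) F →* Module.End ℂ V) {e : F} (he : ¬IsSquare e) {x : F}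
    (hx : x ≠ 0) :
    2 * LinearMap.trace ℂ V (σ (upperUnipotent x)) =
      (LinearMap.trace ℂ V (σ (upperUnipotent 1)) + LinearMap.trace ℂ V (σ (upperUnipotent e))) +
      (quadraticChar F x : ℂ) * (LinearMap.trace ℂ V (σ (upperUnipotent 1)) -
        LinearMap.trace ℂ V (σ (upperUnipotent e))) := by
  have hsq : ∀ (a : F) (y : F), a ≠ 0 → LinearMap.trace ℂ V (σ (upperUnipotent (a ^ 2 * y))) =
      LinearMap.trace ℂ V (σ (upperUnipotent y)) := by
    intro a y ha
    have h := diagonalTorus_mul_upperUnipotent (Units.mk0 a ha) y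
    rw [Units.val_mk0] at h
    rw [eq_mul_inv_of_mul_eq h.symm, map_mul, LinearMap.trace_mul_comm, ← map_mul]
    group
  by_cases h : IsSquare x
  · rw [(quadraticChar_one_iff_isSquare hx).2 h]
    obtain ⟨a, rfl⟩ := h
    have ha : a ≠ 0 := by rintro rfl; simp at hx
    rw [show a * a = a ^ 2 * 1 by ring, hsq a 1 ha]
    push_cast
    ring
  · have hx1 := quadraticChar_neg_one_iff_not_isSquare.2 h
    have he1 := quadraticChar_neg_one_iff_not_isSquare.2 he
    have he0 : e ≠ 0 := by rintro rfl; exact he IsSquare.zero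
    have hprod : IsSquare (x * e) := by
      rw [← quadraticChar_one_iff_isSquare (mul_ne_zero hx he0), map_mul, hx1, he1]
      norm_num
    obtain ⟨a, ha⟩ := hprod
    have ha0 : a ≠ 0 := by rintro rfl; simp [hx, he0] at ha
    have hxe : x = (a / e) ^ 2 * e := by
      field_simp
      linear_combination ha
    rw [hx1]
    nth_rw 1 [hxe]
    rw [hsq _ _ (div_ne_zero ha0 he0)]
    push_cast
    ring

variable [FiniteDimensional ℂ V]

/-- A representation of `SL₂(q)` of degree `q > 3`, `q` odd, has a nonzero vector fixed by the
unipotent subgroup. -/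
theorem exists_unipotent_fixed_vector_of_three_lt (hF : ringChar F ≠ 2)
    (hdim : finrank ℂ V = Fintype.card F) (hcard : 3 < Fintype.card F)
    (σ : SpecialLinearGroup (Fin 2) F →* Module.End ℂ V) :
    ∃ v : V, v ≠ 0 ∧ ∀ x, σ (upperUnipotent x) v = v := by
  classical
  by_contra! hfix
  have hsum : ∑ x, σ (upperUnipotent x) = 0 := by
    ext v
    by_contra hne
    obtain ⟨y, hy⟩ := hfix _ hne
    apply hy
    rw [← Module.End.mul_apply, Finset.mul_sum]
    congr 1
    simp_rw [← map_mul, upperUnipotent_mul]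
    exact Fintype.sum_equiv (Equiv.addLeft y) _ _ fun x => rfl
  obtain ⟨e, he⟩ := FiniteField.exists_nonsquare hF
  let f : F → ℂ := fun x => LinearMap.trace ℂ V (σ (upperUnipotent x))
  have hf0 : f 0 = Fintype.card F := by
    simp only [f]
    rw [upperUnipotent_zero, map_one, LinearMap.trace_one, hdim]
  have hfsum : ∑ x, f x = 0 := by
    simp only [f]
    rw [← map_sum, hsum, map_zero]
  have hf : ∀ x, 2 * f x = (f 1 + f e) + (quadraticChar F x : ℂ) * (f 1 - f e) +
      if x = 0 then 2 * (Fintype.card F : ℂ) - (f 1 + f e) else 0 := by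
    intro x
    by_cases hx : x = 0
    · subst hx
      rw [if_pos rfl, hf0, quadraticChar_zero]
      push_cast
      ring
    · rw [if_neg hx, add_zero]
      exact two_mul_trace_upperUnipotent σ he hx
  have hχ : ∑ x : F, (quadraticChar F x : ℂ) = 0 := by
    exact_mod_cast quadraticChar_sum_zero hF
  have htot : ((Fintype.card F : ℂ) - 1) * (f 1 + f e) = -2 * (Fintype.card F : ℂ) := by
    have h := congrArg (2 * ·) hfsum
    simp only [Finset.mul_sum, mul_zero] at h
    simp_rw [hf] at h
    rw [Finset.sum_add_distrib, Finset.sum_add_distrib, ← Finset.sum_mul, hχ] at h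
    simp at h
    linear_combination h
  have hint : ∀ x, IsIntegral ℤ (f x) := fun x =>
    LinearMap.isIntegral_trace_of_pow_eq_one (orderOf_pos (upperUnipotent x))
      (by rw [← map_pow, pow_orderOf_eq_one, map_one])
  obtain ⟨q, hq⟩ : ∃ q : ℕ, Fintype.card F = q + 1 := ⟨_, (Nat.sub_add_cancel (by omega)).symm⟩
  have hq0 : (q : ℚ) ≠ 0 := by
    have : q ≠ 0 := by omega
    exact_mod_cast this
  have hr : f 1 + f e = algebraMap ℚ ℂ (-2 * (q + 1) / q) := by
    rw [hq] at htot
    push_cast at htot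
    have hq0' : (q : ℂ) ≠ 0 := by exact_mod_cast hq0
    simp
    field_simp
    linear_combination htot
  have hri := (hint 1).add (hint e)
  rw [hr, isIntegral_algebraMap_iff (algebraMap ℚ ℂ).injective,
    IsIntegrallyClosed.isIntegral_iff] at hri
  obtain ⟨m, hm⟩ := hri
  have hmq : m * q = -2 * (q + 1) := by
    rw [eq_intCast, eq_div_iff hq0] at hm
    exact_mod_cast hm
  have hdvd : (q : ℤ) ∣ 2 := ⟨-m - 2, by linear_combination hmq⟩
  have := Int.le_of_dvd (by norm_num) hdvd
  omega

/-- An irreducible three-dimensional representation of `PSL₂(3)` has a nonzero vector fixed by the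
unipotent subgroup. -/
theorem exists_unipotent_fixed_vector_of_card_eq_three (hdim : finrank ℂ V = 3)
    (hcard : Fintype.card F = 3)
    (σ : SpecialLinearGroup (Fin 2) F →* Module.End ℂ V) (hneg : σ (-1) = 1)
    (hirr : ∀ W : Submodule ℂ V, (∀ g, ∀ v ∈ W, σ g v ∈ W) → W = ⊥ ∨ W = ⊤) :
    ∃ v : V, v ≠ 0 ∧ ∀ x, σ (upperUnipotent x) v = v := by
  classical
  have h3 : (3 : F) = 0 := by
    have := Nat.cast_card_eq_zero F
    rw [hcard] at this
    exact_mod_cast this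
  have h2 : (2 : F) ≠ 0 := by
    intro h
    exact one_ne_zero (α := F) (by linear_combination h3 - h)
  have hcases : ∀ x : F, x = 0 ∨ x = 1 ∨ x = -1 := by
    have huniv : ({0, 1, -1} : Finset F) = Finset.univ := by
      apply Finset.eq_univ_of_card
      rw [hcard, Finset.card_eq_three]
      refine ⟨0, 1, -1, by simp, by simp, fun h => h2 (by linear_combination h), rfl⟩
    intro x
    have : x ∈ ({0, 1, -1} : Finset F) := huniv ▸ Finset.mem_univ x
    simpa using this
  have hσneg : ∀ g, σ (-g) = σ g := by
    intro g
    rw [← neg_one_mul, map_mul, hneg, one_mul]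
  by_contra! hfix
  set A : Module.End ℂ V := σ (upperUnipotent 1) with hA
  have hAA : A * A = σ (upperUnipotent (-1)) := by
    rw [hA, ← map_mul, upperUnipotent_mul]
    congr 2
    linear_combination h3
  have hAAA : A * A * A = 1 := by
    rw [hAA, hA, ← map_mul, upperUnipotent_mul, neg_add_cancel, upperUnipotent_zero, map_one]
  have hsum : 1 + A + A * A = 0 := by
    ext v
    by_contra hne
    have hAfix : A ((1 + A + A * A) v) = (1 + A + A * A) v := by
      rw [← Module.End.mul_apply]
      congr 1
      rw [mul_add, mul_add, mul_one, ← mul_assoc, hAAA]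
      abel
    obtain ⟨y, hy⟩ := hfix _ hne
    apply hy
    rcases hcases y with rfl | rfl | rfl
    · rw [upperUnipotent_zero, map_one, Module.End.one_apply]
    · exact hAfix
    · rw [← hAA, Module.End.mul_apply, hAfix, hAfix]
  let s : SpecialLinearGroup (Fin 2) F := ⟨!![0, -1; 1, 0], by simp⟩
  let j : SpecialLinearGroup (Fin 2) F := ⟨!![1, 1; 1, -1], by simp; linear_combination -h3⟩
  let k : SpecialLinearGroup (Fin 2) F := ⟨!![-1, 1; 1, 1], by simp; linear_combination -h3⟩
  have hs : s.1 = !![0, -1; 1, 0] := rfl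
  have hj : j.1 = !![1, 1; 1, -1] := rfl
  have hk : k.1 = !![-1, 1; 1, 1] := rfl
  have rel : ∀ g h : SpecialLinearGroup (Fin 2) F, g.1 = h.1 → σ g = σ h :=
    fun g h e => congrArg σ (Subtype.ext e)
  have rel' : ∀ g h : SpecialLinearGroup (Fin 2) F, g.1 = -h.1 → σ g = σ h :=
    fun g h e => (congrArg σ (Subtype.ext (by rw [e, coe_neg]))).trans (hσneg h)
  have hII : σ s * σ s = 1 := by
    rw [← map_mul, ← map_one σ]
    apply rel'
    simp [hs, one_fin_two]
  have hJJ : σ j * σ j = 1 := by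
    rw [← map_mul, ← map_one σ]
    apply rel'
    simp [hj, one_fin_two]
    linear_combination h3
  have hKK : σ k * σ k = 1 := by
    rw [← map_mul, ← map_one σ]
    apply rel'
    simp [hk, one_fin_two]
    linear_combination h3
  have hAI : A * σ s = σ j * A := by
    rw [hA, ← map_mul, ← map_mul]
    apply rel
    simp [hs, hj, coe_upperUnipotent]
    linear_combination -h3
  have hAJ : A * σ j = σ k * A := by
    rw [hA, ← map_mul, ← map_mul]
    apply rel
    simp [hj, hk, coe_upperUnipotent]
    constructor
    · linear_combination h3
    · linear_combination -h3
  have hIJ : σ s * σ j = σ k := by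
    rw [← map_mul]
    apply rel
    simp [hs, hj, hk]
  have hJI : σ j * σ s = σ k := by
    rw [← map_mul]
    apply rel'
    simp [hs, hj, hk]
  generalize hI : σ s = I at *
  generalize σ j = J at *
  generalize σ k = K at *
  have hIK : I * K = J := by rw [← hIJ, ← mul_assoc, hII, one_mul]
  have hJK : J * K = I := by rw [← hJI, ← mul_assoc, hJJ, one_mul]
  have hKI : K * I = J := by rw [← hJI, mul_assoc, hII, mul_one]
  have hKJ : K * J = I := by rw [← hIJ, mul_assoc, hJJ, mul_one]
  have hAK : A * K = I * A := by
    rw [← hIJ, ← mul_assoc, hAI, mul_assoc, hAJ, ← mul_assoc, hJK]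
  have hconj : ∀ X Y Z : Module.End ℂ V, X * X = 1 → A * X = Y * A → A * Y = Z * A →
      1 + (X * Y) * A + (X * Z) * (A * A) = 0 := by
    intro X Y Z hXX hXY hYZ
    have h : X * (1 + A + A * A) * X = 0 := by rw [hsum, mul_zero, zero_mul]
    rw [← h, mul_add, mul_add, add_mul, add_mul, mul_one, hXX, mul_assoc X A X, hXY,
      mul_assoc X (A * A) X, mul_assoc A A X, hXY, ← mul_assoc A Y A, hYZ]
    simp only [mul_assoc]
  have hI1 := hconj I J K hII hAI hAJ
  have hJ1 := hconj J K I hJJ hAJ hAK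
  have hK1 := hconj K I J hKK hAK hAI
  rw [hIJ, hIK] at hI1
  rw [hJK, hJI] at hJ1
  rw [hKI, hKJ] at hK1
  have hAA1 : A * A = -1 - A := by
    rw [← sub_eq_zero, ← hsum]
    abel
  have hfour : 1 + I + J + K = 4 • (1 : Module.End ℂ V) := by
    have h : (1 + K * A + J * (A * A)) + (1 + I * A + K * (A * A)) +
        (1 + J * A + I * (A * A)) = 0 := by rw [hI1, hJ1, hK1]; simp
    rw [hAA1] at h
    simp only [mul_sub, mul_neg, mul_one] at h
    rw [← sub_eq_zero, ← neg_eq_zero, ← h]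
    abel
  have hIone : I = 1 := by
    have h : I * (1 + I + J + K) = 1 + I + J + K := by
      rw [mul_add, mul_add, mul_add, mul_one, hII, hIJ, hIK]
      abel
    rw [hfour, mul_smul_comm, mul_one] at h
    have h4 : (4 : ℂ) • I = (4 : ℂ) • (1 : Module.End ℂ V) := by
      rw [← Nat.cast_smul_eq_nsmul ℂ, ← Nat.cast_smul_eq_nsmul ℂ] at h
      exact_mod_cast h
    exact smul_right_injective _ (by norm_num : (4 : ℂ) ≠ 0) h4
  have : Nontrivial V := Module.nontrivial_of_finrank_pos (R := ℂ) (by omega)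
  obtain ⟨μ, hμ⟩ := Module.End.exists_eigenvalue A
  obtain ⟨v, hv⟩ := hμ.exists_hasEigenvector
  have hAv : A v = μ • v := hv.apply_eq_smul
  have hline : ∀ y, ∃ c : ℂ, σ (upperUnipotent y) v = c • v := by
    intro y
    rcases hcases y with rfl | rfl | rfl
    · exact ⟨1, by rw [upperUnipotent_zero, map_one, Module.End.one_apply, one_smul]⟩
    · exact ⟨μ, hAv⟩
    · exact ⟨μ * μ, by rw [← hAA, Module.End.mul_apply, hAv, map_smul, hAv, smul_smul]⟩
  have hbruhat : ∀ g, ∃ c : ℂ, σ g v = c • v := by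
    intro g
    have hdet := g.2
    rw [det_fin_two] at hdet
    have hsign : ∀ (h : SpecialLinearGroup (Fin 2) F) (c : F), c ^ 2 = 1 → g.1 = c • h.1 →
        σ g = σ h := by
      intro h c hc hgh
      rcases sq_eq_one_iff.1 hc with rfl | rfl
      · exact rel _ _ (by rw [hgh, one_smul])
      · exact rel' _ _ (by rw [hgh, neg_one_smul])
    have hsq : ∀ x : F, x ≠ 0 → x ^ 2 = 1 := by
      intro x hx
      rcases hcases x with rfl | rfl | rfl
      · exact absurd rfl hx
      · ring
      · ring
    by_cases hc : g.1 1 0 = 0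
    · rw [hc, mul_zero, sub_zero] at hdet
      have ha := hsq _ (left_ne_zero_of_mul_eq_one hdet)
      obtain ⟨t, ht⟩ := hline (g.1 0 0 * g.1 0 1)
      refine ⟨t, ?_⟩
      rw [hsign (upperUnipotent (g.1 0 0 * g.1 0 1)) (g.1 0 0) ha ?_, ht]
      rw [coe_upperUnipotent]
      ext i j
      fin_cases i <;> fin_cases j <;> simp
      · linear_combination -g.1 0 1 * ha
      · exact hc
      · linear_combination g.1 0 0 * hdet - g.1 1 1 * ha
    · have hc2 := hsq _ hc
      obtain ⟨t, ht⟩ := hline (g.1 0 0 * g.1 1 0)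
      obtain ⟨r, hr⟩ := hline (g.1 1 1 * g.1 1 0)
      refine ⟨r * t, ?_⟩
      rw [hsign (upperUnipotent (g.1 0 0 * g.1 1 0) * s * upperUnipotent (g.1 1 1 * g.1 1 0))
        (g.1 1 0) hc2 ?_, map_mul, map_mul, hI, hIone, mul_one, Module.End.mul_apply, hr,
        map_smul, ht, smul_smul]
      rw [coe_mul, coe_mul, coe_upperUnipotent, coe_upperUnipotent, hs]
      ext i j
      fin_cases i <;> fin_cases j <;> simp
      · linear_combination -g.1 0 0 * hc2
      · linear_combination -g.1 1 0 * hdet - (g.1 0 1 + g.1 0 0 * g.1 1 1 * g.1 1 0) * hc2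
      · linear_combination -g.1 1 1 * hc2
  have htop : Submodule.span ℂ {v} = ⊤ := by
    refine (hirr _ fun g z hz => ?_).resolve_left fun h => ?_
    · obtain ⟨t, rfl⟩ := Submodule.mem_span_singleton.1 hz
      obtain ⟨c, hc⟩ := hbruhat g
      rw [map_smul, hc, smul_smul]
      exact Submodule.mem_span_singleton.2 ⟨_, rfl⟩
    · exact hv.2 (Submodule.span_singleton_eq_bot.1 h)
  have hone := finrank_span_singleton (K := ℂ) hv.2
  rw [htop, finrank_top] at hone
  omega

end Matrix.SpecialLinearGroup

/-- Let `F` be a finite field with `q` elements, `q` odd. Every irreducible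
complex character of `PSL₂(q)` of degree `q` is unisingular. -/
theorem PSL2_unisingular_of_deg_q (q : ℕ) (hodd : Odd q)
    (F : Type) [Field F] [Fintype F] (hF : Fintype.card F = q)
    (V : FDRep ℂ (PSL2 F)) (hV : Simple V)
    (hdeg : Module.finrank ℂ V = q) :
    V.IsUnisingular := by
  subst hF
  have hchar : ringChar F ≠ 2 := by
    intro h
    have := FiniteField.even_card_of_char_two h
    rw [Nat.odd_iff] at hodd
    omega
  let σ : SpecialLinearGroup (Fin 2) F →* Module.End ℂ V :=
    V.ρ.comp (QuotientGroup.mk' (Subgroup.center (SpecialLinearGroup (Fin 2) F)))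
  have hneg : σ (-1) = 1 := by
    have : QuotientGroup.mk' (Subgroup.center (SpecialLinearGroup (Fin 2) F)) (-1) = 1 := by
      rw [QuotientGroup.mk'_apply, QuotientGroup.eq_one_iff, Subgroup.mem_center_iff]
      intro g
      rw [mul_neg_one, neg_one_mul]
    simp only [σ, MonoidHom.comp_apply]
    rw [this, map_one]
  have hsurj := QuotientGroup.mk'_surjective (Subgroup.center (SpecialLinearGroup (Fin 2) F))
  have hirr : ∀ W : Submodule ℂ V, (∀ g, ∀ v ∈ W, σ g v ∈ W) → W = ⊥ ∨ W = ⊤ := by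
    intro W hW
    apply FDRep.eq_bot_or_eq_top_of_simple V W
    intro g
    obtain ⟨h, rfl⟩ := hsurj g
    exact hW h
  intro g
  obtain ⟨h, rfl⟩ := hsurj g
  obtain ⟨u, hu, hUu⟩ : ∃ v : V, v ≠ 0 ∧ ∀ x, σ (SpecialLinearGroup.upperUnipotent x) v = v := by
    have hone := Fintype.one_lt_card (α := F)
    have hne : Fintype.card F ≠ 2 := fun h => by rw [h] at hodd; exact absurd hodd (by decide)
    by_cases hthree : Fintype.card F = 3
    · exact SpecialLinearGroup.exists_unipotent_fixed_vector_of_card_eq_three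
        (hdeg.trans hthree) hthree σ hneg hirr
    · exact SpecialLinearGroup.exists_unipotent_fixed_vector_of_three_lt hchar hdeg (by omega) σ
  obtain ⟨v, hv, hUv, hTv⟩ := SpecialLinearGroup.exists_highest_weight_vector σ hu hUu
  obtain ⟨w, hw, hw0, hwc⟩ := SpecialLinearGroup.exists_equivariant_family σ hv hUv hTv
  obtain ⟨z, hz, hfix⟩ : ∃ z : V, z ≠ 0 ∧ σ h z = z := by
    by_cases htr : h.1.trace ^ 2 = 4
    · exact SpecialLinearGroup.exists_fixed_vector_of_trace_sq_eq_four σ hneg hw hw0 htr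
    · exact SpecialLinearGroup.exists_fixed_vector_of_trace_sq_ne_four hchar hdeg σ hneg hirr
        hw hw0 hwc htr
  refine Module.End.hasEigenvalue_of_hasEigenvector (x := z) ⟨?_, hz⟩
  rw [Module.End.mem_eigenspace_iff, one_smul]
  exact hfix
end

section
/- Let q ≥ 4 be a power of 2 and let χ be an irreducible complex character of PSL_2(q) of degree q. Then for any representation Φ affording χ and any element h of PSL_2(q) of order q+1, the linear map Φ(h) does not have 1 as an eigenvalue; in particular χ is not unisingular. -/
open Module FDRep Matrix CategoryTheory

open scoped MatrixGroups

namespace FDRep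

/-- A nonzero invariant subspace of a simple representation is everything. -/
lemma eq_top_of_invariant {k G : Type} [Field k] [Monoid G] (V : FDRep k G) [Simple V]
    (W : Submodule k V) (hW : ∀ g, ∀ w ∈ W, V.ρ g w ∈ W) (hne : W ≠ ⊥) : W = ⊤ := by
  let S : Subrepresentation V.ρ := ⟨W, fun g v hv => hW g v hv⟩
  let f : FDRep.of S.toRepresentation ⟶ V :=
    ⟨InducedCategory.homMk (ModuleCat.ofHom W.subtype), fun g => by ext; rfl⟩
  have hf : ∀ w : W, f.hom.hom.hom w = w := fun w => rfl
  have : Mono f := by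
    refine ConcreteCategory.mono_of_injective f ?_
    exact Subtype.val_injective
  have hf0 : f ≠ 0 := by
    intro h0
    refine hne ((Submodule.eq_bot_iff W).2 fun w hw => ?_)
    have := hf ⟨w, hw⟩
    rw [h0] at this
    exact this.symm
  have := isIso_of_mono_of_nonzero hf0
  refine eq_top_iff.2 fun v _ => ?_
  have h1 : f.hom.hom.hom ((inv f).hom.hom.hom v) = v := by
    have := congrArg (fun φ : V ⟶ V => φ.hom.hom.hom v) (IsIso.inv_hom_id f)
    exact this
  rw [← h1]
  exact Subtype.property _

end FDRep

section LinearAlgebra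

variable {V : Type*} [AddCommGroup V] [Module ℂ V] [FiniteDimensional ℂ V]

lemma LinearMap.exists_int_trace_eq_of_mul_self_eq_one {f : Module.End ℂ V} (hf : f * f = 1) :
    ∃ n : ℤ, LinearMap.trace ℂ V f = n := by
  have hp : IsIdempotentElem ((1 / 2 : ℂ) • (1 + f)) := by
    rw [IsIdempotentElem, smul_mul_smul_comm, mul_add, add_mul, add_mul, hf]
    simp only [one_mul, mul_one]
    module
  have ht := (LinearMap.IsIdempotentElem.isProj_range _ hp).trace
  rw [map_smul, map_add, LinearMap.trace_one, smul_eq_mul] at ht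
  refine ⟨2 * finrank ℂ (LinearMap.range ((1 / 2 : ℂ) • (1 + f))) - finrank ℂ V, ?_⟩
  push_cast
  rw [← ht]
  ring

open Polynomial in
/-- If an endomorphism has a cyclic vector, then its minimal polynomial has full degree. -/
lemma Module.End.finrank_le_natDegree_minpoly_of_cyclic {f : Module.End ℂ V} {v : V}
    (hv : ∀ w, ∃ p : ℂ[X], aeval f p v = w) : finrank ℂ V ≤ (minpoly ℂ f).natDegree := by
  have hm := minpoly.monic (Algebra.IsIntegral.isIntegral (R := ℂ) f)
  let φ : degreeLT ℂ (minpoly ℂ f).natDegree →ₗ[ℂ] V :=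
    (LinearMap.applyₗ v) ∘ₗ (aeval f).toLinearMap ∘ₗ Submodule.subtype _
  have hφ : Function.Surjective φ := by
    intro w
    obtain ⟨p, rfl⟩ := hv w
    refine ⟨⟨p %ₘ minpoly ℂ f, ?_⟩, ?_⟩
    · rw [mem_degreeLT, ← degree_eq_natDegree hm.ne_zero]
      exact degree_modByMonic_lt p hm
    · change aeval f (p %ₘ minpoly ℂ f) v = aeval f p v
      rw [modByMonic_eq_sub_mul_div p (minpoly ℂ f)]
      simp
  have := LinearMap.finrank_le_finrank_of_surjective hφ
  rwa [(degreeLTEquiv ℂ (minpoly ℂ f).natDegree).finrank_eq, finrank_fin_fun] at this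

open Polynomial in
/-- In even dimension `q`, an endomorphism of determinant one with a cyclic vector and
`(q + 1)`-st power one has as eigenvalues the nontrivial `(q + 1)`-st roots of unity. -/
lemma Module.End.not_hasEigenvalue_one_of_cyclic {f : Module.End ℂ V} {v : V} {q : ℕ}
    (hq : Even q) (hdim : finrank ℂ V = q) (hpow : f ^ (q + 1) = 1)
    (hdet : LinearMap.det f = 1) (hv : ∀ w, ∃ p : ℂ[X], aeval f p v = w) :
    ¬ f.HasEigenvalue 1 := by
  have hdeg : f.charpoly.natDegree = q := by rw [LinearMap.charpoly_natDegree, hdim]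
  have hm := minpoly.monic (Algebra.IsIntegral.isIntegral (R := ℂ) f)
  have hmc : f.charpoly = minpoly ℂ f := by
    refine eq_of_monic_of_dvd_of_natDegree_le hm (LinearMap.charpoly_monic f)
      (LinearMap.minpoly_dvd_charpoly f) ?_
    rw [hdeg, ← hdim]
    exact finrank_le_natDegree_minpoly_of_cyclic hv
  have hdvd : f.charpoly ∣ X ^ (q + 1) - C 1 := by
    rw [hmc]
    apply minpoly.dvd
    simp [hpow]
  obtain ⟨r, hr⟩ := hdvd
  have hXm : (X ^ (q + 1) - C (1 : ℂ)).Monic := monic_X_pow_sub_C 1 (by omega)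
  have hrm : r.Monic := (LinearMap.charpoly_monic f).of_mul_monic_left (hr ▸ hXm)
  have hrd : r.natDegree = 1 := by
    have := congrArg natDegree hr
    rw [natDegree_X_pow_sub_C, (LinearMap.charpoly_monic f).natDegree_mul hrm, hdeg] at this
    omega
  have hrX : r = X + C (r.coeff 0) := hrm.eq_X_add_C hrd
  have hc : f.charpoly.coeff 0 = 1 := by
    have := LinearMap.det_eq_sign_charpoly_coeff f
    rwa [hdet, hdim, hq.neg_one_pow, one_mul, eq_comm] at this
  have hr0 : r.coeff 0 = -1 := by
    have := congrArg (fun p => coeff p 0) hr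
    simp only [mul_coeff_zero, hc, one_mul, coeff_sub, coeff_X_pow, coeff_C_zero] at this
    rw [← this]
    simp
  rw [hrX, hr0] at hr
  have hd := congrArg (fun p => (derivative p).eval 1) hr
  simp at hd
  rw [Module.End.hasEigenvalue_iff_isRoot_charpoly, IsRoot.def]
  intro h0
  rw [h0] at hd
  norm_cast at hd

end LinearAlgebra

namespace Matrix.SpecialLinearGroup

variable {F : Type*} [Field F]

lemma transvection_coe_fin_two (x : F) :
    (transvection (zero_ne_one (α := Fin 2)) x).1 = !![1, x; 0, 1] := by
  ext i j
  fin_cases i <;> fin_cases j <;> simp [transvection_coe]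

lemma transvection_mul_diag2 {t : F} (ht : t ≠ 0) (x : F) :
    transvection (zero_ne_one (α := Fin 2)) (t ^ 2 * x) * diag2 t ht =
      diag2 t ht * transvection zero_ne_one x := by
  apply Subtype.ext
  rw [coe_mul, coe_mul, transvection_coe_fin_two, transvection_coe_fin_two, diag2_coe',
    mul_fin_two, mul_fin_two]
  ext i j
  fin_cases i <;> fin_cases j <;> simp
  field_simp

lemma diag2_mul {s t : F} (hs : s ≠ 0) (ht : t ≠ 0) :
    diag2 (s * t) (mul_ne_zero hs ht) = diag2 s hs * diag2 t ht := by
  apply Subtype.ext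
  rw [coe_mul, diag2_coe', diag2_coe', diag2_coe', mul_fin_two]
  ext i j
  fin_cases i <;> fin_cases j <;> simp [mul_comm]

lemma det_expand_fin_two (A : SL(2, F)) : A 0 0 * A 1 1 - A 0 1 * A 1 0 = 1 := by
  rw [← det_fin_two A.1, A.2]

lemma apply_zero_zero_ne_zero_of_lower_eq_zero {A : SL(2, F)} (hA : A 1 0 = 0) : A 0 0 ≠ 0 := by
  intro h
  have := det_expand_fin_two A
  simp [hA, h] at this

lemma eq_diag2_mul_transvection {A : SL(2, F)} (hA : A 1 0 = 0) :
    A = diag2 (A 0 0) (apply_zero_zero_ne_zero_of_lower_eq_zero hA) *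
      transvection zero_ne_one ((A 0 0)⁻¹ * A 0 1) := by
  have h0 := apply_zero_zero_ne_zero_of_lower_eq_zero hA
  have := det_expand_fin_two A
  apply Subtype.ext
  rw [coe_mul, diag2_coe', transvection_coe_fin_two, mul_fin_two]
  ext i j
  fin_cases i <;> fin_cases j <;> simp [hA, h0]
  rw [hA, mul_zero, sub_zero] at this
  exact eq_inv_of_mul_eq_one_right this

lemma pow_apply_of_lower_eq_zero {A : SL(2, F)} (hA : A 1 0 = 0) (n : ℕ) :
    (A ^ n) 1 0 = 0 ∧ (A ^ n) 0 0 = A 0 0 ^ n ∧ (A ^ n) 1 1 = A 1 1 ^ n := by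
  induction n with
  | zero => simp
  | succ n ih =>
    obtain ⟨h1, h2, h3⟩ := ih
    rw [pow_succ, pow_succ, pow_succ, ← h2, ← h3]
    generalize A ^ n = B at *
    simp [mul_apply, h1, hA]

lemma pow_eq_one_of_lower_eq_zero [Fintype F] [CharP F 2] {A : SL(2, F)} (hA : A 1 0 = 0) :
    A ^ ((Fintype.card F - 1) * 2) = 1 := by
  have h0 := apply_zero_zero_ne_zero_of_lower_eq_zero hA
  have hd := det_expand_fin_two A
  rw [hA, mul_zero, sub_zero] at hd
  have h1 : A 1 1 ≠ 0 := right_ne_zero_of_mul_eq_one hd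
  obtain ⟨e1, e2, e3⟩ := pow_apply_of_lower_eq_zero hA (Fintype.card F - 1)
  rw [FiniteField.pow_card_sub_one_eq_one _ h0] at e2
  rw [FiniteField.pow_card_sub_one_eq_one _ h1] at e3
  rw [pow_mul]
  generalize A ^ (Fintype.card F - 1) = B at *
  ext i j
  fin_cases i <;> fin_cases j <;>
    simp [pow_two, mul_apply, e1, e2, e3, CharTwo.add_self_eq_zero]

open Classical in
/-- The image of the point at infinity of the projective line under a fractional linear
transformation. -/
noncomputable def imageInfty (A : SL(2, F)) : Option F :=
  if A 1 0 = 0 then none else some (A 0 0 / A 1 0)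

lemma inv_mul_lower_eq_zero_of_imageInfty_eq {A B : SL(2, F)} (h : imageInfty A = imageInfty B) :
    (A⁻¹ * B) 1 0 = 0 := by
  have key : A 0 0 * B 1 0 = A 1 0 * B 0 0 := by
    unfold imageInfty at h
    split_ifs at h with h1 h2 h2
    · simp [h1, h2]
    · rw [Option.some_inj, div_eq_div_iff h1 h2] at h
      rw [h, mul_comm]
  simp [mul_apply, coe_inv, adjugate_fin_two, key]

lemma exists_pow_inv_mul_lower_eq_zero [Fintype F] [CharP F 2] (hF : Even (Fintype.card F))
    {g : SL(2, F)} (hg : ∀ k, g ^ k = 1 → Fintype.card F + 1 ∣ k) (A : SL(2, F)) :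
    ∃ i : ℕ, ((g ^ i)⁻¹ * A) 1 0 = 0 := by
  have h1 : 1 < Fintype.card F := Fintype.one_lt_card
  have hcop : (Fintype.card F + 1).Coprime ((Fintype.card F - 1) * 2) := by
    have h2 : (Fintype.card F + 1).Coprime 2 := by
      rw [Nat.coprime_two_right]
      exact hF.add_one
    refine Nat.Coprime.mul_right ?_ h2
    have : Fintype.card F + 1 = 2 + (Fintype.card F - 1) := by omega
    rw [this, Nat.coprime_add_self_left, Nat.coprime_comm, Nat.coprime_two_right]
    exact Nat.Even.sub_odd h1.le hF odd_one
  have hle : ∀ i j : Fin (Fintype.card F + 1), i ≤ j →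
      imageInfty (g ^ (i : ℕ)) = imageInfty (g ^ (j : ℕ)) → i = j := by
    intro i j hij h
    have h3 := inv_mul_lower_eq_zero_of_imageInfty_eq h
    have h4 : (g ^ (i : ℕ))⁻¹ * g ^ (j : ℕ) = g ^ ((j : ℕ) - i) := by
      rw [inv_mul_eq_iff_eq_mul, ← pow_add, Nat.add_sub_cancel' hij]
    rw [h4] at h3
    have h5 := pow_eq_one_of_lower_eq_zero h3
    rw [← pow_mul] at h5
    have h6 := hcop.dvd_of_dvd_mul_right (hg _ h5)
    have h7 := Nat.eq_zero_of_dvd_of_lt h6 (by omega)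
    exact Fin.ext (by have : (i : ℕ) ≤ j := hij; omega)
  have hinj : Function.Injective
      fun i : Fin (Fintype.card F + 1) => imageInfty (g ^ (i : ℕ)) := by
    intro i j h
    rcases le_total i j with hij | hij
    · exact hle i j hij h
    · exact (hle j i hij h.symm).symm
  have hbij := (Fintype.bijective_iff_injective_and_card _).2 ⟨hinj, by simp⟩
  obtain ⟨i, hi⟩ := hbij.2 (imageInfty A)
  exact ⟨i, inv_mul_lower_eq_zero_of_imageInfty_eq hi⟩

end Matrix.SpecialLinearGroup

namespace Matrix.SpecialLinearGroup

variable {F : Type*} [Field F]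

/-- For `F` finite of characteristic two, `SL₂(F)` has an element of order `|F| + 1`, coming
from the multiplicative group of the quadratic extension. -/
lemma exists_pow_eq_one_iff_card_add_one_dvd [Fintype F] [CharP F 2] :
    ∃ M : SL(2, F), ∀ k, M ^ k = 1 ↔ Fintype.card F + 1 ∣ k := by
  have h1 : 1 < Fintype.card F := Fintype.one_lt_card
  set q := Fintype.card F with hq
  let K := FiniteField.Extension F 2 2
  have hK : Nat.card K = q ^ 2 := by
    rw [FiniteField.natCard_extension, Nat.card_eq_fintype_card]
  have := Fintype.ofFinite K
  obtain ⟨γ, hγ⟩ := IsCyclic.exists_generator (α := Kˣ)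
  have hγo : orderOf γ = (q + 1) * (q - 1) := by
    rw [orderOf_eq_card_of_forall_mem_zpowers hγ, Nat.card_units, hK, ← Nat.sq_sub_sq, one_pow]
  have hζ : orderOf ((γ ^ (q - 1) : Kˣ) : K) = q + 1 := by
    rw [orderOf_units, orderOf_pow_of_dvd (by omega) (hγo ▸ dvd_mul_left _ _), hγo,
      Nat.mul_div_cancel _ (by omega)]
  set ζ : K := ((γ ^ (q - 1) : Kˣ) : K)
  let b : Basis (Fin 2) F K := finBasisOfFinrankEq F K (FiniteField.finrank_extension F 2 2)
  let N : Matrix (Fin 2) (Fin 2) F := Algebra.leftMulMatrix b ζ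
  have hN : ∀ k, N ^ k = 1 ↔ q + 1 ∣ k := by
    intro k
    rw [← map_pow, ← hζ, orderOf_dvd_iff_pow_eq_one]
    exact map_eq_one_iff _ (Algebra.leftMulMatrix_injective b)
  have hdet : N.det = 1 := by
    have e1 : N.det ^ (q + 1) = 1 := by rw [← det_pow, (hN _).2 dvd_rfl, det_one]
    have h0 : N.det ≠ 0 := by
      intro h
      simp [h] at e1
    have e2 : N.det ^ q = N.det := FiniteField.pow_card _
    rw [pow_succ, e2] at e1
    have e3 : (N.det - 1) ^ 2 = 0 := by
      linear_combination e1 + (1 - N.det) * CharTwo.two_eq_zero (R := F)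
    exact sub_eq_zero.1 (pow_eq_zero_iff two_ne_zero |>.1 e3)
  obtain ⟨M, hMN⟩ : ∃ M : SL(2, F), M.1 = N := ⟨⟨N, hdet⟩, rfl⟩
  refine ⟨M, fun k => ?_⟩
  rw [← hN, ← hMN, ← coe_pow, ← coe_one]
  exact Subtype.ext_iff

/-- For `F` finite of characteristic two, `PSL₂(F)` has an element of order `|F| + 1`. -/
lemma exists_orderOf_eq_card_add_one [Fintype F] [CharP F 2] (hF : Even (Fintype.card F)) :
    ∃ h : ProjectiveSpecialLinearGroup (Fin 2) F, orderOf h = Fintype.card F + 1 := by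
  obtain ⟨M, hM⟩ := exists_pow_eq_one_iff_card_add_one_dvd (F := F)
  refine ⟨QuotientGroup.mk M, Nat.dvd_antisymm ?_ ?_⟩
  · rw [orderOf_dvd_iff_pow_eq_one, ← QuotientGroup.mk_pow, (hM _).2 dvd_rfl,
      QuotientGroup.mk_one]
  · have h1 := pow_orderOf_eq_one (QuotientGroup.mk M : ProjectiveSpecialLinearGroup (Fin 2) F)
    generalize orderOf (QuotientGroup.mk M : ProjectiveSpecialLinearGroup (Fin 2) F) = k
      at h1 ⊢
    rw [← QuotientGroup.mk_pow, QuotientGroup.eq_one_iff, mem_center_iff] at h1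
    obtain ⟨r, hr, hr'⟩ := h1
    have h2 : M ^ (k * 2) = 1 := by
      apply Subtype.ext
      rw [pow_mul, coe_pow, ← hr', ← map_pow, coe_one]
      rw [Fintype.card_fin] at hr
      rw [hr, map_one]
    have h3 : (Fintype.card F + 1).Coprime 2 := by
      rw [Nat.coprime_two_right]
      exact hF.add_one
    exact h3.dvd_of_dvd_mul_right ((hM _).1 h2)

section Representation

variable {V : Type*} [AddCommGroup V] [Module ℂ V]

lemma det_eq_one_of_representation {a : F} (ha : a ≠ 0) (ha2 : a ^ 2 ≠ 1)
    (ρ : SL(2, F) →* Module.End ℂ V) (g : SL(2, F)) : LinearMap.det (ρ g) = 1 := by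
  let δ : SL(2, F) →* ℂˣ := (LinearMap.det.comp ρ).toHomUnits
  have h : g ∈ δ.ker :=
    Abelianization.commutator_subset_ker δ (SL2.commutator_eq_top ha ha2 ▸ Subgroup.mem_top g)
  exact congrArg Units.val (MonoidHom.mem_ker.1 h)

variable (F) in
/-- The vectors fixed by all upper unitriangular matrices. -/
def unipotentInvariants (ρ : SL(2, F) →* Module.End ℂ V) : Submodule ℂ V :=
  ⨅ x : F, LinearMap.eqLocus (ρ (transvection zero_ne_one x)) LinearMap.id

lemma mem_unipotentInvariants {ρ : SL(2, F) →* Module.End ℂ V} {v : V} :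
    v ∈ unipotentInvariants F ρ ↔ ∀ x : F, ρ (transvection zero_ne_one x) v = v := by
  simp [unipotentInvariants]

lemma diag2_mem_unipotentInvariants {ρ : SL(2, F) →* Module.End ℂ V} {t : F} (ht : t ≠ 0) {v : V}
    (hv : v ∈ unipotentInvariants F ρ) : ρ (diag2 t ht) v ∈ unipotentInvariants F ρ := by
  rw [mem_unipotentInvariants] at *
  intro x
  have hx : x = t ^ 2 * (x / t ^ 2) := by field_simp
  rw [← Module.End.mul_apply, ← map_mul, hx, transvection_mul_diag2, map_mul, Module.End.mul_apply,
    hv]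

lemma transvection_mul_transvection (x y : F) :
    (transvection zero_ne_one x : SL(2, F)) * transvection zero_ne_one y =
      transvection zero_ne_one (x + y) := by
  apply Subtype.ext
  simp [coe_mul, transvection_coe_fin_two, add_comm]

variable [FiniteDimensional ℂ V]

lemma unipotentInvariants_ne_bot [Fintype F] [CharP F 2] (h4 : 4 ≤ Fintype.card F)
    (ρ : SL(2, F) →* Module.End ℂ V) (hdim : finrank ℂ V = Fintype.card F) :
    unipotentInvariants F ρ ≠ ⊥ := by
  classical
  intro hbot
  have hP : ∑ x : F, ρ (transvection zero_ne_one x) = 0 := by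
    ext w
    rw [LinearMap.zero_apply, ← Submodule.mem_bot ℂ, ← hbot, mem_unipotentInvariants]
    intro y
    simp only [LinearMap.sum_apply, map_sum]
    simp only [← Module.End.mul_apply, ← map_mul, transvection_mul_transvection]
    exact Fintype.sum_equiv (Equiv.addLeft y) _ _ fun x => rfl
  obtain ⟨n, hn⟩ := LinearMap.exists_int_trace_eq_of_mul_self_eq_one
    (f := ρ (transvection zero_ne_one 1)) (by
      rw [← map_mul, transvection_mul_transvection, CharTwo.add_self_eq_zero,
        transvection_coeff_zero, map_one])
  have htr : ∀ x : F, x ≠ 0 →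
      LinearMap.trace ℂ V (ρ (transvection zero_ne_one x)) = n := by
    intro x hx
    obtain ⟨t, rfl⟩ := FiniteField.isSquare_of_char_two (ringChar.eq F 2) x
    have ht : t ≠ 0 := left_ne_zero_of_mul hx
    have h1 := transvection_mul_diag2 ht (1 : F)
    rw [mul_one, pow_two] at h1
    rw [eq_mul_inv_of_mul_eq h1, map_mul, LinearMap.trace_mul_comm, ← map_mul,
      inv_mul_cancel_left, hn]
  have h0 := congrArg (LinearMap.trace ℂ V) hP
  rw [map_sum, map_zero, ← Finset.add_sum_erase _ _ (Finset.mem_univ 0),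
    Finset.sum_congr rfl (fun x hx => htr x (Finset.ne_of_mem_erase hx)),
    transvection_coeff_zero, map_one, LinearMap.trace_one, hdim, Finset.sum_const,
    Finset.card_erase_of_mem (Finset.mem_univ _), Finset.card_univ, nsmul_eq_mul] at h0
  have h1 : (Fintype.card F : ℤ) + ((Fintype.card F - 1 : ℕ) : ℤ) * n = 0 := by exact_mod_cast h0
  have h2 : ((Fintype.card F - 1 : ℕ) : ℤ) ∣ 1 := by
    refine ⟨-n - 1, ?_⟩
    push_cast [show 1 ≤ Fintype.card F by omega] at h1 ⊢
    linear_combination h1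
  have h3 := Int.le_of_dvd one_pos h2
  omega

/-- A representation of `SL₂(F)` of degree `|F|` has a common eigenvector for the upper
triangular matrices. -/
lemma exists_borel_eigenvector [Fintype F] [CharP F 2] (h4 : 4 ≤ Fintype.card F)
    (ρ : SL(2, F) →* Module.End ℂ V) (hdim : finrank ℂ V = Fintype.card F) :
    ∃ v : V, v ≠ 0 ∧ ∀ A : SL(2, F), A 1 0 = 0 → ∃ c : ℂ, ρ A v = c • v := by
  obtain ⟨t, ht⟩ := IsCyclic.exists_monoid_generator (α := Fˣ)
  let f : Module.End ℂ (unipotentInvariants F ρ) :=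
    (ρ (diag2 (t : F) t.ne_zero)).restrict fun _ => diag2_mem_unipotentInvariants t.ne_zero
  have : Nontrivial (unipotentInvariants F ρ) :=
    Submodule.nontrivial_iff_ne_bot.2 (unipotentInvariants_ne_bot h4 ρ hdim)
  obtain ⟨μ, hμ⟩ := Module.End.exists_eigenvalue f
  obtain ⟨⟨v, hvU⟩, hv⟩ := hμ.exists_hasEigenvector
  have hfv : ρ (diag2 (t : F) t.ne_zero) v = μ • v := congrArg Subtype.val hv.apply_eq_smul
  refine ⟨v, fun h => hv.2 (Subtype.ext h), fun A hA => ?_⟩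
  have hd : ∀ n : ℕ, ρ (diag2 ((t : F) ^ n) (pow_ne_zero n t.ne_zero)) v = μ ^ n • v := by
    intro n
    induction n with
    | zero =>
      have : diag2 ((t : F) ^ 0) (pow_ne_zero 0 t.ne_zero) = 1 := by
        apply Subtype.ext
        rw [diag2_coe']
        simp [one_fin_two]
      rw [this]
      simp
    | succ n ih =>
      have : diag2 ((t : F) ^ (n + 1)) (pow_ne_zero (n + 1) t.ne_zero) =
          diag2 ((t : F) ^ n) (pow_ne_zero n t.ne_zero) * diag2 (t : F) t.ne_zero := by
        rw [← diag2_mul]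
        congr 1
        exact pow_succ _ _
      rw [this, map_mul, Module.End.mul_apply, hfv, map_smul, ih, smul_smul, pow_succ']
  have h0 := apply_zero_zero_ne_zero_of_lower_eq_zero hA
  obtain ⟨n, hn⟩ := ht (Units.mk0 _ h0)
  refine ⟨μ ^ n, ?_⟩
  rw [eq_diag2_mul_transvection hA, map_mul, Module.End.mul_apply, mem_unipotentInvariants.1 hvU,
    ← hd n]
  congr 3
  simpa using (congrArg Units.val hn).symm

end Representation

end Matrix.SpecialLinearGroup

open Polynomial in
/-- In a simple representation of `PSL₂(F)` of degree `|F|`, with `F` of characteristic two, no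
element of order `|F| + 1` has the eigenvalue `1`. -/
lemma PSL2.not_hasEigenvalue_one_of_orderOf {F : Type} [Field F] [Fintype F] [CharP F 2]
    (hF : Even (Fintype.card F)) (h4 : 4 ≤ Fintype.card F) (V : FDRep ℂ (PSL2 F)) [Simple V]
    (hdeg : finrank ℂ V = Fintype.card F) {h : PSL2 F} (hh : orderOf h = Fintype.card F + 1) :
    ¬ Module.End.HasEigenvalue (V.ρ h) 1 := by
  classical
  let ρ : SL(2, F) →* Module.End ℂ V := V.ρ.comp (QuotientGroup.mk' _)
  obtain ⟨g, rfl⟩ := QuotientGroup.mk_surjective h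
  obtain ⟨v, hv0, hv⟩ := SpecialLinearGroup.exists_borel_eigenvector h4 ρ hdeg
  have hg : ∀ k, g ^ k = 1 → Fintype.card F + 1 ∣ k := by
    intro k hk
    rw [← hh, orderOf_dvd_iff_pow_eq_one, ← QuotientGroup.mk_pow, hk, QuotientGroup.mk_one]
  obtain ⟨a, ha, ha2⟩ : ∃ a : F, a ≠ 0 ∧ a ^ 2 ≠ 1 := by
    obtain ⟨a, ha⟩ : ∃ a : F, a ∉ ({0, 1} : Finset F) := by
      by_contra! hcon
      have := Finset.card_le_card (fun x _ => hcon x : Finset.univ ⊆ ({0, 1} : Finset F))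
      have h2 := Finset.card_le_two (a := (0 : F)) (b := 1)
      rw [Finset.card_univ] at this
      omega
    simp only [Finset.mem_insert, Finset.mem_singleton, not_or] at ha
    refine ⟨a, ha.1, fun h => ha.2 ?_⟩
    have e : (a - 1) ^ 2 = 0 := by
      linear_combination h + (1 - a) * CharTwo.two_eq_zero (R := F)
    exact sub_eq_zero.1 ((pow_eq_zero_iff two_ne_zero).1 e)
  let W : Submodule ℂ V := LinearMap.range ((LinearMap.applyₗ v) ∘ₗ (aeval (ρ g)).toLinearMap)
  have hmem : ∀ p : ℂ[X], aeval (ρ g) p v ∈ W := fun p => ⟨p, rfl⟩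
  have horb : ∀ A : SL(2, F), ρ A v ∈ W := by
    intro A
    obtain ⟨i, hi⟩ := SpecialLinearGroup.exists_pow_inv_mul_lower_eq_zero hF hg A
    obtain ⟨c, hc⟩ := hv _ hi
    have h1 : ρ A v = c • aeval (ρ g) (X ^ i : ℂ[X]) v := by
      rw [map_pow, aeval_X, ← map_smul, ← hc, ← Module.End.mul_apply, ← map_pow, ← map_mul,
        mul_inv_cancel_left]
    rw [h1]
    exact W.smul_mem _ (hmem _)
  have hinv : ∀ k : PSL2 F, ∀ w ∈ W, V.ρ k w ∈ W := by
    intro k w hw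
    obtain ⟨A, rfl⟩ := QuotientGroup.mk_surjective k
    obtain ⟨p, rfl⟩ := hw
    change ρ A (aeval (ρ g) p v) ∈ W
    induction p using Polynomial.induction_on' with
    | add p r hp hr =>
      rw [map_add, LinearMap.add_apply, map_add]
      exact W.add_mem hp hr
    | monomial n c =>
      rw [aeval_monomial, Module.End.mul_apply, Module.algebraMap_end_apply, map_smul, ← map_pow,
        ← Module.End.mul_apply, ← map_mul]
      exact W.smul_mem _ (horb _)
  have htop : W = ⊤ := V.eq_top_of_invariant W hinv fun hbot => hv0 <| by
    have := hmem 1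
    rwa [map_one, Module.End.one_apply, hbot, Submodule.mem_bot] at this
  refine Module.End.not_hasEigenvalue_one_of_cyclic (f := ρ g) (v := v) hF hdeg ?_
    (SpecialLinearGroup.det_eq_one_of_representation ha ha2 ρ g) fun w => ?_
  · have := pow_orderOf_eq_one (QuotientGroup.mk g : PSL2 F)
    rw [hh] at this
    change V.ρ (QuotientGroup.mk g) ^ _ = 1
    rw [← map_pow, this, map_one]
  · exact (htop ▸ Submodule.mem_top : w ∈ W)

/-- Let `F` be a finite field with `q` elements, where `q ≥ 4` is a power of
`2`. For every irreducible complex character of `PSL₂(q)` of degree `q`, every element of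
order `q + 1` acts without the eigenvalue `1`; in particular the character is not
unisingular. -/
theorem PSL2_even_not_unisingular_of_deg_q (q : ℕ) (hq : ∃ k : ℕ, q = 2 ^ k) (h4 : 4 ≤ q)
    (F : Type) [Field F] [Fintype F] (hF : Fintype.card F = q)
    (V : FDRep ℂ (PSL2 F)) (hV : Simple V)
    (hdeg : Module.finrank ℂ V = q) :
    (∀ h : PSL2 F, orderOf h = q + 1 → ¬ Module.End.HasEigenvalue (V.ρ h) 1) ∧
      ¬ V.IsUnisingular := by
  obtain ⟨k, hk⟩ := hq
  have : Fact (Nat.Prime 2) := ⟨Nat.prime_two⟩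
  have : CharP F 2 := charP_of_card_eq_prime_pow (hF.trans hk)
  have heven : Even (Fintype.card F) := by
    rw [hF, hk]
    refine Even.pow_of_ne_zero even_two ?_
    rintro rfl
    omega
  subst hF
  have key : ∀ h : PSL2 F, orderOf h = Fintype.card F + 1 →
      ¬ Module.End.HasEigenvalue (V.ρ h) 1 :=
    fun h hh => PSL2.not_hasEigenvalue_one_of_orderOf heven h4 V hdeg hh
  obtain ⟨h, hh⟩ := SpecialLinearGroup.exists_orderOf_eq_card_add_one heven
  exact ⟨key, fun hV => key h hh (hV h)⟩
end

section
/- Let q be a prime power with q ≡ 1 (mod 4). Then every irreducible complex character of PSL_2(q) of degree (q+1)/2 is unisingular. -/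
open Module FDRep Matrix CategoryTheory

namespace Representation

section Irreducible

variable {k G W : Type*} [Field k] [Group G] [AddCommGroup W] [Module k W]
  {ρ : Representation k G W}

theorem IsIrreducible.eq_bot_or_eq_top_of_forall_mem [ρ.IsIrreducible] (p : Submodule k W)
    (hp : ∀ g, ∀ x ∈ p, ρ g x ∈ p) : p = ⊥ ∨ p = ⊤ :=
  (eq_bot_or_eq_top (⟨p, hp⟩ : Subrepresentation ρ)).imp
    (congrArg Subrepresentation.toSubmodule) (congrArg Subrepresentation.toSubmodule)

/-- An endomorphism commuting with an irreducible representation and having a nontrivial kernel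
is zero. -/
theorem IsIrreducible.eq_zero_of_apply_eq_zero [ρ.IsIrreducible] {f : W →ₗ[k] W}
    (hf : ∀ g, Commute f (ρ g)) {v : W} (hv : v ≠ 0) (hfv : f v = 0) : f = 0 := by
  refine LinearMap.ker_eq_top.mp ((eq_bot_or_eq_top_of_forall_mem (ρ := ρ) (LinearMap.ker f)
    fun g x hx ↦ ?_).resolve_left fun h ↦ hv ?_)
  · have := LinearMap.congr_fun (hf g).eq x
    simp_all
  · exact (Submodule.eq_bot_iff _).mp h v hfv

theorem IsIrreducible.finrank_eq_one_of_fixed [ρ.IsIrreducible] {v : W} (hv : v ≠ 0)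
    (h : ∀ g, ρ g v = v) : finrank k W = 1 := by
  have := (eq_bot_or_eq_top_of_forall_mem (ρ := ρ) (k ∙ v) fun g x hx ↦ by
    obtain ⟨c, rfl⟩ := Submodule.mem_span_singleton.mp hx
    simpa [h] using hx).resolve_left (by simpa using hv)
  refine (finrank_eq_one_iff_of_nonzero v hv).mpr this

theorem IsIrreducible.comp_of_surjective {H : Type*} [Group H] [hρ : ρ.IsIrreducible]
    {f : H →* G} (hf : Function.Surjective f) :
    IsIrreducible (ρ.comp f : Representation k H W) := by
  have := hρ.toNontrivial
  refine { exists_pair_ne := ?_, eq_bot_or_eq_top := fun p ↦ ?_ }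
  · obtain ⟨p, p', h⟩ := exists_pair_ne (Subrepresentation ρ)
    refine ⟨⟨p.1, fun g ↦ p.2 (f g)⟩, ⟨p'.1, fun g ↦ p'.2 (f g)⟩, fun e ↦
      h (Subrepresentation.toSubmodule_injective ?_)⟩
    simpa using e
  · have := eq_bot_or_eq_top_of_forall_mem (ρ := ρ) p.toSubmodule fun g x hx ↦ by
      obtain ⟨g, rfl⟩ := hf g
      exact p.2 g hx
    exact this.imp (fun h ↦ Subrepresentation.toSubmodule_injective h)
      (fun h ↦ Subrepresentation.toSubmodule_injective h)

end Irreducible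

end Representation

open Representation in
theorem FDRep.isIrreducible_of_simple {k : Type} [Field k] {G : Type} [Group G] (V : FDRep k G)
    [Simple V] : Representation.IsIrreducible V.ρ := by
  have key : ∀ p : Subrepresentation V.ρ, p.toSubmodule = ⊥ ∨ p.toSubmodule = ⊤ := by
    intro p
    let i : FDRep.of p.toRepresentation ⟶ V :=
      ⟨InducedCategory.homMk (ModuleCat.ofHom p.toSubmodule.subtype), fun g ↦ by
        ext x
        rfl⟩
    have hi : Function.Injective i.hom := Subtype.val_injective
    have : Mono i := ConcreteCategory.mono_of_injective i hi
    by_cases h0 : i = 0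
    · left
      refine (Submodule.eq_bot_iff _).mpr fun x hx ↦ ?_
      have : i.hom ⟨x, hx⟩ = 0 := by rw [h0]; rfl
      exact this
    · right
      have := isIso_of_mono_of_nonzero h0
      have hs : Function.Surjective i.hom :=
        (FDRep.isoToLinearEquiv (asIso i)).surjective
      exact Submodule.eq_top_iff'.mpr fun x ↦ by
        obtain ⟨y, hy⟩ := hs x
        rw [← hy]
        exact y.2
  refine { exists_pair_ne := ⟨⊥, ⊤, fun h ↦ ?_⟩, eq_bot_or_eq_top := fun p ↦ ?_ }
  · refine id_nonzero V ?_
    ext x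
    have : x ∈ (⊥ : Subrepresentation V.ρ).toSubmodule := by rw [h]; trivial
    exact this
  · exact (key p).imp (fun h ↦ Subrepresentation.toSubmodule_injective h)
      (fun h ↦ Subrepresentation.toSubmodule_injective h)

namespace SL2

open scoped MatrixGroups

section Matrices

variable {F : Type*} [Field F]

/-- The upper unipotent matrix with off-diagonal entry `x`. -/
def unip (x : F) : SL(2, F) := ⟨!![1, x; 0, 1], by simp⟩

/-- The diagonal matrix with entries `t` and `t⁻¹`. -/
def torus (t : Fˣ) : SL(2, F) := ⟨!![(t : F), 0; 0, (t⁻¹ : Fˣ)], by simp⟩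

/-- The Weyl element. -/
def weyl : SL(2, F) := ⟨!![0, -1; 1, 0], by simp⟩

@[ext]
theorem ext_entries {g h : SL(2, F)} (h00 : g 0 0 = h 0 0) (h01 : g 0 1 = h 0 1)
    (h10 : g 1 0 = h 1 0) (h11 : g 1 1 = h 1 1) : g = h := by
  ext i j
  fin_cases i <;> fin_cases j <;> assumption

@[simp] theorem unip_00 (x : F) : unip x 0 0 = 1 := rfl
@[simp] theorem unip_01 (x : F) : unip x 0 1 = x := rfl
@[simp] theorem unip_10 (x : F) : unip x 1 0 = 0 := rfl
@[simp] theorem unip_11 (x : F) : unip x 1 1 = 1 := rfl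
@[simp] theorem torus_00 (t : Fˣ) : torus t 0 0 = t := rfl
@[simp] theorem torus_01 (t : Fˣ) : torus t 0 1 = 0 := rfl
@[simp] theorem torus_10 (t : Fˣ) : torus t 1 0 = 0 := rfl
@[simp] theorem torus_11 (t : Fˣ) : torus t 1 1 = (t : F)⁻¹ := by simp [torus]
@[simp] theorem weyl_00 : (weyl : SL(2, F)) 0 0 = 0 := rfl
@[simp] theorem weyl_01 : (weyl : SL(2, F)) 0 1 = -1 := rfl
@[simp] theorem weyl_10 : (weyl : SL(2, F)) 1 0 = 1 := rfl
@[simp] theorem weyl_11 : (weyl : SL(2, F)) 1 1 = 0 := rfl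

theorem mul_entry (g h : SL(2, F)) (i j : Fin 2) :
    (g * h) i j = g i 0 * h 0 j + g i 1 * h 1 j := by
  change ((g : Matrix (Fin 2) (Fin 2) F) * (h : Matrix (Fin 2) (Fin 2) F)) i j = _
  rw [Matrix.mul_apply, Fin.sum_univ_two]

theorem det_eq (g : SL(2, F)) : g 0 0 * g 1 1 - g 0 1 * g 1 0 = 1 := by
  rw [← Matrix.det_fin_two]
  exact g.2

@[simp] theorem inv_00 (g : SL(2, F)) : g⁻¹ 0 0 = g 1 1 := by simp [Matrix.adjugate_fin_two]
@[simp] theorem inv_01 (g : SL(2, F)) : g⁻¹ 0 1 = -g 0 1 := by simp [Matrix.adjugate_fin_two]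
@[simp] theorem inv_10 (g : SL(2, F)) : g⁻¹ 1 0 = -g 1 0 := by simp [Matrix.adjugate_fin_two]
@[simp] theorem inv_11 (g : SL(2, F)) : g⁻¹ 1 1 = g 0 0 := by simp [Matrix.adjugate_fin_two]

theorem unip_add (x y : F) : unip (x + y) = unip x * unip y := by
  ext <;> simp [mul_entry, add_comm]

@[simp] theorem unip_zero : unip (0 : F) = 1 := by
  ext <;> simp

theorem torus_mul (s t : Fˣ) : torus (s * t) = torus s * torus t := by
  ext <;> simp [mul_entry, mul_comm]

theorem torus_mul_unip (t : Fˣ) (x : F) :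
    torus t * unip x = unip ((t : F) ^ 2 * x) * torus t := by
  ext <;> simp [mul_entry]
  field_simp

/-- The Bruhat decomposition of the big cell. -/
theorem eq_unip_mul_torus_mul_weyl_mul_unip (g : SL(2, F)) (c : Fˣ) (hc : g 1 0 = c) :
    g = unip (g 0 0 / c) * torus c⁻¹ * weyl * unip (g 1 1 / c) := by
  have := det_eq g
  rw [hc] at this
  have hc0 := c.ne_zero
  ext <;> simp [mul_entry, hc] <;> field_simp
  linear_combination -this

theorem eq_torus_mul_unip (g : SL(2, F)) (hc : g 1 0 = 0) :
    ∃ (t : Fˣ) (x : F), g = torus t * unip x := by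
  have := det_eq g
  simp only [hc, mul_zero, sub_zero] at this
  have h0 : g 0 0 ≠ 0 := left_ne_zero_of_mul_eq_one this
  refine ⟨Units.mk0 _ h0, g 0 1 / g 0 0, ?_⟩
  ext <;> simp [mul_entry, hc] <;> field_simp
  linear_combination this

/-- An upper triangular element with distinct eigenvalues is conjugate to a diagonal one. -/
theorem torus_mul_unip_conj (t : Fˣ) (x : F) (ht : (t : F) ^ 2 ≠ 1) :
    ∃ y : F, torus t * unip x = unip y * torus t * (unip y)⁻¹ := by
  have h : (1 : F) - t ^ 2 ≠ 0 := sub_ne_zero.mpr ht.symm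
  have h0 := t.ne_zero
  refine ⟨t ^ 2 * x / (1 - t ^ 2), ?_⟩
  ext <;> simp [mul_entry]
  field_simp
  ring

/-- An element of `SL₂` is anisotropic if it has no eigenvalue in the base field. -/
def IsAnisotropic (g : SL(2, F)) : Prop :=
  ∀ r : F, (g 0 0 - r) * (g 1 1 - r) - g 0 1 * g 1 0 ≠ 0

theorem IsAnisotropic.ne_zero {g : SL(2, F)} (hg : IsAnisotropic g) : g 1 0 ≠ 0 :=
  fun h ↦ hg (g 0 0) (by simp [h])

theorem isAnisotropic_iff_trace {g : SL(2, F)} :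
    IsAnisotropic g ↔ ∀ r : F, r ^ 2 - (g 0 0 + g 1 1) * r + 1 ≠ 0 := by
  have := det_eq g
  refine forall_congr' fun r ↦ not_congr ?_
  constructor <;> intro h
  · linear_combination h - this
  · linear_combination h + this

theorem exists_conj_upper_of_not_isAnisotropic {g : SL(2, F)} (hg : ¬ IsAnisotropic g) :
    ∃ p h : SL(2, F), h 1 0 = 0 ∧ g = p * h * p⁻¹ := by
  by_cases hc : g 1 0 = 0
  · exact ⟨1, g, hc, by simp⟩
  simp only [IsAnisotropic, not_forall, not_not] at hg
  obtain ⟨r, hr⟩ := hg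
  let p : SL(2, F) := ⟨!![r - g 1 1, -(g 1 0)⁻¹; g 1 0, 0], by simp [hc]⟩
  have h00 : p 0 0 = r - g 1 1 := rfl
  have h01 : p 0 1 = -(g 1 0)⁻¹ := rfl
  have h10 : p 1 0 = g 1 0 := rfl
  have h11 : p 1 1 = 0 := rfl
  refine ⟨p, p⁻¹ * g * p, ?_, by group⟩
  simp only [mul_entry, inv_10, inv_11, h00, h10]
  linear_combination g 1 0 * hr

/-- The powers of `g` lie in the linear span of `1` and `g`. -/
theorem exists_pow_eq (g : SL(2, F)) (k : ℕ) : ∃ α β : F,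
    (g ^ k) 0 0 = α * g 0 0 + β ∧ (g ^ k) 0 1 = α * g 0 1 ∧
    (g ^ k) 1 0 = α * g 1 0 ∧ (g ^ k) 1 1 = α * g 1 1 + β := by
  induction k with
  | zero => exact ⟨0, 1, by simp⟩
  | succ k ih =>
    obtain ⟨α, β, h00, h01, h10, h11⟩ := ih
    have := det_eq g
    refine ⟨α * (g 0 0 + g 1 1) + β, -α, ?_⟩
    simp only [pow_succ, mul_entry, h00, h01, h10, h11]
    refine ⟨?_, by ring, by ring, ?_⟩ <;> linear_combination -α * this

theorem IsAnisotropic.pow {g : SL(2, F)} (hg : IsAnisotropic g) (k : ℕ) :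
    g ^ k = 1 ∨ g ^ k = -1 ∨ IsAnisotropic (g ^ k) := by
  obtain ⟨α, β, h00, h01, h10, h11⟩ := exists_pow_eq g k
  have hd := det_eq (g ^ k)
  by_cases hα : α = 0
  · simp only [hα, zero_mul, zero_add] at h00 h01 h10 h11
    have : (β - 1) * (β + 1) = 0 := by
      rw [h00, h01, h10, h11] at hd
      linear_combination hd
    rcases mul_eq_zero.mp this with h | h
    · left
      rw [sub_eq_zero] at h
      subst h
      ext <;> simp [*]
    · right; left
      rw [← eq_neg_iff_add_eq_zero] at h
      subst h
      ext <;> simp [*]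
  · right; right
    intro r hr
    refine hg ((r - β) / α) ?_
    rw [h00, h01, h10, h11] at hr
    field_simp
    linear_combination hr

theorem IsAnisotropic.exists_conj_companion [Finite F] {g : SL(2, F)} (hg : IsAnisotropic g)
    (h2 : (2 : F) ≠ 0) :
    ∃ p h : SL(2, F), g = p * h * p⁻¹ ∧ h 0 0 = 0 ∧ h 0 1 = -1 ∧ h 1 0 = 1 ∧
      h 1 1 = g 0 0 + g 1 1 := by
  have hc := hg.ne_zero
  have hd := det_eq g
  obtain ⟨x, y, hxy⟩ : ∃ x y : F,
      g 1 0 * x ^ 2 + (g 1 1 - g 0 0) * x * y - g 0 1 * y ^ 2 = 1 := by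
    have hD : (g 1 1 - g 0 0) ^ 2 + 4 * g 0 1 * g 1 0 ≠ 0 := fun h ↦
      hg ((g 0 0 + g 1 1) / 2) (by field_simp; linear_combination -h)
    have h4 : (4 : F) ≠ 0 := by
      rw [show (4 : F) = 2 * 2 by norm_num]
      exact mul_ne_zero h2 h2
    cases nonempty_fintype F
    have hodd := FiniteField.odd_card_of_char_ne_two
      fun h : ringChar F = 2 ↦ h2 (by exact_mod_cast (ringChar.spec F 2).mpr h.dvd)
    obtain ⟨u, v, huv⟩ := FiniteField.exists_root_sum_quadratic
      (f := Polynomial.C (g 1 0) * Polynomial.X ^ 2)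
      (g := Polynomial.C (-((g 1 1 - g 0 0) ^ 2 + 4 * g 0 1 * g 1 0) / (4 * g 1 0)) *
        Polynomial.X ^ 2 + Polynomial.C 0 * Polynomial.X + Polynomial.C (-1))
      (Polynomial.degree_C_mul_X_pow 2 hc)
      (Polynomial.degree_quadratic (div_ne_zero (neg_ne_zero.mpr hD) (mul_ne_zero h4 hc))) hodd
    refine ⟨u - (g 1 1 - g 0 0) * v / (2 * g 1 0), v, ?_⟩
    simp only [Polynomial.eval_add, Polynomial.eval_mul, Polynomial.eval_C, Polynomial.eval_pow,
      Polynomial.eval_X] at huv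
    field_simp at huv ⊢
    linear_combination huv
  let p : SL(2, F) := ⟨!![x, g 0 0 * x + g 0 1 * y; y, g 1 0 * x + g 1 1 * y], by
    rw [Matrix.det_fin_two_of]
    linear_combination hxy⟩
  have h00 : p 0 0 = x := rfl
  have h01 : p 0 1 = g 0 0 * x + g 0 1 * y := rfl
  have h10 : p 1 0 = y := rfl
  have h11 : p 1 1 = g 1 0 * x + g 1 1 * y := rfl
  refine ⟨p, p⁻¹ * g * p, by group, ?_, ?_, ?_, ?_⟩ <;>
    simp only [mul_entry, inv_00, inv_01, inv_10, inv_11, h00, h01, h10, h11]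
  · ring
  · linear_combination (-(g 0 0 * g 1 1 - g 0 1 * g 1 0)) * hxy - hd
  · linear_combination hxy
  · linear_combination (g 0 0 + g 1 1) * hxy

/-- Anisotropic elements with the same trace are conjugate in `SL₂` over a finite field. -/
theorem IsAnisotropic.isConj [Finite F] {g h : SL(2, F)} (hg : IsAnisotropic g)
    (h2 : (2 : F) ≠ 0) (ht : h 0 0 + h 1 1 = g 0 0 + g 1 1) : IsConj g h := by
  have hh : IsAnisotropic h := by
    rw [isAnisotropic_iff_trace] at hg ⊢
    rwa [ht]
  obtain ⟨p, k, rfl, hk⟩ := hg.exists_conj_companion h2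
  obtain ⟨p', k', rfl, hk'⟩ := hh.exists_conj_companion h2
  rw [ht] at hk'
  obtain rfl : k = k' := by
    ext
    · rw [hk.1, hk'.1]
    · rw [hk.2.1, hk'.2.1]
    · rw [hk.2.2.1, hk'.2.2.1]
    · rw [hk.2.2.2, hk'.2.2.2]
  exact (isConj_iff.mpr ⟨p, rfl⟩).symm.trans (isConj_iff.mpr ⟨p', rfl⟩)

/-- Conjugation of `SL₂` by a diagonal matrix of determinant `s` in `GL₂`. -/
def diagConj (s : Fˣ) (g : SL(2, F)) : SL(2, F) :=
  ⟨!![g 0 0, g 0 1 * (s : F)⁻¹; s * g 1 0, g 1 1], by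
    rw [Matrix.det_fin_two_of]
    have := det_eq g
    field_simp
    linear_combination this⟩

theorem diagConj_inv_diagConj (s : Fˣ) (g : SL(2, F)) : diagConj s⁻¹ (diagConj s g) = g := by
  ext <;> simp [diagConj]

end Matrices

section WeightSpaces

variable {F : Type*} [Field F] {W : Type*} [AddCommGroup W] [Module ℂ W]
  {ρ : Representation ℂ SL(2, F) W}

theorem rho_mul_apply (g h : SL(2, F)) (w : W) : ρ (g * h) w = ρ g (ρ h w) := by
  rw [map_mul, Module.End.mul_apply]

variable [Fintype F] (ρ)

/-- The projection onto the subspace on which the unipotent subgroup acts through `χ`. -/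
noncomputable def weightProj (χ : AddChar F ℂ) : Module.End ℂ W :=
  (Fintype.card F : ℂ)⁻¹ • ∑ x : F, χ (-x) • ρ (unip x)

variable {ρ} {χ : AddChar F ℂ}

theorem weightProj_apply (w : W) :
    weightProj ρ χ w = (Fintype.card F : ℂ)⁻¹ • ∑ x : F, χ (-x) • ρ (unip x) w := by
  simp [weightProj]

theorem unip_weightProj (y : F) (w : W) :
    ρ (unip y) (weightProj ρ χ w) = χ y • weightProj ρ χ w := by
  rw [weightProj_apply, map_smul, smul_comm (χ y), map_sum,
    Finset.smul_sum (r := χ y)]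
  refine congrArg _ (Fintype.sum_equiv (Equiv.addLeft y) _ _ fun x ↦ ?_)
  rw [map_smul, ← rho_mul_apply, ← unip_add, smul_smul, ← AddChar.map_add_eq_mul]
  simp

theorem weightProj_unip (y : F) (w : W) :
    weightProj ρ χ (ρ (unip y) w) = χ y • weightProj ρ χ w := by
  rw [← unip_weightProj, weightProj_apply, weightProj_apply, map_smul, map_sum]
  congr 1
  refine Finset.sum_congr rfl fun x _ ↦ ?_
  rw [map_smul, ← rho_mul_apply, ← rho_mul_apply, ← unip_add, ← unip_add, add_comm]

theorem weightProj_of_forall {w : W} (h : ∀ x, ρ (unip x) w = χ x • w) :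
    weightProj ρ χ w = w := by
  simp [weightProj_apply, h, smul_smul, ← AddChar.map_add_eq_mul, ← Nat.cast_smul_eq_nsmul ℂ]

theorem isIdempotentElem_weightProj : IsIdempotentElem (weightProj ρ χ) := by
  refine LinearMap.ext fun w ↦ ?_
  exact weightProj_of_forall fun x ↦ unip_weightProj x w

theorem weightProj_eq_zero_of_forall {χ' : AddChar F ℂ} (hχ : χ' ≠ χ) {w : W}
    (h : ∀ x, ρ (unip x) w = χ' x • w) : weightProj ρ χ w = 0 := by
  have hne : χ' - χ ≠ 1 := fun h ↦ hχ (sub_eq_zero.mp h)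
  have := AddChar.sum_eq_zero_of_ne_one hne
  simp_rw [AddChar.sub_apply] at this
  simp only [weightProj_apply, h, smul_smul, ← Finset.sum_smul]
  rw [Finset.sum_congr rfl fun x _ ↦ mul_comm (χ (-x)) (χ' x), this, mul_zero, zero_smul]

theorem torus_weightProj (t : Fˣ) (w : W) :
    ρ (torus t) (weightProj ρ χ w) =
      weightProj ρ (χ.mulShift ((t : F)⁻¹ ^ 2)) (ρ (torus t) w) := by
  have h0 := t.ne_zero
  simp only [weightProj_apply, map_smul, map_sum]
  congr 1
  refine Fintype.sum_equiv (Equiv.mulLeft₀ ((t : F) ^ 2) (pow_ne_zero 2 h0)) _ _ fun x ↦ ?_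
  rw [← rho_mul_apply, torus_mul_unip, rho_mul_apply, AddChar.mulShift_apply]
  congr 2
  simp only [Equiv.mulLeft₀_apply]
  field_simp

theorem sum_weightProj {ψ : AddChar F ℂ} (hψ : ψ.IsPrimitive) :
    ∑ a : F, weightProj ρ (ψ.mulShift a) = 1 := by
  classical
  have hcard : (Fintype.card F : ℂ) ≠ 0 := Nat.cast_ne_zero.mpr Fintype.card_ne_zero
  simp only [weightProj, AddChar.mulShift_apply, ← Finset.smul_sum]
  rw [Finset.sum_comm]
  simp only [← Finset.sum_smul, AddChar.sum_mulShift _ hψ, neg_eq_zero]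
  simp [hcard]

variable [FiniteDimensional ℂ W]

theorem trace_weightProj :
    LinearMap.trace ℂ W (weightProj ρ χ) = finrank ℂ (LinearMap.range (weightProj ρ χ)) :=
  (LinearMap.IsIdempotentElem.isProj_range _ isIdempotentElem_weightProj).trace

theorem finrank_weight_mulShift_sq (χ : AddChar F ℂ) (t : Fˣ) :
    finrank ℂ (LinearMap.range (weightProj ρ (χ.mulShift ((t : F) ^ 2)))) =
      finrank ℂ (LinearMap.range (weightProj ρ χ)) := by
  have h : weightProj ρ (χ.mulShift ((t : F) ^ 2)) * ρ (torus t⁻¹) =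
      ρ (torus t⁻¹) * weightProj ρ χ := by
    refine LinearMap.ext fun w ↦ ?_
    simp [Module.End.mul_apply, torus_weightProj (χ := χ)]
  have h1 : ρ (torus t⁻¹) * ρ (torus t⁻¹)⁻¹ = 1 := by rw [← map_mul, mul_inv_cancel, map_one]
  have h2 : ρ (torus t⁻¹)⁻¹ * ρ (torus t⁻¹) = 1 := by rw [← map_mul, inv_mul_cancel, map_one]
  have := congrArg (fun f : Module.End ℂ W ↦ LinearMap.trace ℂ W (f * ρ (torus t⁻¹)⁻¹)) h
  simp only [mul_assoc, h1, mul_one] at this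
  rw [LinearMap.trace_mul_comm, mul_assoc, h2, mul_one, trace_weightProj, trace_weightProj] at this
  exact_mod_cast this

end WeightSpaces

/-- The sum of a function on a finite field which is invariant under nonzero squares. -/
theorem exists_two_mul_sum_eq {F : Type*} [Field F] [Fintype F] (h2 : (2 : F) ≠ 0) (R : F → ℕ)
    (hR : ∀ (a : F) (t : Fˣ), R (a * (t : F) ^ 2) = R a) :
    ∃ ε : F, ε ≠ 0 ∧ (∀ a, a ≠ 0 → R a = R 1 ∨ R a = R ε) ∧
      2 * ∑ a, R a = 2 * R 0 + (Fintype.card F - 1) * (R 1 + R ε) := by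
  classical
  have hF : ringChar F ≠ 2 :=
    fun h : ringChar F = 2 ↦ h2 (by exact_mod_cast (ringChar.spec F 2).mpr h.dvd)
  obtain ⟨ε, hε⟩ := quadraticChar_exists_neg_one hF
  have hε0 : ε ≠ 0 := by
    rintro rfl
    simp at hε
  have hsq : ∀ a, a ≠ 0 → IsSquare a → R a = R 1 := by
    rintro _ ha ⟨t, rfl⟩
    simpa [pow_two] using hR 1 (Units.mk0 t (left_ne_zero_of_mul ha))
  have hnsq : ∀ a, a ≠ 0 → ¬ IsSquare a → R a = R ε := by
    intro a ha hsa
    have h1 := quadraticChar_neg_one_iff_not_isSquare.mpr hsa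
    obtain ⟨t, ht⟩ : IsSquare (a * ε⁻¹) := by
      refine (quadraticChar_one_iff_isSquare (mul_ne_zero ha (inv_ne_zero hε0))).mp ?_
      have hi : quadraticChar F ε * quadraticChar F ε⁻¹ = 1 := by
        rw [← map_mul, mul_inv_cancel₀ hε0, map_one]
      rw [map_mul, h1]
      rw [hε] at hi
      exact hi
    have h0 : t ≠ 0 := by
      rintro rfl
      simp_all
    have : a = ε * t ^ 2 := by
      field_simp at ht
      linear_combination ht
    simpa [this] using hR ε (Units.mk0 t h0)
  refine ⟨ε, hε0, fun a ha ↦ ?_, ?_⟩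
  · by_cases h : IsSquare a
    · exact .inl (hsq a ha h)
    · exact .inr (hnsq a ha h)
  · have key : ∀ a, 2 * (R a : ℤ) = (R 1 + R ε) + quadraticChar F a * (R 1 - R ε) +
        if a = 0 then 2 * (R 0 : ℤ) - (R 1 + R ε) else 0 := by
      intro a
      by_cases ha : a = 0
      · simp [ha]
      by_cases h : IsSquare a
      · rw [hsq a ha h, (quadraticChar_one_iff_isSquare ha).mpr h, if_neg ha]
        ring
      · rw [hnsq a ha h, quadraticChar_neg_one_iff_not_isSquare.mpr h, if_neg ha]
        ring
    zify [Fintype.card_pos (α := F)]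
    rw [Finset.mul_sum, Finset.sum_congr rfl fun a _ ↦ key a]
    simp only [Finset.sum_add_distrib, ← Finset.sum_mul, quadraticChar_sum_zero hF]
    simp
    ring

section Irreducible

variable {F : Type*} [Field F] {W : Type*} [AddCommGroup W] [Module ℂ W]
  {ρ : Representation ℂ SL(2, F) W}

theorem rho_eq_one_of_unip (h : ∀ x, ρ (unip x) = 1) (g : SL(2, F)) : ρ g = 1 := by
  change g ∈ MonoidHom.ker ρ
  have hu : ∀ x, unip x ∈ MonoidHom.ker ρ := h
  have hl : ∀ x, weyl * unip x * weyl⁻¹ ∈ MonoidHom.ker ρ := fun x ↦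
    (MonoidHom.normal_ker ρ).conj_mem _ (hu x) _
  have htw : ∀ t : Fˣ, torus t * weyl ∈ MonoidHom.ker ρ := fun t ↦ by
    have : torus t * weyl =
        unip (-(t : F)) * (weyl * unip (-(t : F)⁻¹) * weyl⁻¹) * unip (-(t : F)) := by
      ext <;> simp [mul_entry]
    rw [this]
    exact mul_mem (mul_mem (hu _) (hl _)) (hu _)
  have hw : weyl ∈ MonoidHom.ker ρ := by
    have h1 : torus (1 : Fˣ) = 1 := by ext <;> simp
    simpa [h1] using htw 1
  have ht : ∀ t : Fˣ, torus t ∈ MonoidHom.ker ρ := fun t ↦ by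
    simpa using mul_mem (htw t) (inv_mem hw)
  by_cases hc : g 1 0 = 0
  · obtain ⟨t, x, rfl⟩ := eq_torus_mul_unip g hc
    exact mul_mem (ht t) (hu x)
  · rw [eq_unip_mul_torus_mul_weyl_mul_unip g (Units.mk0 _ hc) rfl]
    exact mul_mem (mul_mem (mul_mem (hu _) (ht _)) hw) (hu _)

theorem rho_torus_eq_one (hneg : ρ (-1) = 1) {t : Fˣ} (ht : t ^ 2 = 1) : ρ (torus t) = 1 := by
  have h : ((t : F) - 1) * (t + 1) = 0 := by
    have := congrArg Units.val ht
    push_cast at this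
    linear_combination this
  rcases mul_eq_zero.mp h with h | h
  · rw [← map_one ρ]
    congr 1
    ext <;> simp [sub_eq_zero.mp h]
  · rw [← hneg]
    congr 1
    ext <;> simp [eq_neg_of_add_eq_zero_left h]

variable [Fintype F]

/-- The action of the big cell on a vector fixed by the unipotent subgroup. -/
theorem weightProj_one_apply_of_bigCell {v : W} (hv : ∀ x, ρ (unip x) v = v) (g : SL(2, F))
    (c : Fˣ) (hc : g 1 0 = c) :
    weightProj ρ 1 (ρ g v) = ρ (torus c⁻¹) (weightProj ρ 1 (ρ weyl v)) := by
  rw [eq_unip_mul_torus_mul_weyl_mul_unip g c hc]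
  simp only [rho_mul_apply, hv, weightProj_unip, torus_weightProj, AddChar.one_apply, one_smul]
  rfl

theorem trace_eq_zero_of_isAnisotropic [ρ.IsIrreducible] (h2 : (2 : F) ≠ 0) {v : W} (hv : v ≠ 0)
    (hu : ∀ x, ρ (unip x) v = v) {s : Fˣ} {z : ℂ} (hz : z ≠ 1) (hs : ρ (torus s) v = z • v)
    (hone : ∀ w, ∃ c : ℂ, weightProj ρ 1 w = c • v) {h : SL(2, F)} (hh : IsAnisotropic h) :
    LinearMap.trace ℂ W (ρ h) = 0 := by
  classical
  cases nonempty_fintype SL(2, F)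
  let K : Finset SL(2, F) := {g | g 0 0 + g 1 1 = h 0 0 + h 1 1}
  have hK : ∀ g, g ∈ K ↔ g 0 0 + g 1 1 = h 0 0 + h 1 1 := by simp [K]
  have haniso : ∀ g ∈ K, g 1 0 ≠ 0 := fun g hg ↦ by
    refine IsAnisotropic.ne_zero (isAnisotropic_iff_trace.mpr ?_)
    rw [(hK g).mp hg]
    exact isAnisotropic_iff_trace.mp hh
  have hconj : ∀ p g, p * g * p⁻¹ ∈ K ↔ g ∈ K := by
    intro p g
    have := det_eq p
    rw [hK, hK]
    simp only [mul_entry, inv_00, inv_01, inv_10, inv_11]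
    constructor <;> intro h
    · linear_combination h - (g 0 0 + g 1 1) * this
    · linear_combination h + (g 0 0 + g 1 1) * this
  set Z : Module.End ℂ W := ∑ g ∈ K, ρ g
  have hZ : ∀ p, Commute Z (ρ p) := by
    intro p
    change (∑ g ∈ K, ρ g) * ρ p = ρ p * ∑ g ∈ K, ρ g
    rw [Finset.sum_mul, Finset.mul_sum]
    symm
    refine Finset.sum_equiv (MulAut.conj p).toEquiv (fun g ↦ ?_) fun g _ ↦ ?_
    · simpa using (hconj p g).symm
    · simp [← map_mul]
  have hdiag : ∀ g ∈ K, weightProj ρ 1 (ρ (diagConj s⁻¹ g) v) = z • weightProj ρ 1 (ρ g v) := by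
    intro g hg
    obtain ⟨κ, hκ⟩ := hone (ρ weyl v)
    rw [weightProj_one_apply_of_bigCell hu g (Units.mk0 _ (haniso g hg)) rfl,
      weightProj_one_apply_of_bigCell hu (diagConj s⁻¹ g) (s⁻¹ * Units.mk0 _ (haniso g hg)) rfl,
      hκ, mul_inv, inv_inv, mul_comm s, torus_mul, rho_mul_apply]
    simp only [map_smul, hs]
    rw [smul_comm]
  have hZv : Z v = 0 := by
    have h1 : weightProj ρ 1 (Z v) = Z v := weightProj_of_forall fun x ↦ by
      have := LinearMap.congr_fun (hZ (unip x)).eq v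
      simp only [Module.End.mul_apply, hu] at this
      simpa using this.symm
    have h3 : ∑ g ∈ K, weightProj ρ 1 (ρ g v) = z • ∑ g ∈ K, weightProj ρ 1 (ρ g v) := by
      rw [Finset.smul_sum, ← Finset.sum_congr rfl hdiag]
      refine Finset.sum_nbij' (diagConj s) (diagConj s⁻¹) (fun g hg ↦ ?_) (fun g hg ↦ ?_)
        (fun g _ ↦ diagConj_inv_diagConj s g)
        (fun g _ ↦ by simpa using diagConj_inv_diagConj s⁻¹ g)
        (fun g _ ↦ by rw [diagConj_inv_diagConj])
      · exact (hK _).mpr ((hK g).mp hg)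
      · exact (hK _).mpr ((hK g).mp hg)
    have h4 : (1 - z) • Z v = 0 := by
      rw [← h1, sub_smul, one_smul, sub_eq_zero]
      simpa [Z] using h3
    exact (smul_eq_zero.mp h4).resolve_left (sub_ne_zero.mpr hz.symm)
  have hZ0 := Representation.IsIrreducible.eq_zero_of_apply_eq_zero (ρ := ρ) hZ hv hZv
  have htr : ∀ g ∈ K, LinearMap.trace ℂ W (ρ g) = LinearMap.trace ℂ W (ρ h) := by
    intro g hg
    obtain ⟨p, rfl⟩ := isConj_iff.mp (hh.isConj h2 ((hK g).mp hg))
    rw [map_mul, LinearMap.trace_mul_comm, ← map_mul, ← mul_assoc, inv_mul_cancel, one_mul]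
  have h5 : ∑ g ∈ K, LinearMap.trace ℂ W (ρ g) = 0 := by
    rw [← map_sum, show ∑ g ∈ K, ρ g = 0 from hZ0, map_zero]
  rw [Finset.sum_congr rfl htr, Finset.sum_const, ← Nat.cast_smul_eq_nsmul ℂ, smul_eq_mul] at h5
  refine (mul_eq_zero.mp h5).resolve_left (Nat.cast_ne_zero.mpr ?_)
  exact Finset.card_ne_zero_of_mem ((hK h).mpr rfl)

theorem exists_fixed_torus (hneg : ρ (-1) = 1) {ψ : AddChar F ℂ} (hψ : ψ.IsPrimitive) {a : F}
    (ha : a ≠ 0) (hproj : weightProj ρ (ψ.mulShift a) ≠ 0) :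
    ∃ w, w ≠ 0 ∧ ∀ t, ρ (torus t) w = w := by
  classical
  set χ := ψ.mulShift a with hχ
  obtain ⟨w, hw⟩ : ∃ w, weightProj ρ χ w ≠ 0 := by
    by_contra! h
    exact hproj (LinearMap.ext h)
  set w₀ := weightProj ρ χ w
  have hproj₀ : ∀ s : Fˣ, weightProj ρ χ (ρ (torus s) w₀) =
      ((if s ^ 2 = 1 then 1 else 0 : ℕ) : ℂ) • w₀ := by
    intro s
    split_ifs with hs
    · rw [rho_torus_eq_one hneg hs, Nat.cast_one, one_smul, Module.End.one_apply]
      exact LinearMap.congr_fun isIdempotentElem_weightProj.eq w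
    · rw [Nat.cast_zero, zero_smul]
      refine weightProj_eq_zero_of_forall (χ' := χ.mulShift ((s : F)⁻¹ ^ 2)) (fun h ↦ hs ?_)
        fun x ↦ ?_
      · rw [hχ, AddChar.mulShift_mulShift] at h
        have := AddChar.to_mulShift_inj_of_isPrimitive hψ h
        have h1 : ((s : F)⁻¹) ^ 2 = 1 := mul_left_cancel₀ ha (by rw [this, mul_one])
        rw [inv_pow, inv_eq_one] at h1
        exact Units.ext (by simpa using h1)
      · rw [torus_weightProj, unip_weightProj]
  refine ⟨∑ s : Fˣ, ρ (torus s) w₀, fun h ↦ ?_, fun t ↦ ?_⟩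
  · have h1 := congrArg (weightProj ρ χ) h
    rw [map_sum, map_zero, Finset.sum_congr rfl fun s _ ↦ hproj₀ s, ← Finset.sum_smul,
      ← Nat.cast_sum] at h1
    have h2 := (smul_eq_zero.mp h1).resolve_right hw
    rw [Nat.cast_eq_zero, Finset.sum_eq_zero_iff] at h2
    simpa using h2 1 (Finset.mem_univ _)
  · rw [map_sum]
    refine Fintype.sum_equiv (Equiv.mulLeft t) _ _ fun s ↦ ?_
    rw [← rho_mul_apply, ← torus_mul, Equiv.coe_mulLeft]

variable [FiniteDimensional ℂ W]

theorem finrank_weightProj_of_finrank_eq [ρ.IsIrreducible] (h2 : (2 : F) ≠ 0)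
    (hcard : 3 < Fintype.card F) (hdim : 2 * finrank ℂ W = Fintype.card F + 1)
    {ψ : AddChar F ℂ} (hψ : ψ.IsPrimitive) :
    finrank ℂ (LinearMap.range (weightProj ρ 1)) = 1 ∧
      ∃ a, a ≠ 0 ∧ weightProj ρ (ψ.mulShift a) ≠ 0 := by
  set R : F → ℕ := fun a ↦ finrank ℂ (LinearMap.range (weightProj ρ (ψ.mulShift a)))
  have hsum : ∑ a, R a = finrank ℂ W := by
    have := congrArg (LinearMap.trace ℂ W) (sum_weightProj (ρ := ρ) hψ)
    rw [map_sum, LinearMap.trace_one] at this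
    simp only [trace_weightProj] at this
    exact_mod_cast this
  obtain ⟨ε, hε0, hε, hR⟩ := exists_two_mul_sum_eq h2 R fun a t ↦ by
    have := finrank_weight_mulShift_sq (ρ := ρ) (ψ.mulShift a) t
    rwa [AddChar.mulShift_mulShift] at this
  rw [hsum, hdim] at hR
  have hR0 : R 0 = finrank ℂ (LinearMap.range (weightProj ρ 1)) :=
    congrArg (fun χ ↦ finrank ℂ (LinearMap.range (weightProj ρ χ))) (AddChar.mulShift_zero ψ)
  have hzero : ∀ a, R a = 0 ↔ weightProj ρ (ψ.mulShift a) = 0 := fun a ↦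
    Submodule.finrank_eq_zero.trans LinearMap.range_eq_bot
  have hne : R 1 + R ε ≠ 0 := by
    intro h
    have hall : ∀ a, a ≠ 0 → weightProj ρ (ψ.mulShift a) = 0 := fun a ha ↦ (hzero a).mp (by
      have := hε a ha
      omega)
    have h1 : weightProj ρ 1 = 1 := by
      rw [← sum_weightProj (ρ := ρ) hψ, Fintype.sum_eq_single 0 hall, AddChar.mulShift_zero]
    have htriv := rho_eq_one_of_unip (ρ := ρ) fun x ↦ LinearMap.ext fun w ↦ by
      have := unip_weightProj (ρ := ρ) (χ := 1) x w
      simpa [h1] using this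
    have : Nontrivial W := Module.nontrivial_of_finrank_pos (R := ℂ) (by omega)
    obtain ⟨w, hw⟩ := exists_ne (0 : W)
    have := Representation.IsIrreducible.finrank_eq_one_of_fixed (ρ := ρ) hw
      fun g ↦ by rw [htriv g, Module.End.one_apply]
    omega
  have hle : R 1 + R ε ≤ 1 := by
    by_contra! h
    have := Nat.mul_le_mul_left (Fintype.card F - 1) (show 2 ≤ R 1 + R ε from h)
    omega
  obtain hone : R 1 + R ε = 1 := by omega
  rw [hone] at hR
  refine ⟨by omega, ?_⟩
  by_cases h1 : R 1 = 0
  · refine ⟨ε, hε0, fun h ↦ ?_⟩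
    have := (hzero ε).mpr h
    omega
  · refine ⟨1, one_ne_zero, fun h ↦ h1 ((hzero 1).mpr h)⟩

/-- If the Borel subgroup fixes a vector and there are no further vectors fixed by the unipotent
subgroup, then the representation has dimension at least `q - 1`. -/
theorem card_le_finrank_add_one [ρ.IsIrreducible] (hdim : finrank ℂ W ≠ 1) {v : W} (hv : v ≠ 0)
    (hu : ∀ x, ρ (unip x) v = v) (ht : ∀ t, ρ (torus t) v = v)
    (hone : ∀ w, ∃ c : ℂ, weightProj ρ 1 w = c • v) :
    Fintype.card F ≤ finrank ℂ W + 1 := by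
  classical
  obtain ⟨κ, hκ⟩ := hone (ρ weyl v)
  have hbig : ∀ g : SL(2, F), g 1 0 ≠ 0 → weightProj ρ 1 (ρ g v) = κ • v := fun g hg ↦ by
    rw [weightProj_one_apply_of_bigCell hu g (Units.mk0 _ hg) rfl, hκ, map_smul, ht]
  have hfix : weightProj ρ 1 v = v := weightProj_of_forall fun x ↦ by simp [hu]
  have hsmall : ∀ g : SL(2, F), g 1 0 = 0 → weightProj ρ 1 (ρ g v) = v := fun g hg ↦ by
    obtain ⟨t, x, rfl⟩ := eq_torus_mul_unip g hg
    rw [rho_mul_apply, hu, ht, hfix]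
  have hκ1 : κ ≠ 1 := by
    rintro rfl
    have hall : ∀ g : SL(2, F), weightProj ρ 1 (ρ g v) = v := fun g ↦ by
      by_cases hg : g 1 0 = 0
      · exact hsmall g hg
      · rw [hbig g hg, one_smul]
    cases nonempty_fintype SL(2, F)
    have hS : ∑ g, ρ g v ≠ 0 := by
      intro h
      have := congrArg (weightProj ρ 1) h
      rw [map_sum, Finset.sum_congr rfl fun g _ ↦ hall g, map_zero, Finset.sum_const,
        ← Nat.cast_smul_eq_nsmul ℂ] at this
      simp [hv] at this
    refine hdim (Representation.IsIrreducible.finrank_eq_one_of_fixed (ρ := ρ) hS fun h ↦ ?_)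
    rw [map_sum]
    exact Fintype.sum_equiv (Equiv.mulLeft h) _ _ fun g ↦ (rho_mul_apply h g v).symm
  let L : (F → ℂ) →ₗ[ℂ] W × ℂ :=
    (Fintype.linearCombination ℂ fun r ↦ ρ (unip r * weyl) v).prod
      (Fintype.linearCombination ℂ fun _ ↦ (1 : ℂ))
  have hL : Function.Injective L := by
    refine (injective_iff_map_eq_zero L).mpr fun a ha ↦ funext fun s ↦ ?_
    have h1 : ∑ r, a r • ρ (unip r * weyl) v = 0 := congrArg Prod.fst ha
    have h2 : ∑ r, a r = 0 := by
      simpa [L, Fintype.linearCombination_apply] using congrArg Prod.snd ha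
    have h3 := congrArg (fun w ↦ weightProj ρ 1 (ρ (unip s * weyl)⁻¹ w)) h1
    simp only [map_sum, map_smul, map_zero, ← rho_mul_apply] at h3
    have h4 : ∀ r, weightProj ρ 1 (ρ ((unip s * weyl)⁻¹ * (unip r * weyl)) v) =
        κ • v + if r = s then (1 - κ) • v else 0 := by
      intro r
      have he : ((unip s * weyl)⁻¹ * (unip r * weyl) : SL(2, F)) 1 0 = s - r := by
        simp only [mul_entry, inv_10, inv_11]
        simp
        ring
      split_ifs with hrs
      · rw [hsmall _ (by rw [he, hrs, sub_self]), ← add_smul]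
        simp
      · rw [hbig _ (by rw [he]; exact sub_ne_zero.mpr (Ne.symm hrs)), add_zero]
    simp only [h4, smul_add, Finset.sum_add_distrib, ← Finset.sum_smul, h2, zero_smul, smul_ite,
      smul_zero, Finset.sum_ite_eq', Finset.mem_univ, if_true, zero_add, smul_eq_zero,
      sub_eq_zero, hv, or_false] at h3
    exact h3.resolve_right hκ1.symm
  simpa using LinearMap.finrank_le_finrank_of_injective hL

theorem exists_fixed_of_isAnisotropic (hneg : ρ (-1) = 1) (hW : finrank ℂ W ≠ 0)
    {g : SL(2, F)} (hg : IsAnisotropic g)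
    (htr : ∀ h : SL(2, F), IsAnisotropic h → LinearMap.trace ℂ W (ρ h) = 0) :
    ∃ w, w ≠ 0 ∧ ρ g w = w := by
  set P : Module.End ℂ W := ∑ k ∈ Finset.range (orderOf g), ρ (g ^ k) with hP
  have hterm : ∀ k, ∃ n : ℕ, LinearMap.trace ℂ W (ρ (g ^ k)) = n := by
    intro k
    rcases hg.pow k with h | h | h
    · exact ⟨finrank ℂ W, by rw [h, map_one, LinearMap.trace_one]⟩
    · exact ⟨finrank ℂ W, by rw [h, hneg, LinearMap.trace_one]⟩
    · exact ⟨0, by rw [htr _ h, Nat.cast_zero]⟩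
  choose n hn using hterm
  have hn0 : n 0 = finrank ℂ W := by
    have := hn 0
    rw [pow_zero, map_one, LinearMap.trace_one] at this
    exact_mod_cast this.symm
  have hP0 : P ≠ 0 := by
    intro h
    have h1 := congrArg (LinearMap.trace ℂ W) h
    rw [hP, map_sum, Finset.sum_congr rfl fun k _ ↦ hn k, map_zero] at h1
    have h2 : ∑ k ∈ Finset.range (orderOf g), n k = 0 := by exact_mod_cast h1
    exact hW (hn0 ▸ Finset.sum_eq_zero_iff.mp h2 0 (Finset.mem_range.mpr (orderOf_pos g)))
  obtain ⟨w, hw⟩ : ∃ w, P w ≠ 0 := by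
    by_contra! h
    exact hP0 (LinearMap.ext h)
  refine ⟨P w, hw, ?_⟩
  have hgP : ρ g * P = P := by
    rw [hP, Finset.mul_sum]
    simp only [← map_mul, ← pow_succ']
    have h1 := Finset.sum_range_succ (fun k ↦ ρ (g ^ k)) (orderOf g)
    rw [Finset.sum_range_succ', pow_orderOf_eq_one, pow_zero] at h1
    exact add_right_cancel h1
  exact LinearMap.congr_fun hgP w

/-- An irreducible representation of `SL₂(q)` of dimension `(q + 1) / 2` in which `-1` acts
trivially has the property that every group element fixes a nonzero vector. -/
theorem exists_fixed_of_finrank_eq [ρ.IsIrreducible] (hneg : ρ (-1) = 1) (h2 : (2 : F) ≠ 0)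
    (hcard : 3 < Fintype.card F) (hdim : 2 * finrank ℂ W = Fintype.card F + 1) (g : SL(2, F)) :
    ∃ w, w ≠ 0 ∧ ρ g w = w := by
  have hψ := AddChar.FiniteField.primitiveChar_to_Complex_isPrimitive F
  obtain ⟨h1, a, ha, hproj⟩ := finrank_weightProj_of_finrank_eq (ρ := ρ) h2 hcard hdim hψ
  obtain ⟨⟨v, hvr⟩, hv0, hspan⟩ := finrank_eq_one_iff'.mp h1
  have hv : v ≠ 0 := fun h ↦ hv0 (Subtype.ext h)
  have hone : ∀ w, ∃ c : ℂ, weightProj ρ 1 w = c • v := fun w ↦ by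
    obtain ⟨c, hc⟩ := hspan ⟨_, LinearMap.mem_range_self _ w⟩
    exact ⟨c, (congrArg Subtype.val hc).symm⟩
  obtain ⟨w₁, hw₁⟩ := hvr
  have hu : ∀ x, ρ (unip x) v = v := fun x ↦ by
    simpa [hw₁] using unip_weightProj (ρ := ρ) (χ := 1) x w₁
  by_cases hg : IsAnisotropic g
  · obtain ⟨s, hs⟩ : ∃ s, ρ (torus s) v ≠ v := by
      by_contra! ht
      have := card_le_finrank_add_one (ρ := ρ) (by omega) hv hu ht hone
      omega
    obtain ⟨z, hz⟩ := hone (ρ (torus s) v)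
    have hz' : ρ (torus s) v = z • v := by
      rw [← hz]
      refine (weightProj_of_forall fun x ↦ ?_).symm
      conv_lhs => rw [← hw₁, torus_weightProj]
      conv_rhs => rw [← hw₁, torus_weightProj]
      exact unip_weightProj x _
    refine exists_fixed_of_isAnisotropic hneg (by omega) hg fun h hh ↦
      trace_eq_zero_of_isAnisotropic h2 hv hu (z := z) (fun h ↦ hs ?_) hz' hone hh
    rw [hz', h, one_smul]
  · obtain ⟨p, h, hc, rfl⟩ := exists_conj_upper_of_not_isAnisotropic hg
    suffices ∃ w, w ≠ 0 ∧ ρ h w = w by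
      obtain ⟨w, hw, hfix⟩ := this
      refine ⟨ρ p w, fun h0 ↦ hw ?_, ?_⟩
      · simpa [← rho_mul_apply] using congrArg (ρ p⁻¹) h0
      · rw [← rho_mul_apply, inv_mul_cancel_right, rho_mul_apply, hfix]
    obtain ⟨t, x, rfl⟩ := eq_torus_mul_unip h hc
    obtain ⟨w, hw, hfix⟩ := exists_fixed_torus hneg hψ ha hproj
    by_cases ht : t ^ 2 = 1
    · exact ⟨v, hv, by rw [rho_mul_apply, hu, rho_torus_eq_one hneg ht, Module.End.one_apply]⟩
    · obtain ⟨y, hy⟩ := torus_mul_unip_conj t x fun h ↦ ht (Units.ext (by simpa using h))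
      refine ⟨ρ (unip y) w, fun h0 ↦ hw ?_, ?_⟩
      · simpa [← rho_mul_apply] using congrArg (ρ (unip y)⁻¹) h0
      · rw [hy, ← rho_mul_apply, inv_mul_cancel_right, rho_mul_apply, hfix]

end Irreducible

end SL2

/-- Let `F` be a finite field with `q` elements, `q ≡ 1 (mod 4)`. Every
irreducible complex character of `PSL₂(q)` of degree `(q + 1) / 2` is unisingular. -/
theorem PSL2_unisingular_of_deg_half_q_add_one (q : ℕ) (hq : q % 4 = 1)
    (F : Type) [Field F] [Fintype F] (hF : Fintype.card F = q)
    (V : FDRep ℂ (PSL2 F)) (hV : Simple V)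
    (hdeg : Module.finrank ℂ V = (q + 1) / 2) :
    V.IsUnisingular := by
  have h1 := Fintype.one_lt_card (α := F)
  have h2 : (2 : F) ≠ 0 := fun h ↦ by
    have : CharP F 2 := CharTwo.of_one_ne_zero_of_two_eq_zero one_ne_zero h
    have := FiniteField.even_card_of_char_two (ringChar.eq F 2)
    omega
  let ρ := V.ρ.comp (QuotientGroup.mk' (Subgroup.center (Matrix.SpecialLinearGroup (Fin 2) F)))
  have := V.isIrreducible_of_simple
  have : Representation.IsIrreducible ρ :=
    Representation.IsIrreducible.comp_of_surjective (QuotientGroup.mk'_surjective _)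
  have hneg : ρ (-1) = 1 := by
    have : QuotientGroup.mk' (Subgroup.center (Matrix.SpecialLinearGroup (Fin 2) F)) (-1) = 1 :=
      (QuotientGroup.eq_one_iff _).mpr (Subgroup.mem_center_iff.mpr fun g ↦ by simp)
    rw [MonoidHom.comp_apply, this, map_one]
  intro g
  obtain ⟨g, rfl⟩ := QuotientGroup.mk'_surjective _ g
  obtain ⟨w, hw, hfix⟩ := SL2.exists_fixed_of_finrank_eq (ρ := ρ) hneg h2 (by omega) (by omega) g
  exact Module.End.hasEigenvalue_of_hasEigenvector
    ⟨Module.End.mem_eigenspace_iff.mpr (hfix.trans (one_smul ℂ w).symm), hw⟩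
end
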